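/- Fix an integer ℓ ≥ 9 that is divisible by 3 and not divisible by 4. There exist ε > 0 and n₀ such that the following holds for every n ≥ n₀: let G be an oriented graph on n vertices with minimum semidegree δ±(G) ≥ (n+1)/4 when ℓ ≡ 3 (mod 4), and δ±(G) ≥ (n+2)/4 otherwise. If G contains a subgraph H with minimum semidegree δ±(H) ≥ n/4 − ε·n that is homomorphic to the directed cycle C₄, then G contains a directed cycle of length exactly ℓ. -/

import Mathlib

/-- The outdegree of a vertex `v` in the directed graph with edge relation `E`. -/
noncomputable def outDeg {n : ℕ} (E : Fin n → Fin n → Prop) (v : Fin n) : ℕ :=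
  {w | E v w}.ncard

/-- The indegree of a vertex `v` in the directed graph with edge relation `E`. -/
noncomputable def inDeg {n : ℕ} (E : Fin n → Fin n → Prop) (v : Fin n) : ℕ :=
  {w | E w v}.ncard

/-- The semidegree of a vertex: the minimum of its outdegree and indegree. -/
noncomputable def semiDeg {n : ℕ} (E : Fin n → Fin n → Prop) (v : Fin n) : ℕ :=
  min (outDeg E v) (inDeg E v)

/-- `E` is an oriented graph: no loops and no pair of opposite edges. -/
def Oriented {n : ℕ} (E : Fin n → Fin n → Prop) : Prop :=
  (∀ v, ¬ E v v) ∧ (∀ u v, E u v → ¬ E v u)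

/-- The graph contains a directed cycle of length exactly `t`:
`t` distinct vertices cyclically joined by edges. -/
def HasDiCycle {n : ℕ} (E : Fin n → Fin n → Prop) (t : ℕ) : Prop :=
  ∃ v : ZMod t → Fin n, Function.Injective v ∧ ∀ i, E (v i) (v (i + 1))

/-- The graph contains a closed directed walk of length `t` (vertices may repeat). -/
def HasClosedWalk {n : ℕ} (E : Fin n → Fin n → Prop) (t : ℕ) : Prop :=
  ∃ w : ℕ → Fin n, w 0 = w t ∧ ∀ i < t, E (w i) (w (i + 1))

/-- There is a directed path of length `t` from `x` to `y` (all vertices distinct). -/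
def HasPath {n : ℕ} (E : Fin n → Fin n → Prop) (x y : Fin n) (t : ℕ) : Prop :=
  ∃ u : Fin (t + 1) → Fin n, Function.Injective u ∧ u 0 = x ∧ u (Fin.last t) = y ∧
    ∀ i : Fin t, E (u i.castSucc) (u i.succ)

/-- The graph contains an `s`-shortcut: a directed path `v₀ v₁ ⋯ v_s` on distinct
vertices together with the additional edge `v₀ v_s`. -/
def HasShortcut {n : ℕ} (E : Fin n → Fin n → Prop) (s : ℕ) : Prop :=
  ∃ v : Fin (s + 1) → Fin n, Function.Injective v ∧
    (∀ i : Fin s, E (v i.castSucc) (v i.succ)) ∧ E (v 0) (v (Fin.last s))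

/-- The graph is homomorphic to the directed cycle `C_k`. -/
def HomToCycle {n : ℕ} (E : Fin n → Fin n → Prop) (k : ℕ) : Prop :=
  ∃ f : Fin n → ZMod k, ∀ u v, E u v → f v = f u + 1

namespace DiCycle

open Finset Classical

section Walks

variable {V : Type*}

/-- There is a walk of length `k` from `u` to `v`. -/
def IsWalk (E : V → V → Prop) : ℕ → V → V → Prop
  | 0, u, v => u = v
  | k + 1, u, v => ∃ w, E u w ∧ IsWalk E k w v

namespace IsWalk

variable {E : V → V → Prop} {a b c d e f u v w : V} {j k : ℕ}

lemma cons (h : E u v) (hw : IsWalk E k v w) : IsWalk E (k + 1) u w := ⟨v, h, hw⟩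

lemma append (h : IsWalk E j u v) (h' : IsWalk E k v w) : IsWalk E (j + k) u w := by
  induction j generalizing u with
  | zero => cases h; simpa using h'
  | succ j ih =>
    obtain ⟨x, hx, hj⟩ := h
    rw [Nat.succ_add]
    exact cons hx (ih hj)

lemma cast (h : IsWalk E j u v) (hjk : j = k) : IsWalk E k u v := hjk ▸ h

lemma one : IsWalk E 1 a b ↔ E a b := by
  constructor
  · rintro ⟨w, hw, rfl⟩; exact hw
  · intro h; exact ⟨b, h, rfl⟩

lemma two : IsWalk E 2 a c ↔ ∃ b, E a b ∧ E b c := by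
  constructor
  · rintro ⟨w, hw, x, hx, rfl⟩; exact ⟨w, hw, hx⟩
  · rintro ⟨b, h, h'⟩; exact ⟨b, h, c, h', rfl⟩

lemma mk_three (h₁ : E a b) (h₂ : E b c) (h₃ : E c d) : IsWalk E 3 a d :=
  ⟨b, h₁, c, h₂, d, h₃, rfl⟩

lemma mk_four (h₁ : E a b) (h₂ : E b c) (h₃ : E c d) (h₄ : E d e) : IsWalk E 4 a e :=
  ⟨b, h₁, c, h₂, d, h₃, e, h₄, rfl⟩

lemma mk_five (h₁ : E a b) (h₂ : E b c) (h₃ : E c d) (h₄ : E d e) (h₅ : E e f) :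
    IsWalk E 5 a f :=
  ⟨b, h₁, c, h₂, d, h₃, e, h₄, f, h₅, rfl⟩

lemma snoc (h : IsWalk E k u v) (h' : E v w) : IsWalk E (k + 1) u w :=
  h.append (one.2 h')

lemma flip_of (h : IsWalk E k u v) : IsWalk (flip E) k v u := by
  induction k generalizing u with
  | zero => exact Eq.symm h
  | succ k ih =>
    obtain ⟨x, hx, hk⟩ := h
    exact snoc (ih hk) hx

lemma flip_iff : IsWalk (flip E) k v u ↔ IsWalk E k u v :=
  ⟨fun h => flip_of h, flip_of⟩

lemma flip_no_closed {l : ℕ} (hno : ∀ u, ¬ IsWalk E l u u) : ∀ u, ¬ IsWalk (flip E) l u u :=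
  fun u hu => hno u (IsWalk.flip_iff.1 hu)

lemma mul (h : IsWalk E k u u) (m : ℕ) : IsWalk E (m * k) u u := by
  induction m with
  | zero => rw [Nat.zero_mul]; rfl
  | succ m ih => rw [Nat.succ_mul]; exact ih.append h

lemma comb (h : IsWalk E j u u) (h' : IsWalk E k u u) (p q l : ℕ) (hl : p * j + q * k = l) :
    IsWalk E l u u :=
  hl ▸ (h.mul p).append (h'.mul q)

end IsWalk

end Walks

section Acyclic

variable {V : Type*} {E : V → V → Prop}

/-- Every nonempty subset of `P` has a source and a sink. -/
def AcyclicOn (E : V → V → Prop) (P : Finset V) : Prop :=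
  ∀ Y ⊆ P, Y.Nonempty → (∃ y ∈ Y, ∀ w ∈ Y, ¬ E w y) ∧ ∃ y ∈ Y, ∀ w ∈ Y, ¬ E y w

lemma AcyclicOn.flip_of {P : Finset V} (h : AcyclicOn E P) : AcyclicOn (flip E) P :=
  fun Y hY hne => (h Y hY hne).symm

lemma AcyclicOn.mono {P Q : Finset V} (h : AcyclicOn E P) (hQ : Q ⊆ P) : AcyclicOn E Q :=
  fun Y hY hne => h Y (hY.trans hQ) hne

lemma acyclicOn_of_sources (hirr : ∀ v, ¬ E v v) {P : Finset V}
    (h : ∀ Y ⊆ P, Y.Nonempty → ∃ y ∈ Y, ∀ w ∈ Y, ¬ E w y) : AcyclicOn E P := by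
  intro Y hY hne
  refine ⟨h Y hY hne, ?_⟩
  induction Y using Finset.strongInduction with
  | H Y ih =>
    obtain ⟨s, hs, hsrc⟩ := h Y hY hne
    rcases (Y.erase s).eq_empty_or_nonempty with he | he
    · refine ⟨s, hs, fun w hw hsw => ?_⟩
      have : w ∉ Y.erase s := by rw [he]; simp
      rw [mem_erase] at this
      by_cases hws : w = s
      · subst hws; exact hirr _ hsw
      · exact this ⟨hws, hw⟩
    · obtain ⟨t, ht, htt⟩ := ih _ (erase_ssubset hs) ((erase_subset _ _).trans hY) he
      refine ⟨t, mem_of_mem_erase ht, fun w hw htw => ?_⟩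
      by_cases hws : w = s
      · subst hws; exact hsrc t (mem_of_mem_erase ht) htw
      · exact htt w (mem_erase.2 ⟨hws, hw⟩) htw

end Acyclic

section Neighbourhoods

variable {V : Type*} [Fintype V]

/-- The set of out-neighbours. -/
noncomputable def outN (E : V → V → Prop) (v : V) : Finset V := univ.filter fun w => E v w

/-- The set of in-neighbours. -/
noncomputable def inN (E : V → V → Prop) (v : V) : Finset V := univ.filter fun w => E w v

variable {E : V → V → Prop} {u v w : V}

@[simp] lemma mem_outN : w ∈ outN E v ↔ E v w := by simp [outN]

@[simp] lemma mem_inN : w ∈ inN E v ↔ E w v := by simp [inN]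

lemma outN_flip : outN (flip E) v = inN E v := rfl

lemma inN_flip : inN (flip E) v = outN E v := rfl

lemma sum_card_le_of_pairwise (L : List (Finset V))
    (h : L.Pairwise fun A B => ∀ v, v ∈ A → v ∈ B → False) :
    (L.map Finset.card).sum ≤ Fintype.card V := by
  suffices H : ∃ S : Finset V, (L.map Finset.card).sum ≤ #S ∧ ∀ v ∈ S, ∃ A ∈ L, v ∈ A by
    obtain ⟨S, hS, -⟩ := H
    exact hS.trans (card_le_univ S)
  induction L with
  | nil => exact ⟨∅, by simp⟩
  | cons A L ih =>
    rw [List.pairwise_cons] at h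
    obtain ⟨S, hS, hS'⟩ := ih h.2
    refine ⟨A ∪ S, ?_, ?_⟩
    · rw [card_union_of_disjoint]
      · simpa using hS
      · rw [disjoint_left]
        intro v hv hv'
        obtain ⟨B, hB, hvB⟩ := hS' v hv'
        exact h.1 B hB v hv hvB
    · intro v hv
      rcases mem_union.1 hv with hv | hv
      · exact ⟨A, by simp, hv⟩
      · obtain ⟨B, hB, hvB⟩ := hS' v hv
        exact ⟨B, by simp [hB], hvB⟩

lemma card_add_four_le {A B C D : Finset V} (h₁ : ∀ v, v ∈ A → v ∈ B → False)
    (h₂ : ∀ v, v ∈ A → v ∈ C → False) (h₃ : ∀ v, v ∈ A → v ∈ D → False)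
    (h₄ : ∀ v, v ∈ B → v ∈ C → False) (h₅ : ∀ v, v ∈ B → v ∈ D → False)
    (h₆ : ∀ v, v ∈ C → v ∈ D → False) : #A + #B + #C + #D ≤ Fintype.card V := by
  have := sum_card_le_of_pairwise [A, B, C, D] (by
    simp only [List.pairwise_cons, List.mem_cons, List.not_mem_nil, or_false, forall_eq_or_imp,
      forall_eq]
    tauto)
  simp at this
  omega

lemma card_add_five_le {A B C D F : Finset V} (h₁ : ∀ v, v ∈ A → v ∈ B → False)
    (h₂ : ∀ v, v ∈ A → v ∈ C → False) (h₃ : ∀ v, v ∈ A → v ∈ D → False)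
    (h₄ : ∀ v, v ∈ B → v ∈ C → False) (h₅ : ∀ v, v ∈ B → v ∈ D → False)
    (h₆ : ∀ v, v ∈ C → v ∈ D → False) (h₇ : ∀ v, v ∈ A → v ∈ F → False)
    (h₈ : ∀ v, v ∈ B → v ∈ F → False) (h₉ : ∀ v, v ∈ C → v ∈ F → False)
    (h₀ : ∀ v, v ∈ D → v ∈ F → False) :
    #A + #B + #C + #D + #F ≤ Fintype.card V := by
  have := sum_card_le_of_pairwise [A, B, C, D, F] (by
    simp only [List.pairwise_cons, List.mem_cons, List.not_mem_nil, or_false, forall_eq_or_imp,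
      forall_eq]
    tauto)
  simp at this
  omega

/-- The set of vertices reachable by a walk with length in `[1, k]`. -/
noncomputable def outBall (E : V → V → Prop) (k : ℕ) (v : V) : Finset V :=
  univ.filter fun w => ∃ j, 1 ≤ j ∧ j ≤ k ∧ IsWalk E j v w

lemma mem_outBall {k : ℕ} : w ∈ outBall E k v ↔ ∃ j, 1 ≤ j ∧ j ≤ k ∧ IsWalk E j v w := by
  simp [outBall]

lemma outN_subset_outBall {k : ℕ} (hk : 1 ≤ k) : outN E v ⊆ outBall E k v := fun _ hw =>
  mem_outBall.2 ⟨1, le_rfl, hk, IsWalk.one.2 (mem_outN.1 hw)⟩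

/-- In a triangle-free oriented graph some vertex of `X` has small outdegree inside `X`. -/
lemma exists_small_outdegree (hE : ∀ u v, E u v → ¬ E v u)
    (h3 : ∀ a b c, E a b → E b c → E c a → False) (X : Finset V) (hX : X.Nonempty) :
    ∃ v ∈ X, 5 * #(outN E v ∩ X) ≤ 2 * #X := by
  by_contra! hcon
  have key : ∀ Y : Finset V, ∑ v ∈ Y, #(outN E v ∩ Y) = ∑ v ∈ Y, #(inN E v ∩ Y) := by
    intro Y
    have := Finset.sum_card_bipartiteAbove_eq_sum_card_bipartiteBelow (s := Y) (t := Y) E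
    convert this using 3 with v hv v hv <;>
    · ext w; simp [Finset.bipartiteAbove, Finset.bipartiteBelow, and_comm]
  obtain ⟨v, hv, hvin⟩ : ∃ v ∈ X, 2 * #X < 5 * #(inN E v ∩ X) := by
    by_contra! h
    have h1 := Finset.sum_lt_sum_of_nonempty hX hcon
    have h2 := Finset.sum_le_sum h
    rw [← Finset.mul_sum] at h1 h2
    rw [← Finset.mul_sum, key] at h1
    rw [← Finset.mul_sum] at h2
    omega
  have hYc := hcon v hv
  set Y := outN E v ∩ X with hY
  have hYne : Y.Nonempty := by
    rw [← card_pos]; omega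
  obtain ⟨w, hw, hwY⟩ : ∃ w ∈ Y, 2 * #(outN E w ∩ Y) ≤ #Y := by
    by_contra! h
    have h1 := Finset.sum_lt_sum_of_nonempty hYne h
    have h2 : ∑ w ∈ Y, (#(outN E w ∩ Y) + #(inN E w ∩ Y)) ≤ ∑ w ∈ Y, #Y := by
      refine Finset.sum_le_sum fun _ _ => ?_
      rw [← card_union_of_disjoint]
      · exact card_le_card (union_subset inter_subset_right inter_subset_right)
      · rw [disjoint_left]
        simp only [mem_inter, mem_outN, mem_inN]
        exact fun u hu hu' => hE _ _ hu.1 hu'.1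
    rw [sum_add_distrib, ← key, ← two_mul, mul_sum] at h2
    omega
  simp only [hY, mem_inter, mem_outN] at hw
  have hwX := hcon w hw.2
  have hdis : #(Y ∪ ((outN E w ∩ X) \ (outN E w ∩ Y)) ∪ (inN E v ∩ X)) ≤ #X := by
    refine card_le_card ?_
    intro u hu
    simp only [hY, mem_union, mem_inter, mem_sdiff] at hu
    tauto
  rw [card_union_of_disjoint, card_union_of_disjoint, card_sdiff_of_subset] at hdis
  · have : #(outN E w ∩ Y) ≤ #(outN E w ∩ X) :=
      card_le_card (inter_subset_inter_left inter_subset_right)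
    omega
  · exact inter_subset_inter_left inter_subset_right
  · rw [disjoint_left]
    simp only [mem_inter, mem_sdiff]
    tauto
  · rw [disjoint_left]
    simp only [hY, mem_union, mem_inter, mem_sdiff, mem_outN, mem_inN]
    rintro u (hu | hu) hu'
    · exact hE _ _ hu.1 hu'.1
    · exact h3 _ _ _ hw.1 hu.1.1 hu'.1

end Neighbourhoods

section ClosedWalks

variable {V : Type*} [Fintype V]

/-- A triangle-free oriented graph with semidegree at least `d`, on at most `4 d + s` vertices. -/
structure NearQuarter (E : V → V → Prop) (d s : ℕ) : Prop where
  asymm : ∀ u v, E u v → ¬ E v u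
  no3 : ∀ a b c, E a b → E b c → E c a → False
  le_out : ∀ v, d ≤ #(outN E v)
  le_in : ∀ v, d ≤ #(inN E v)
  card_le : Fintype.card V ≤ 4 * d + s
  small : 60 * s ≤ d
  pos : 0 < d

lemma exists_walk_of_card_lt {E : V → V → Prop} {u v : V} {i j : ℕ}
    (hc : Fintype.card V < #(outBall E i u) + #(outBall (flip E) j v)) :
    ∃ t, 2 ≤ t ∧ t ≤ i + j ∧ IsWalk E t u v := by
  obtain ⟨w, hw⟩ : (outBall E i u ∩ outBall (flip E) j v).Nonempty := by
    rw [← card_pos]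
    have h1 := card_union_add_card_inter (outBall E i u) (outBall (flip E) j v)
    have h2 := card_le_univ (outBall E i u ∪ outBall (flip E) j v)
    omega
  rw [mem_inter, mem_outBall, mem_outBall] at hw
  obtain ⟨⟨a, ha, ha', hwa⟩, ⟨b, hb, hb', hwb⟩⟩ := hw
  exact ⟨a + b, by omega, by omega, hwa.append (IsWalk.flip_iff.1 hwb)⟩

namespace NearQuarter

variable {E : V → V → Prop} {d s l : ℕ} {u v w : V}

lemma flip_of (h : NearQuarter E d s) : NearQuarter (flip E) d s where
  asymm _ _ h1 h2 := h.asymm _ _ h1 h2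
  no3 _ _ _ h1 h2 h3 := h.no3 _ _ _ h2 h1 h3
  le_out := h.le_in
  le_in := h.le_out
  card_le := h.card_le
  small := h.small
  pos := h.pos

lemma irrefl (h : NearQuarter E d s) (v : V) : ¬ E v v := fun hv => h.asymm _ _ hv hv

lemma outN_nonempty (h : NearQuarter E d s) (v : V) : (outN E v).Nonempty := by
  rw [← card_pos]; have := h.le_out v; have := h.pos; omega

lemma card_outBall_succ (h : NearQuarter E d s) (v : V) {k : ℕ} (hk : 1 ≤ k) :
    5 * d + 3 * #(outBall E k v) ≤ 5 * #(outBall E (k + 1) v) := by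
  obtain ⟨x, hx, hx'⟩ := exists_small_outdegree h.asymm h.no3 (outBall E k v)
    ((h.outN_nonempty v).mono (outN_subset_outBall hk))
  have hsub : outBall E k v ∪ (outN E x \ outBall E k v) ⊆ outBall E (k + 1) v := by
    intro w hw
    rw [mem_outBall]
    rcases mem_union.1 hw with hw | hw
    · obtain ⟨j, h1, h2, h3⟩ := mem_outBall.1 hw
      exact ⟨j, h1, by omega, h3⟩
    · obtain ⟨j, h1, h2, h3⟩ := mem_outBall.1 hx
      exact ⟨j + 1, by omega, by omega, h3.snoc (mem_outN.1 (mem_sdiff.1 hw).1)⟩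
  have h1 := card_le_card hsub
  rw [card_union_of_disjoint disjoint_sdiff] at h1
  have h2 := card_sdiff_add_card_inter (outN E x) (outBall E k v)
  have h3 := h.le_out x
  omega

lemma le_card_outBall_one (h : NearQuarter E d s) (v : V) : d ≤ #(outBall E 1 v) :=
  (h.le_out v).trans (card_le_card (outN_subset_outBall le_rfl))

lemma exists_walk_le_eight (h : NearQuarter E d s) (u v : V) :
    ∃ t, 2 ≤ t ∧ t ≤ 8 ∧ IsWalk E t u v := by
  apply exists_walk_of_card_lt (i := 4) (j := 4)
  have a1 := h.le_card_outBall_one u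
  have a2 := h.card_outBall_succ u (k := 1) (by norm_num)
  have a3 := h.card_outBall_succ u (k := 2) (by norm_num)
  have a4 := h.card_outBall_succ u (k := 3) (by norm_num)
  have b1 := h.flip_of.le_card_outBall_one v
  have b2 := h.flip_of.card_outBall_succ v (k := 1) (by norm_num)
  have b3 := h.flip_of.card_outBall_succ v (k := 2) (by norm_num)
  have b4 := h.flip_of.card_outBall_succ v (k := 3) (by norm_num)
  have := h.card_le
  have := h.small
  have := h.pos
  norm_num at *
  omega

lemma acyclicOn_outN (h : NearQuarter E d s) (hl : 9 ≤ l) (hno : ∀ u, ¬ IsWalk E l u u) (z : V) :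
    AcyclicOn E (outN E z) := by
  refine acyclicOn_of_sources h.irrefl fun Y hY ⟨p, hp⟩ => ?_
  by_contra! hcon
  have key : ∀ k, ∀ y ∈ Y, IsWalk E (k + 1) z y := by
    intro k
    induction k with
    | zero => exact fun y hy => IsWalk.one.2 (mem_outN.1 (hY hy))
    | succ k ih =>
      intro y hy
      obtain ⟨w, hw, hwy⟩ := hcon y hy
      exact (ih w hw).snoc hwy
  obtain ⟨t, h2, h8, ht⟩ := h.exists_walk_le_eight p z
  exact hno z (((key (l - t - 1) p hp).append ht).cast (by omega))

lemma two_mul_le_card_outBall_two (h : NearQuarter E d s) (hv : AcyclicOn E (outN E v)) :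
    2 * d ≤ #(outBall E 2 v) := by
  obtain ⟨-, p, hp, hp'⟩ := hv _ subset_rfl (h.outN_nonempty v)
  have hsub : outN E v ∪ outN E p ⊆ outBall E 2 v := by
    refine union_subset (outN_subset_outBall (by norm_num)) fun w hw => ?_
    exact mem_outBall.2 ⟨2, by norm_num, le_rfl, IsWalk.two.2 ⟨p, mem_outN.1 hp, mem_outN.1 hw⟩⟩
  have h1 := card_le_card hsub
  rw [card_union_of_disjoint] at h1
  · have := h.le_out v
    have := h.le_out p
    omega
  · rw [disjoint_left]
    exact fun w hw hw' => hp' w hw (mem_outN.1 hw')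

lemma exists_walk_le_five (h : NearQuarter E d s) (hl : 9 ≤ l) (hno : ∀ u, ¬ IsWalk E l u u)
    (u v : V) : ∃ t, 2 ≤ t ∧ t ≤ 5 ∧ IsWalk E t u v := by
  apply exists_walk_of_card_lt (i := 3) (j := 2)
  have a1 := h.two_mul_le_card_outBall_two (h.acyclicOn_outN hl hno u)
  have b1 := h.flip_of.two_mul_le_card_outBall_two
    (h.flip_of.acyclicOn_outN hl (IsWalk.flip_no_closed hno) v)
  have a2 := h.card_outBall_succ u (k := 2) (by norm_num)
  have := h.card_le
  have := h.small
  have := h.pos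
  norm_num at *
  omega

lemma closed_four_or_five (h : NearQuarter E d s) (hl : 9 ≤ l) (hno : ∀ u, ¬ IsWalk E l u u)
    (v : V) : IsWalk E 4 v v ∨ IsWalk E 5 v v := by
  obtain ⟨t, h2, h5, ht⟩ := h.exists_walk_le_five hl hno v v
  interval_cases t
  · obtain ⟨w, hw, hw'⟩ := IsWalk.two.1 ht
    exact absurd hw' (h.asymm _ _ hw)
  · obtain ⟨a, ha, b, hb, hc⟩ := ht
    exact (h.no3 _ _ _ ha hb (IsWalk.one.1 hc)).elim
  · exact Or.inl ht
  · exact Or.inr ht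

/-- A pair joined by walks of lengths one and two forces a closed walk of any admissible
length other than nine. -/
lemma eq_nine (h : NearQuarter E d s) (hl : 9 ≤ l) (hno : ∀ u, ¬ IsWalk E l u u) (h3 : 3 ∣ l)
    (h4 : ¬ 4 ∣ l) {x z : V} (h1 : E x z) (h2 : IsWalk E 2 x z) : l = 9 := by
  by_contra hne
  obtain ⟨q, hq2, hq5, hq⟩ := h.exists_walk_le_five hl hno z x
  have c1 : IsWalk E (1 + q) x x := (IsWalk.one.2 h1).append hq
  have c2 : IsWalk E (2 + q) x x := h2.append hq
  have c45 := h.closed_four_or_five hl hno x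
  have comb : ∀ a b p r, IsWalk E a x x → IsWalk E b x x → p * a + r * b = l → False :=
    fun a b p r ha hb hpr => hno x (ha.comb hb p r l hpr)
  obtain ⟨m, rfl⟩ := h3
  interval_cases q
  · exact comb _ _ m 0 c1 c1 (by ring)
  · refine comb _ _ ((3 * m - 5 * (3 * m % 4)) / 4) (3 * m % 4) c1 c2 ?_
    omega
  · by_cases hm : 3 * m = 27
    · exact comb _ _ 3 2 c1 c2 (by omega)
    · have := Nat.mod_add_div (3 * m) 5
      have : 3 * m ≠ 9 := hne
      refine comb _ _ ((3 * m - 6 * (3 * m % 5)) / 5) (3 * m % 5) c1 c2 ?_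
      omega
  · by_cases hm : 3 * m = 15
    · rcases c45 with c | c
      · exact comb _ _ 2 1 c c2 (by omega)
      · exact comb _ _ 3 0 c c (by omega)
    · refine comb _ _ ((3 * m - 7 * (3 * m % 6)) / 6) (3 * m % 6) c1 c2 ?_
      omega

end NearQuarter

end ClosedWalks

section FlexPairs

variable {V : Type*} [Fintype V]

/-- The structure around a pair `x`, `z` joined by walks of lengths one and two, chosen
extremal, in a graph without closed walks of length nine. -/
structure FlexPair (E : V → V → Prop) (d s : ℕ) (x z : V) : Prop extends NearQuarter E d s where
  no9 : ∀ u, ¬ IsWalk E 9 u u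
  edge : E x z
  path : ∃ y, E x y ∧ E y z
  acyclic_out : AcyclicOn E (outBall E 2 z)
  acyclic_in : AcyclicOn E (outBall (flip E) 2 x)
  no_common_out : ∀ a, E z a → E x a → False
  no_common_in : ∀ b, E b x → E b z → False

namespace FlexPair

variable {E : V → V → Prop} {d s : ℕ} {x z : V}

lemma flip_of (h : FlexPair E d s x z) : FlexPair (flip E) d s z x where
  toNearQuarter := h.toNearQuarter.flip_of
  no9 := IsWalk.flip_no_closed h.no9
  edge := h.edge
  path := let ⟨y, h1, h2⟩ := h.path; ⟨y, h2, h1⟩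
  acyclic_out := h.acyclic_in.flip_of
  acyclic_in := h.acyclic_out.flip_of
  no_common_out := h.no_common_in
  no_common_in := h.no_common_out

lemma no45 (h : FlexPair E d s x z) {v : V} (h4 : IsWalk E 4 v v) (h5 : IsWalk E 5 v v) :
    False := h.no9 v (h4.append h5)

lemma no_path (h : FlexPair E d s x z) {a b : V} (h1 : E z a) (h2 : E a b) (h3 : E b x) :
    False := by
  obtain ⟨y, hy, hy'⟩ := h.path
  exact h.no45 (IsWalk.mk_four h1 h2 h3 h.edge) (IsWalk.mk_five h1 h2 h3 hy hy')

lemma mem_ball (_h : FlexPair E d s x z) {v : V} :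
    v ∈ outBall E 2 z ↔ E z v ∨ ∃ a, E z a ∧ E a v := by
  rw [mem_outBall]
  constructor
  · rintro ⟨j, h1, h2, hj⟩
    interval_cases j
    · exact Or.inl (IsWalk.one.1 hj)
    · exact Or.inr (IsWalk.two.1 hj)
  · rintro (hv | hv)
    · exact ⟨1, by norm_num, by norm_num, IsWalk.one.2 hv⟩
    · exact ⟨2, by norm_num, by norm_num, IsWalk.two.2 hv⟩

lemma ball_not_to_dest (h : FlexPair E d s x z) {v : V} (hv : v ∈ outBall E 2 z) (hvz : E v z) :
    False := by
  rcases h.mem_ball.1 hv with hv | ⟨a, ha, hav⟩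
  · exact h.asymm _ _ hv hvz
  · exact h.no3 _ _ _ ha hav hvz

lemma ball_not_to_start (h : FlexPair E d s x z) {v : V} (hv : v ∈ outBall E 2 z) (hvx : E v x) :
    False := by
  rcases h.mem_ball.1 hv with hv | ⟨a, ha, hav⟩
  · exact h.no3 _ _ _ hv hvx h.edge
  · exact h.no_path ha hav hvx

lemma acyclic_outN (h : FlexPair E d s x z) (v : V) : AcyclicOn E (outN E v) :=
  h.acyclicOn_outN (l := 9) le_rfl h.no9 v

lemma exists_sink_outN (h : FlexPair E d s x z) :
    ∃ p, E z p ∧ ∀ w, E z w → ¬ E p w := by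
  obtain ⟨-, p, hp, hp'⟩ := h.acyclic_outN z _ subset_rfl (h.outN_nonempty z)
  exact ⟨p, mem_outN.1 hp, fun w hw => hp' w (mem_outN.2 hw)⟩

lemma exists_sink_ball (h : FlexPair E d s x z) :
    ∃ a p, E z a ∧ E a p ∧ ∀ w ∈ outBall E 2 z, ¬ E p w := by
  obtain ⟨-, p, hp, hp'⟩ := h.acyclic_out _ subset_rfl
    ((h.outN_nonempty z).mono (outN_subset_outBall (by norm_num)))
  rcases h.mem_ball.1 hp with hz | ⟨a, ha, hap⟩
  · obtain ⟨q, hq⟩ := h.outN_nonempty p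
    rw [mem_outN] at hq
    exact (hp' q (h.mem_ball.2 (Or.inr ⟨p, hz, hq⟩)) hq).elim
  · exact ⟨a, p, ha, hap, hp'⟩

/-- The four disjoint sets `N⁺(z)`, `N⁻(x)`, `N⁺(p)`, `N⁻(z)`, where `p` is a sink
of `N⁺(z)`. -/
lemma card_four (h : FlexPair E d s x z) {p : V} (hp : E z p) (hp' : ∀ w, E z w → ¬ E p w) :
    #(outN E z) + #(inN E x) + #(outN E p) + #(inN E z) ≤ 4 * d + s := by
  refine le_trans (card_add_four_le ?_ ?_ ?_ ?_ ?_ ?_) h.card_le <;>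
  simp only [mem_outN, mem_inN]
  · exact fun v h1 h2 => h.no3 _ _ _ h1 h2 h.edge
  · exact fun v h1 h2 => hp' v h1 h2
  · exact fun v h1 h2 => h.asymm _ _ h1 h2
  · exact fun v h1 h2 => h.no_path hp h2 h1
  · exact h.no_common_in
  · exact fun v h1 h2 => h.no3 _ _ _ hp h1 h2

lemma two_mul_le_card_ball (h : FlexPair E d s x z) : 2 * d ≤ #(outBall E 2 z) :=
  h.two_mul_le_card_outBall_two (h.acyclic_outN z)

section NoFourWalk

variable (h : FlexPair E d s x z) (hI : ¬ IsWalk E 4 z x)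

include h hI

/-- From a vertex of `N⁺(z)` without out-neighbours there, one reaches most of `N⁻(z)`
in two steps. -/
lemma exists_two_steps {a : V} (ha : E z a) (ha' : ∀ w, E z w → ¬ E a w) {D : Finset V}
    (hD : D ⊆ inN E z) (hDc : d ≤ #D + s) : ∃ c e, E a c ∧ E c e ∧ e ∈ D := by
  by_contra! hcon
  set U := (outBall E 2 z).filter fun u => ∀ e ∈ D, ¬ E u e with hU
  have hAU : ∀ v, E z v → v ∈ U := fun v hv => by
    rw [hU, mem_filter, h.mem_ball]
    exact ⟨Or.inl hv, fun e he hve => h.no3 _ _ _ hv hve (mem_inN.1 (hD he))⟩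
  have hA2U : ∀ v, E a v → v ∈ U := fun v hv => by
    rw [hU, mem_filter, h.mem_ball]
    exact ⟨Or.inr ⟨a, ha, hv⟩, fun e he hve => hcon v e hv hve he⟩
  obtain ⟨-, t, ht, ht'⟩ := h.acyclic_out U (filter_subset _ _) ⟨a, hAU a ha⟩
  rw [hU, mem_filter] at ht
  have key : #(outN E z) + #(outN E a) + #(outN E t) + #(inN E x) + #D ≤ 4 * d + s := by
    refine le_trans (card_add_five_le ?_ ?_ ?_ ?_ ?_ ?_ ?_ ?_ ?_ ?_) h.card_le <;>
    simp only [mem_outN, mem_inN]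
    · exact fun v h1 h2 => ha' v h1 h2
    · exact fun v h1 h2 => ht' v (hAU v h1) h2
    · exact fun v h1 h2 => h.no3 _ _ _ h1 h2 h.edge
    · exact fun v h1 h2 => ht' v (hA2U v h1) h2
    · exact fun v h1 h2 => h.no_path ha h1 h2
    · intro v h1 h2
      rcases h.mem_ball.1 ht.1 with h3 | ⟨b, hb, hbt⟩
      · exact h.no_path h3 h1 h2
      · exact hI (IsWalk.mk_four hb hbt h1 h2)
    · exact fun v h1 h2 => h.asymm _ _ h1 (mem_inN.1 (hD h2))
    · exact fun v h1 h2 => h.no3 _ _ _ ha h1 (mem_inN.1 (hD h2))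
    · exact fun v h1 h2 => ht.2 v h2 h1
    · exact fun v h1 h2 => h.no_common_in v h1 (mem_inN.1 (hD h2))
  have := h.le_out z
  have := h.le_out a
  have := h.le_out t
  have := h.le_in x
  have := h.small
  have := h.pos
  omega

lemma closed_four : IsWalk E 4 z z := by
  obtain ⟨a, p, ha, hap, hp⟩ := h.exists_sink_ball
  obtain ⟨q, hq, hq'⟩ := h.exists_sink_outN
  by_contra hcon
  have key : #(outN E z) + #(outN E q) + #(outN E p) + #(inN E x) + #(inN E z) ≤ 4 * d + s := by
    refine le_trans (card_add_five_le ?_ ?_ ?_ ?_ ?_ ?_ ?_ ?_ ?_ ?_) h.card_le <;>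
    simp only [mem_outN, mem_inN]
    · exact fun v h1 h2 => hq' v h1 h2
    · exact fun v h1 h2 => hp v (h.mem_ball.2 (Or.inl h1)) h2
    · exact fun v h1 h2 => h.no3 _ _ _ h1 h2 h.edge
    · exact fun v h1 h2 => hp v (h.mem_ball.2 (Or.inr ⟨q, hq, h1⟩)) h2
    · exact fun v h1 h2 => h.no_path hq h1 h2
    · exact fun v h1 h2 => hI (IsWalk.mk_four ha hap h1 h2)
    · exact fun v h1 h2 => h.asymm _ _ h1 h2
    · exact fun v h1 h2 => h.no3 _ _ _ hq h1 h2
    · exact fun v h1 h2 => hcon (IsWalk.mk_four ha hap h1 h2)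
    · exact h.no_common_in
  have := h.le_out z
  have := h.le_out q
  have := h.le_out p
  have := h.le_in x
  have := h.le_in z
  have := h.small
  have := h.pos
  omega

lemma no_closed_five (h5 : IsWalk E 5 z z) : False := h.no45 (h.closed_four hI) h5

lemma independent_outN {a b : V} (ha : E z a) (hb : E z b) (hab : E a b) : False := by
  set Y := (outN E z).filter fun v => ∃ w, E z w ∧ E w v with hY
  obtain ⟨-, t, ht, ht'⟩ := h.acyclic_outN z Y (filter_subset _ _)
    ⟨b, by rw [hY, mem_filter, mem_outN]; exact ⟨hb, a, ha, hab⟩⟩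
  rw [hY, mem_filter, mem_outN] at ht
  obtain ⟨hzt, w, hzw, hwt⟩ := ht
  have hsink : ∀ v, E z v → ¬ E t v := fun v hv htv =>
    ht' v (by rw [hY, mem_filter, mem_outN]; exact ⟨hv, t, hzt, htv⟩) htv
  obtain ⟨c, e, hc, hce, he⟩ := h.exists_two_steps hI hzt hsink (D := inN E z) subset_rfl
    (by have := h.le_in z; omega)
  exact h.no_closed_five hI (IsWalk.mk_five hzw hwt hc hce (mem_inN.1 he))

end NoFourWalk

omit [Fintype V] in
lemma no_four_flip (hI : ¬ IsWalk E 4 z x) : ¬ IsWalk (flip E) 4 x z :=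
  fun hw => hI (IsWalk.flip_iff.1 hw)

section NoFourWalk

variable (h : FlexPair E d s x z) (hI : ¬ IsWalk E 4 z x)

include h hI

/-- No in-neighbour of `z` has an out-neighbour in `N⁺(z)`. -/
lemma no_middle_to_outN {y a : V} (hyz : E y z) (hya : E y a) (hza : E z a) :
    False := by
  obtain ⟨a', p, ha', hap, hp⟩ := h.exists_sink_ball
  obtain ⟨q, hq, hq'⟩ := h.exists_sink_outN
  obtain ⟨b, hbx, hby⟩ : ∃ b, E b x ∧ E b y := by
    by_contra! hcon
    have key : #(outN E z) + #(outN E a) + #(outN E p) + #(inN E y) + #(inN E x) ≤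
        4 * d + s := by
      refine le_trans (card_add_five_le ?_ ?_ ?_ ?_ ?_ ?_ ?_ ?_ ?_ ?_) h.card_le <;>
      simp only [mem_outN, mem_inN]
      · exact fun v h1 h2 => h.independent_outN hI hza h1 h2
      · exact fun v h1 h2 => hp v (h.mem_ball.2 (Or.inl h1)) h2
      · exact fun v h1 h2 => h.no3 _ _ _ h1 h2 hyz
      · exact fun v h1 h2 => hp v (h.mem_ball.2 (Or.inr ⟨a, hza, h1⟩)) h2
      · exact fun v h1 h2 => h.no3 _ _ _ hya h1 h2
      · exact fun v h1 h2 => h.no_closed_five hI (IsWalk.mk_five ha' hap h1 h2 hyz)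
      · exact fun v h1 h2 => h.no3 _ _ _ h1 h2 h.edge
      · exact fun v h1 h2 => h.no_path hza h1 h2
      · exact fun v h1 h2 => hI (IsWalk.mk_four ha' hap h1 h2)
      · exact fun v h1 h2 => hcon v h2 h1
    have := h.le_out z
    have := h.le_out a
    have := h.le_out p
    have := h.le_in y
    have := h.le_in x
    have := h.small
    have := h.pos
    omega
  have hDc : d ≤ #(inN E z ∩ inN E b) + s := by
    have key : #(outN E z) + #(inN E x) + #(outN E q) + #(inN E z ∪ inN E b) ≤ 4 * d + s := by
      refine le_trans (card_add_four_le ?_ ?_ ?_ ?_ ?_ ?_) h.card_le <;>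
      simp only [mem_outN, mem_inN, mem_union]
      · exact fun v h1 h2 => h.no3 _ _ _ h1 h2 h.edge
      · exact fun v h1 h2 => hq' v h1 h2
      · rintro v h1 (h2 | h2)
        · exact h.asymm _ _ h1 h2
        · exact h.no_path h1 h2 hbx
      · exact fun v h1 h2 => h.no_path hq h2 h1
      · rintro v h1 (h2 | h2)
        · exact h.no_common_in v h1 h2
        · exact h.flip_of.independent_outN (no_four_flip hI) hbx h1 h2
      · rintro v h1 (h2 | h2)
        · exact h.no3 _ _ _ hq h1 h2
        · exact hI (IsWalk.mk_four hq h1 h2 hbx)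
    have := card_union_add_card_inter (inN E z) (inN E b)
    have := h.le_out z
    have := h.le_in x
    have := h.le_out q
    have := h.le_in z
    have := h.le_in b
    omega
  obtain ⟨c, e, hac, hce, he⟩ := h.exists_two_steps hI hza
    (fun w hw hw' => h.independent_outN hI hza hw hw') inter_subset_left hDc
  rw [mem_inter, mem_inN, mem_inN] at he
  exact h.no45 (IsWalk.mk_four he.1 hza hac hce) (IsWalk.mk_five he.2 hby hya hac hce)

lemma false_of_no_four_walk : False := by
  obtain ⟨y, hxy, hyz⟩ := h.path
  have h' := h.flip_of
  have hI' := no_four_flip hI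
  obtain ⟨a, p, ha, hap, hp⟩ := h.exists_sink_ball
  obtain ⟨q, hq, hq'⟩ := h.exists_sink_outN
  obtain ⟨b, m, hb, hbm, hm⟩ := h'.exists_sink_ball
  obtain ⟨n, hn, hn'⟩ := h'.exists_sink_outN
  simp only [flip] at hb hbm hm hn hn'
  obtain ⟨e, hye, hen⟩ : ∃ e, E y e ∧ E e n := by
    by_contra! hcon
    have key : #(outN E z) + #(inN E x) + #(inN E n) + #(inN E m) + #(outN E y) ≤
        4 * d + s := by
      refine le_trans (card_add_five_le ?_ ?_ ?_ ?_ ?_ ?_ ?_ ?_ ?_ ?_) h.card_le <;>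
      simp only [mem_outN, mem_inN]
      · exact fun v h1 h2 => h.no3 _ _ _ h1 h2 h.edge
      · exact fun v h1 h2 => h.no_path h1 h2 hn
      · exact fun v h1 h2 => hI (IsWalk.mk_four h1 h2 hbm hb)
      · exact fun v h1 h2 => hn' v h1 h2
      · exact fun v h1 h2 => hm v (h'.mem_ball.2 (Or.inl h1)) h2
      · exact fun v h1 h2 => hm v (h'.mem_ball.2 (Or.inr ⟨n, hn, h1⟩)) h2
      · exact fun v h1 h2 => h.no_middle_to_outN hI hyz h2 h1
      · exact fun v h1 h2 => h.no3 _ _ _ h2 h1 hxy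
      · exact fun v h1 h2 => hcon v h2 h1
      · exact fun v h1 h2 => h'.no_closed_five hI'
          (IsWalk.flip_iff.2 (IsWalk.mk_five hxy h2 h1 hbm hb))
    have := h.le_out z
    have := h.le_in x
    have := h.le_in n
    have := h.le_in m
    have := h.le_out y
    have := h.small
    have := h.pos
    omega
  have k1 : #(outN E z) + #(inN E x) + #(outN E p) + #(outN E q ∪ inN E y) ≤ 4 * d + s := by
    refine le_trans (card_add_four_le ?_ ?_ ?_ ?_ ?_ ?_) h.card_le <;>
    simp only [mem_outN, mem_inN, mem_union]
    · exact fun v h1 h2 => h.no3 _ _ _ h1 h2 h.edge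
    · exact fun v h1 h2 => hp v (h.mem_ball.2 (Or.inl h1)) h2
    · rintro v h1 (h2 | h2)
      · exact hq' v h1 h2
      · exact h.no3 _ _ _ h1 h2 hyz
    · exact fun v h1 h2 => hI (IsWalk.mk_four ha hap h2 h1)
    · rintro v h1 (h2 | h2)
      · exact h.no_path hq h2 h1
      · exact h'.no_middle_to_outN hI' hxy h2 h1
    · rintro v h1 (h2 | h2)
      · exact hp v (h.mem_ball.2 (Or.inr ⟨q, hq, h2⟩)) h1
      · exact h.no_closed_five hI (IsWalk.mk_five ha hap h1 h2 hyz)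
  have k2 : #(outN E z) + #(inN E x) + #(inN E n) + #(outN E q ∪ outN E x) ≤ 4 * d + s := by
    refine le_trans (card_add_four_le ?_ ?_ ?_ ?_ ?_ ?_) h.card_le <;>
    simp only [mem_outN, mem_inN, mem_union]
    · exact fun v h1 h2 => h.no3 _ _ _ h1 h2 h.edge
    · exact fun v h1 h2 => h.no_path h1 h2 hn
    · rintro v h1 (h2 | h2)
      · exact hq' v h1 h2
      · exact h.no_common_out v h1 h2
    · exact fun v h1 h2 => hn' v h1 h2
    · rintro v h1 (h2 | h2)
      · exact h.no_path hq h2 h1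
      · exact h.asymm _ _ h1 h2
    · rintro v h1 (h2 | h2)
      · exact hI (IsWalk.mk_four hq h2 h1 hn)
      · exact h.no3 _ _ _ h2 h1 hn
  have k3 : ((outN E q ∩ inN E y) ∩ (outN E q ∩ outN E x)).Nonempty := by
    rw [← card_pos]
    have c1 := card_union_add_card_inter (outN E q) (inN E y)
    have c2 := card_union_add_card_inter (outN E q) (outN E x)
    have c3 := card_union_add_card_inter (outN E q ∩ inN E y) (outN E q ∩ outN E x)
    have c4 : #(outN E q ∩ inN E y ∪ outN E q ∩ outN E x) ≤ #(outN E q) :=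
      card_le_card (union_subset inter_subset_left inter_subset_left)
    have c5 := h.card_four hq hq'
    have := h.le_out z
    have := h.le_in x
    have := h.le_in z
    have := h.le_out x
    have := h.le_out p
    have := h.le_in n
    have := h.le_out q
    have := h.le_in y
    have := h.small
    have := h.pos
    omega
  obtain ⟨c, hc⟩ := k3
  simp only [mem_inter, mem_outN, mem_inN] at hc
  exact h'.no_closed_five hI'
    (IsWalk.flip_iff.2 (IsWalk.mk_five hc.2.2 hc.1.2 hye hen hn))

end NoFourWalk

end FlexPair

end FlexPairs

section FlexPairs

variable {V : Type*} [Fintype V]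

namespace FlexPair

variable {E : V → V → Prop} {d s : ℕ} {x z : V}

section FourWalk

variable (h : FlexPair E d s x z) (hII : IsWalk E 4 z x)

include h hII

lemma no_closed_four_dest (h4 : IsWalk E 4 z z) : False :=
  h.no45 h4 (hII.append (IsWalk.one.2 h.edge))

lemma no_closed_four_start (h4 : IsWalk E 4 x x) : False :=
  h.no45 h4 (IsWalk.cons h.edge hII)

lemma two_step_not_to_ball {c u : V} (hcz : E c z) (hu : u ∈ outBall E 2 z) (huc : E u c) :
    False := by
  rcases h.mem_ball.1 hu with hu | ⟨a, ha, hau⟩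
  · exact h.no3 _ _ _ hu huc hcz
  · exact h.no_closed_four_dest hII (IsWalk.mk_four ha hau huc hcz)

lemma card_filter_ball_le {B : Finset V} (hB : B ⊆ inN E x) {k : ℕ} (hk : d ≤ #B + k) :
    #((outBall E 2 z).filter fun u => ∀ b ∈ B, ¬ E u b) ≤ d + s + k := by
  set U := (outBall E 2 z).filter fun u => ∀ b ∈ B, ¬ E u b with hU
  have hAU : outN E z ⊆ U := fun v hv => by
    rw [hU, mem_filter]
    exact ⟨outN_subset_outBall (by norm_num) hv, fun b hb hvb =>
      h.no_path (mem_outN.1 hv) hvb (mem_inN.1 (hB hb))⟩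
  obtain ⟨-, t, ht, ht'⟩ := h.acyclic_out U (filter_subset _ _) ((h.outN_nonempty z).mono hAU)
  rw [hU, mem_filter] at ht
  have key : #(outN E t) + #U + #B + #(inN E z) ≤ 4 * d + s := by
    refine le_trans (card_add_four_le ?_ ?_ ?_ ?_ ?_ ?_) h.card_le <;>
    try simp only [mem_outN, mem_inN]
    · exact fun v h1 h2 => ht' v h2 h1
    · exact fun v h1 h2 => ht.2 v h2 h1
    · exact fun v h1 h2 => h.two_step_not_to_ball hII h2 ht.1 h1
    · exact fun v h1 h2 => h.ball_not_to_start (mem_filter.1 h1).1 (mem_inN.1 (hB h2))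
    · exact fun v h1 h2 => h.ball_not_to_dest (mem_filter.1 h1).1 h2
    · exact fun v h1 h2 => h.no_common_in v (mem_inN.1 (hB h1)) h2
  have := h.le_out t
  have := h.le_in z
  omega

lemma le_card_filter_ball :
    d ≤ #((outBall E 2 z).filter fun u => ∃ b, E b x ∧ E u b) + s := by
  have h1 := h.card_filter_ball_le hII (B := inN E x) (k := 0) subset_rfl (h.le_in x)
  have h2 := h.two_mul_le_card_ball
  have h3 := card_filter_add_card_filter_not (s := outBall E 2 z) (fun u => ∃ b, E b x ∧ E u b)
  have h4 : ((outBall E 2 z).filter fun u => ¬ ∃ b, E b x ∧ E u b) =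
      (outBall E 2 z).filter fun u => ∀ b ∈ inN E x, ¬ E u b := by
    ext u; simp
  rw [h4] at h3
  omega

lemma le_card_middle : d ≤ #(outN E x ∩ inN E z) + 2 * s := by
  set T := (outBall E 2 z).filter fun u => ∃ b, E b x ∧ E u b with hT
  have key : #(outN E z) + #(inN E x) + #T + #(outN E x ∪ inN E z) ≤ 4 * d + s := by
    refine le_trans (card_add_four_le ?_ ?_ ?_ ?_ ?_ ?_) h.card_le <;>
    simp only [mem_outN, mem_inN, mem_union, hT, mem_filter]
    · exact fun v h1 h2 => h.no3 _ _ _ h1 h2 h.edge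
    · rintro v h1 ⟨-, b, hb, hvb⟩
      exact h.no_path h1 hvb hb
    · rintro v h1 (h2 | h2)
      · exact h.no_common_out v h1 h2
      · exact h.asymm _ _ h1 h2
    · exact fun v h1 h2 => h.ball_not_to_start h2.1 h1
    · rintro v h1 (h2 | h2)
      · exact h.asymm _ _ h1 h2
      · exact h.no_common_in v h1 h2
    · rintro v ⟨h1, b, hb, hvb⟩ (h2 | h2)
      · exact h.no3 _ _ _ h2 hvb hb
      · exact h.ball_not_to_dest h1 h2
  have hTc := h.le_card_filter_ball hII
  rw [← hT] at hTc
  have := card_union_add_card_inter (outN E x) (inN E z)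
  have := h.le_out z
  have := h.le_in x
  have := h.le_out x
  have := h.le_in z
  omega

omit hII in
lemma card_middle_le : #(outN E x ∩ inN E z) ≤ d + s := by
  obtain ⟨q, hq, hq'⟩ := h.exists_sink_outN
  have h1 := h.card_four hq hq'
  have h2 : #(outN E x ∩ inN E z) ≤ #(inN E z) := card_le_card inter_subset_right
  have := h.le_out z
  have := h.le_in x
  have := h.le_out q
  omega

/-- In-neighbours of a middle vertex lie almost entirely in `N⁻(x)` and among the middle
vertices. -/
lemma le_card_in_middle {c : V} (hcz : E c z) :
    d ≤ #(inN E c ∩ inN E x) + #(inN E c ∩ (outN E x ∩ inN E z)) + 3 * s := by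
  set K := outN E x ∩ inN E z with hK
  have hBK : #(inN E x ∪ K) = #(inN E x) + #K := by
    apply card_union_of_disjoint
    rw [disjoint_left]
    simp only [hK, mem_inN, mem_inter, mem_outN]
    exact fun v h1 h2 => h.asymm _ _ h1 h2.1
  have key : #(outBall E 2 z) + #(inN E c ∪ (inN E x ∪ K)) + #(∅ : Finset V) + #(∅ : Finset V)
      ≤ 4 * d + s := by
    refine le_trans (card_add_four_le ?_ ?_ ?_ ?_ ?_ ?_) h.card_le <;>
    simp only [mem_outN, mem_inN, mem_union, hK, mem_inter, notMem_empty, IsEmpty.forall_iff,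
      implies_true]
    rintro v h1 (h2 | h2 | h2)
    · exact h.two_step_not_to_ball hII hcz h1 h2
    · exact h.ball_not_to_start h1 h2
    · exact h.ball_not_to_dest h1 h2.2
  have h1 := card_union_add_card_inter (inN E c) (inN E x ∪ K)
  have h2 : #(inN E c ∩ (inN E x ∪ K)) ≤ #(inN E c ∩ inN E x) + #(inN E c ∩ K) := by
    rw [inter_union_distrib_left]; exact card_union_le _ _
  have := h.two_mul_le_card_ball
  have hKc := h.le_card_middle hII
  rw [← hK] at hKc
  have := h.le_in c
  have := h.le_in x
  simp only [card_empty] at key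
  omega

/-- Out-neighbours of a middle vertex lie almost entirely in `N⁺(z)` and among the middle
vertices. -/
lemma le_card_out_middle {c : V} (hxc : E x c) :
    d ≤ #(outN E c ∩ outN E z) + #(outN E c ∩ (outN E x ∩ inN E z)) + 4 * s := by
  set K := outN E x ∩ inN E z with hK
  set T := (outBall E 2 z).filter fun u => ∃ b, E b x ∧ E u b with hT
  have hBK : #(outN E z ∪ K) = #(outN E z) + #K := by
    apply card_union_of_disjoint
    rw [disjoint_left]
    simp only [hK, mem_inN, mem_inter, mem_outN]
    exact fun v h1 h2 => h.asymm _ _ h1 h2.2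
  have key : #(inN E x) + #T + #(outN E c ∪ (outN E z ∪ K)) + #(∅ : Finset V) ≤ 4 * d + s := by
    refine le_trans (card_add_four_le ?_ ?_ ?_ ?_ ?_ ?_) h.card_le <;>
    simp only [mem_outN, mem_inN, mem_union, hK, mem_inter, notMem_empty, IsEmpty.forall_iff,
      implies_true, hT, mem_filter]
    · exact fun v h1 h2 => h.ball_not_to_start h2.1 h1
    · rintro v h1 (h2 | h2 | h2)
      · exact h.no3 _ _ _ hxc h2 h1
      · exact h.no3 _ _ _ h2 h1 h.edge
      · exact h.asymm _ _ h2.1 h1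
    · rintro v ⟨h1, b, hb, hvb⟩ (h2 | h2 | h2)
      · exact h.no_closed_four_start hII (IsWalk.mk_four hxc h2 hvb hb)
      · exact h.no_path h2 hvb hb
      · exact h.no3 _ _ _ h2.1 hvb hb
  have h1 := card_union_add_card_inter (outN E c) (outN E z ∪ K)
  have h2 : #(outN E c ∩ (outN E z ∪ K)) ≤ #(outN E c ∩ outN E z) + #(outN E c ∩ K) := by
    rw [inter_union_distrib_left]; exact card_union_le _ _
  have hTc := h.le_card_filter_ball hII
  have hKc := h.le_card_middle hII
  rw [← hT] at hTc
  rw [← hK] at hKc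
  have := h.le_out c
  have := h.le_out z
  have := h.le_in x
  simp only [card_empty] at key
  omega

lemma card_out_middle_le {c : V} {k : ℕ}
    (hk : d ≤ #(inN E c ∩ inN E x) + k) : #(outN E c ∩ outN E z) ≤ s + k := by
  have hU := h.card_filter_ball_le hII (B := inN E c ∩ inN E x) inter_subset_right hk
  set U := (outBall E 2 z).filter fun u => ∀ b ∈ inN E c ∩ inN E x, ¬ E u b with hUdef
  set A := (outN E z).filter fun a => ∀ t, E a t → t ∈ U with hA
  have hsub : outN E c ∩ outN E z ⊆ A := by
    intro a ha
    rw [mem_inter, mem_outN, mem_outN] at ha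
    rw [hA, mem_filter, mem_outN]
    refine ⟨ha.2, fun t hat => ?_⟩
    rw [hUdef, mem_filter, h.mem_ball]
    refine ⟨Or.inr ⟨a, ha.2, hat⟩, fun b hb htb => ?_⟩
    rw [mem_inter, mem_inN, mem_inN] at hb
    exact h.no45 (IsWalk.mk_four hat htb hb.1 ha.1)
      (IsWalk.mk_five hat htb hb.2 h.edge ha.2)
  refine (card_le_card hsub).trans ?_
  rcases A.eq_empty_or_nonempty with hAe | hAe
  · simp [hAe]
  · obtain ⟨-, t, ht, ht'⟩ := h.acyclic_outN z A (filter_subset _ _) hAe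
    have htU := (mem_filter.1 ht).2
    have hAU : A ⊆ U := fun a ha => by
      have haz := mem_outN.1 (mem_filter.1 ha).1
      rw [hUdef, mem_filter, h.mem_ball]
      refine ⟨Or.inl haz, fun b hb hab => ?_⟩
      rw [mem_inter, mem_inN, mem_inN] at hb
      exact h.no_path haz hab hb.2
    have h1 : #(A ∪ outN E t) ≤ #U :=
      card_le_card (union_subset hAU fun w hw => htU w (mem_outN.1 hw))
    rw [card_union_of_disjoint] at h1
    · have := h.le_out t
      omega
    · rw [disjoint_left]
      exact fun w hw hw' => ht' w hw (mem_outN.1 hw')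

lemma le_card_out_of_source {c : V} (hxc : E x c) (hcz : E c z)
    (hsrc : ∀ w, E x w → E w z → ¬ E w c) :
    d ≤ #(outN E c ∩ (outN E x ∩ inN E z)) + 8 * s := by
  have h1 := h.le_card_in_middle hII hcz
  have h2 : inN E c ∩ (outN E x ∩ inN E z) = ∅ := by
    ext w
    simp only [mem_inter, mem_inN, mem_outN, notMem_empty, iff_false]
    exact fun hw => hsrc w hw.2.1 hw.2.2 hw.1
  rw [h2, card_empty] at h1
  have h3 := h.card_out_middle_le hII (c := c) (k := 3 * s) (by omega)
  have h4 := h.le_card_out_middle hII hxc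
  omega

lemma false_of_four_walk : False := by
  set K := outN E x ∩ inN E z with hK
  have hKc := h.le_card_middle hII
  have hKle := h.card_middle_le
  rw [← hK] at hKc hKle
  have hpos := h.pos
  have hsm := h.small
  have hKne : K.Nonempty := by rw [← card_pos]; omega
  have hKac : AcyclicOn E K := (h.acyclic_outN x).mono inter_subset_left
  obtain ⟨⟨c₁, hc₁, hs₁⟩, c₄, hc₄, hs₄⟩ := hKac K subset_rfl hKne
  have memK : ∀ v, v ∈ K ↔ E x v ∧ E v z := fun v => by
    rw [hK, mem_inter, mem_outN, mem_inN]
  rw [memK] at hc₁ hc₄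
  have k1 := h.le_card_out_of_source hII hc₁.1 hc₁.2 fun w h1 h2 => hs₁ w ((memK w).2 ⟨h1, h2⟩)
  have k4 := h.flip_of.le_card_out_of_source (IsWalk.flip_iff.2 hII) hc₄.2 hc₄.1
    fun w h1 h2 => hs₄ w ((memK w).2 ⟨h2, h1⟩)
  rw [outN_flip, outN_flip, inN_flip, inter_comm (inN E z), ← hK] at k4
  rw [← hK] at k1
  set M := (outN E c₁ ∩ K) ∩ (inN E c₄ ∩ K) with hM
  have hMc : d ≤ #M + 17 * s := by
    have c1 := card_union_add_card_inter (outN E c₁ ∩ K) (inN E c₄ ∩ K)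
    rw [← hM] at c1
    have c2 : #(outN E c₁ ∩ K ∪ inN E c₄ ∩ K) ≤ #K :=
      card_le_card (union_subset inter_subset_right inter_subset_right)
    omega
  have hMK : M ⊆ K := fun v hv => (mem_inter.1 (mem_inter.1 hv).1).2
  have indep : ∀ u v, u ∈ M → v ∈ M → ¬ E u v := by
    intro u v hu hv huv
    simp only [hM, mem_inter, mem_outN, mem_inN] at hu hv
    exact h.no9 z (hII.append (IsWalk.mk_five hc₁.1 hu.1.1 huv hv.2.1 hc₄.2))
  obtain ⟨c, hc⟩ : M.Nonempty := by rw [← card_pos]; omega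
  have hcK := (memK c).1 (hMK hc)
  have hin : #(inN E c ∩ K) + #M ≤ #K := by
    rw [← card_union_of_disjoint]
    · exact card_le_card (union_subset inter_subset_right hMK)
    · rw [disjoint_left]
      exact fun w hw hw' => indep w c hw' hc (mem_inN.1 (mem_inter.1 hw).1)
  have hout : #(outN E c ∩ K) + #M ≤ #K := by
    rw [← card_union_of_disjoint]
    · exact card_le_card (union_subset inter_subset_right hMK)
    · rw [disjoint_left]
      exact fun w hw hw' => indep c w hc hw' (mem_outN.1 (mem_inter.1 hw).1)
  have m1 := h.le_card_in_middle hII hcK.2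
  have m2 := h.le_card_out_middle hII hcK.1
  rw [← hK] at m1 m2
  have m3 := h.card_out_middle_le hII (c := c) (k := 21 * s) (by omega)
  omega

end FourWalk

lemma false (h : FlexPair E d s x z) : False := by
  by_cases hw : IsWalk E 4 z x
  · exact h.false_of_four_walk hw
  · exact h.false_of_no_four_walk hw

end FlexPair

namespace NearQuarter

variable {E : V → V → Prop} {d s : ℕ} {x z : V}

lemma acyclicOn_outBall_two (h : NearQuarter E d s) (hno : ∀ u, ¬ IsWalk E 9 u u) (hxz : E x z)
    (hxz' : IsWalk E 2 x z) : AcyclicOn E (outBall E 2 z) := by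
  refine acyclicOn_of_sources h.irrefl fun Y hY ⟨p, hp⟩ => ?_
  by_contra! hcon
  have key : ∀ k, ∀ y ∈ Y, IsWalk E (k + 3) x y := by
    intro k
    induction k with
    | zero =>
      intro y hy
      obtain ⟨j, hj1, hj2, hj⟩ := mem_outBall.1 (hY hy)
      interval_cases j
      · exact hxz'.append hj
      · exact (IsWalk.one.2 hxz).append hj
    | succ k ih =>
      intro y hy
      obtain ⟨w, hw, hwy⟩ := hcon y hy
      exact (ih w hw).snoc hwy
  obtain ⟨t, h2, h5, ht⟩ := h.exists_walk_le_five le_rfl hno p x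
  exact hno x (((key (6 - t) p hp).append ht).cast (by omega))

/-- Extremal choice of a pair joined by walks of lengths `1, …, k`. -/
lemma exists_flexPair (h : NearQuarter E d s) (hno : ∀ u, ¬ IsWalk E 9 u u) (hxz : E x z)
    (hxz' : IsWalk E 2 x z) : ∃ x z, FlexPair E d s x z := by
  let P : ℕ → Prop := fun k => ∃ x z, ∀ j, 1 ≤ j → j ≤ k → IsWalk E j x z
  have hbound : ∀ k, P k → k < 7 := by
    rintro k ⟨x, z, hk⟩
    by_contra! h7
    obtain ⟨t, h2, h5, ht⟩ := h.exists_walk_le_five le_rfl hno z x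
    exact hno x (((hk (9 - t) (by omega) (by omega)).append ht).cast (by omega))
  have hP2 : P 2 := ⟨x, z, fun j h1 h2 => by
    interval_cases j
    · exact IsWalk.one.2 hxz
    · exact hxz'⟩
  obtain ⟨k, hk2, hk, hmax⟩ : ∃ k, 2 ≤ k ∧ P k ∧ ¬ P (k + 1) := by
    by_contra! hcon
    have : ∀ k, P (k + 2) := by
      intro k
      induction k with
      | zero => exact hP2
      | succ k ih => exact hcon (k + 2) (by omega) ih
    exact absurd (hbound _ (this 5)) (by norm_num)
  obtain ⟨x, z, hw⟩ := hk
  have e1 : E x z := IsWalk.one.1 (hw 1 le_rfl (by omega))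
  have e2 : IsWalk E 2 x z := hw 2 (by norm_num) hk2
  refine ⟨x, z, { h with
    no9 := hno
    edge := e1
    path := IsWalk.two.1 e2
    acyclic_out := h.acyclicOn_outBall_two hno e1 e2
    acyclic_in := (h.flip_of.acyclicOn_outBall_two (IsWalk.flip_no_closed hno) e1
      (IsWalk.flip_iff.2 e2)).flip_of
    no_common_out := fun a hza hxa => hmax ⟨x, a, fun j h1 h2 => ?_⟩
    no_common_in := fun b hbx hbz => hmax ⟨b, z, fun j h1 h2 => ?_⟩ }⟩
  · rcases h1.eq_or_lt with rfl | h1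
    · exact IsWalk.one.2 hxa
    · exact ((hw (j - 1) (by omega) (by omega)).snoc hza).cast (by omega)
  · rcases h1.eq_or_lt with rfl | h1
    · exact IsWalk.one.2 hbz
    · exact (IsWalk.cons hbx (hw (j - 1) (by omega) (by omega))).cast (by omega)

end NearQuarter

/-- An oriented graph with semidegree nearly a quarter of its order which contains a triangle
(transitive or cyclic) has closed walks of every length divisible by three but not by four. -/
theorem exists_closed_walk {E : V → V → Prop} {d s l : ℕ} (hE : ∀ u v, E u v → ¬ E v u)
    (hout : ∀ v, d ≤ #(outN E v)) (hin : ∀ v, d ≤ #(inN E v))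
    (hcard : Fintype.card V ≤ 4 * d + s) (hs : 60 * s ≤ d) (hd : 0 < d) (hl : 9 ≤ l)
    (h3 : 3 ∣ l) (h4 : ¬ 4 ∣ l) {x y z : V} (hxy : E x y) (hyz : E y z)
    (hxz : E x z ∨ E z x) : ∃ u, IsWalk E l u u := by
  by_contra! hno
  have h : NearQuarter E d s :=
    { asymm := hE
      no3 := fun a b c h1 h2 h5 => by
        obtain ⟨m, rfl⟩ := h3
        exact hno a (((IsWalk.mk_three h1 h2 h5).mul m).cast (by ring))
      le_out := hout
      le_in := hin
      card_le := hcard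
      small := hs
      pos := hd }
  have hxz : E x z := hxz.resolve_right fun hzx => h.no3 _ _ _ hxy hyz hzx
  have hxz' : IsWalk E 2 x z := IsWalk.two.2 ⟨y, hxy, hyz⟩
  obtain rfl := h.eq_nine hl hno h3 h4 hxz hxz'
  obtain ⟨x, z, hf⟩ := h.exists_flexPair hno hxz hxz'
  exact hf.false

end FlexPairs

section Blowup

/-- A dense set of `M`-tuples contains a product of `M` sets of prescribed size. -/
theorem exists_product_subset (M : ℕ) (t : ℕ) (c : ℝ) (hc : 0 < c) :
    ∃ n₀ : ℕ, ∀ (V : Type) [Fintype V], n₀ ≤ Fintype.card V → ∀ P : Finset (Fin M → V),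
      c * (Fintype.card V : ℝ) ^ M ≤ #P →
      ∃ W : Fin M → Finset V, (∀ i, t ≤ #(W i)) ∧ ∀ w : Fin M → V, (∀ i, w i ∈ W i) → w ∈ P := by
  induction M generalizing c with
  | zero =>
    refine ⟨0, fun V _ _ P hP => ⟨fun i => i.elim0, fun i => i.elim0, fun w _ => ?_⟩⟩
    have hne : P.Nonempty := by
      rw [← card_pos, ← Nat.cast_pos (α := ℝ)]
      simp only [pow_zero, mul_one] at hP
      linarith
    obtain ⟨x, hx⟩ := hne
    rwa [Subsingleton.elim w x]
  | succ M ih =>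
    obtain ⟨K, hK⟩ := exists_nat_ge (4 * t / c + 1)
    have hKpos : (0 : ℝ) < K := by
      have : (0 : ℝ) ≤ 4 * t / c := by positivity
      linarith
    have hKt : 4 * (t : ℝ) ≤ K * c := by
      rw [← div_le_iff₀ hc]; linarith
    obtain ⟨n₁, hn₁⟩ := ih (c / 4 / 2 ^ K) (by positivity)
    obtain ⟨n₂, hn₂⟩ := exists_nat_ge (2 * K / c + 1)
    refine ⟨max n₁ n₂, fun V _ hV P hP => ?_⟩
    set n : ℝ := (Fintype.card V : ℝ) with hn
    have hn2 : 2 * K / c + 1 ≤ n := hn₂.trans (by rw [hn]; exact_mod_cast (le_max_right _ _).trans hV)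
    have hnK : 2 * K ≤ n * c := by
      rw [← div_le_iff₀ hc]; linarith
    have hnpos : 0 < n := by
      have : (0 : ℝ) ≤ 2 * K / c := by positivity
      linarith
    let T : V → Finset (Fin M → V) := fun a => univ.filter fun u => (Fin.cons a u : Fin (M + 1) → V) ∈ P
    have hTle : ∀ a, (#(T a) : ℝ) ≤ n ^ M := fun a => by
      have := card_le_univ (T a)
      rw [Fintype.card_fun, Fintype.card_fin] at this
      rw [hn]; exact_mod_cast this
    have hPsum : (#P : ℝ) ≤ ∑ a, (#(T a) : ℝ) := by
      have h1 : #P = ∑ a, #(P.filter fun w => w 0 = a) :=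
        card_eq_sum_card_fiberwise (fun _ _ => mem_coe.2 (mem_univ _))
      rw [h1]; push_cast
      refine sum_le_sum fun a _ => ?_
      norm_cast
      refine card_le_card_of_injOn Fin.tail ?_ ?_
      · intro w hw
        simp only [coe_filter, Set.mem_ofPred_eq, T, mem_univ, true_and] at hw ⊢
        rw [← hw.2, Fin.cons_self_tail]; exact hw.1
      · intro w hw w' hw' h
        simp only [coe_filter, Set.mem_ofPred_eq] at hw hw'
        rw [← Fin.cons_self_tail w, ← Fin.cons_self_tail w', h, hw.2, hw'.2]
    set H := univ.filter fun a => c / 2 * n ^ M ≤ #(T a) with hH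
    have hHc : K ≤ #H := by
      have h1 : ∑ a, (#(T a) : ℝ) ≤ ∑ a, ((if a ∈ H then n ^ M else 0) + c / 2 * n ^ M) := by
        refine sum_le_sum fun a _ => ?_
        by_cases ha : a ∈ H
        · rw [if_pos ha]; have := hTle a; have : 0 ≤ c / 2 * n ^ M := by positivity
          linarith
        · rw [if_neg ha]
          simp only [hH, mem_filter, mem_univ, true_and, not_le] at ha
          linarith
      rw [sum_add_distrib, sum_ite_mem, univ_inter, sum_const, sum_const, nsmul_eq_mul,
        nsmul_eq_mul, card_univ, ← hn] at h1
      have h2 : (n * c / 2) * n ^ M ≤ #H * n ^ M := by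
        have : c * n ^ (M + 1) = n * c * n ^ M := by ring
        linarith
      have h3 := le_of_mul_le_mul_right h2 (by positivity)
      exact_mod_cast (by linarith : (K : ℝ) ≤ #H)
    obtain ⟨Q, hQH, hQK⟩ := exists_subset_card_eq hHc
    let A : (Fin M → V) → Finset V := fun u => Q.filter fun a => (Fin.cons a u : Fin (M + 1) → V) ∈ P
    set G := univ.filter fun u => t ≤ #(A u) with hG
    have hdc : ∑ a ∈ Q, (#(T a) : ℝ) = ∑ u, (#(A u) : ℝ) := by
      have := sum_card_bipartiteAbove_eq_sum_card_bipartiteBelow (s := Q)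
        (t := (univ : Finset (Fin M → V))) (fun a u => (Fin.cons a u : Fin (M + 1) → V) ∈ P)
      exact_mod_cast this
    have hlow : K * (c / 2 * n ^ M) ≤ ∑ a ∈ Q, (#(T a) : ℝ) := by
      rw [← hQK, ← nsmul_eq_mul]
      exact card_nsmul_le_sum _ _ _ fun a ha => (mem_filter.1 (hQH ha)).2
    have hup : ∑ u, (#(A u) : ℝ) ≤ #G * K + n ^ M * t := by
      have h1 : ∑ u, (#(A u) : ℝ) ≤ ∑ u, ((if u ∈ G then (K : ℝ) else 0) + t) := by
        refine sum_le_sum fun u _ => ?_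
        by_cases hu : u ∈ G
        · rw [if_pos hu, ← hQK]
          have : (#(A u) : ℝ) ≤ #Q := by exact_mod_cast card_filter_le _ _
          have : (0 : ℝ) ≤ t := by positivity
          linarith
        · rw [if_neg hu]
          simp only [hG, mem_filter, mem_univ, true_and, not_le] at hu
          have : (#(A u) : ℝ) ≤ t := by exact_mod_cast hu.le
          linarith
      rw [sum_add_distrib, sum_ite_mem, univ_inter, sum_const, sum_const, nsmul_eq_mul,
        nsmul_eq_mul, card_univ, Fintype.card_fun, Fintype.card_fin] at h1
      rw [hn]; exact_mod_cast h1
    have hGc : c / 4 * n ^ M ≤ #G := by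
      have hh : K * (c / 4 * n ^ M) ≤ K * #G := by
        have : n ^ M * (4 * t) ≤ n ^ M * (K * c) :=
          mul_le_mul_of_nonneg_left hKt (by positivity)
        nlinarith
      exact le_of_mul_le_mul_left hh hKpos
    obtain ⟨B, hB, hBc⟩ := exists_le_card_fiber_of_nsmul_le_card_of_maps_to (s := G)
      (t := Q.powerset) (f := A) (b := c / 4 / 2 ^ K * n ^ M)
      (fun u _ => mem_powerset.2 (filter_subset _ _)) ⟨∅, by simp⟩ (by
        rw [card_powerset, hQK, nsmul_eq_mul]
        refine le_trans (le_of_eq ?_) hGc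
        push_cast
        field_simp)
    obtain ⟨W, hW, hWP⟩ := hn₁ V ((le_max_left _ _).trans hV) _ hBc
    have hBt : t ≤ #B := by
      have hpos : 0 < #{u ∈ G | A u = B} := by
        rw [← Nat.cast_pos (α := ℝ)]
        exact lt_of_lt_of_le (by positivity) hBc
      obtain ⟨u, hu⟩ := card_pos.1 hpos
      rw [mem_filter, hG, mem_filter] at hu
      rw [← hu.2]; exact hu.1.2
    refine ⟨Fin.cons B W, fun i => ?_, fun w hw => ?_⟩
    · refine Fin.cases ?_ (fun i => ?_) i
      · simpa using hBt
      · simpa using hW i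
    · have h1 := hWP (Fin.tail w) fun i => by simpa [Fin.tail] using hw i.succ
      rw [mem_filter] at h1
      have h2 := hw 0
      simp only [Fin.cons_zero] at h2
      rw [← h1.2] at h2
      simp only [A, mem_filter] at h2
      rw [← Fin.cons_self_tail w]
      exact h2.2

/-- If a positive proportion of the maps `Fin M → V` send a fixed cyclic pattern to a closed
walk, then there is an injective closed walk. -/
theorem exists_cycle_of_pattern (M l : ℕ) [NeZero l] (c : ℝ) (hc : 0 < c) :
    ∃ n₀ : ℕ, ∀ (V : Type) [Fintype V] (E : V → V → Prop), (∀ v, ¬ E v v) →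
      n₀ ≤ Fintype.card V → ∀ φ : ZMod l → Fin M,
      c * (Fintype.card V : ℝ) ^ M ≤
        #(univ.filter fun w : Fin M → V => ∀ i, E (w (φ i)) (w (φ (i + 1)))) →
      ∃ v : ZMod l → V, Function.Injective v ∧ ∀ i, E (v i) (v (i + 1)) := by
  obtain ⟨n₀, hn₀⟩ := exists_product_subset M (l + 1) c hc
  refine ⟨n₀, fun V _ E hE hV φ hφ => ?_⟩
  obtain ⟨W, hW, hWP⟩ := hn₀ V hV _ hφ
  simp only [mem_filter, mem_univ, true_and] at hWP
  have hne : ∀ i, (W i).Nonempty := fun i => by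
    rw [← card_pos]; have := hW i; omega
  choose w₀ hw₀ using hne
  obtain ⟨v, hv, hvW⟩ := (Finset.all_card_le_biUnion_card_iff_exists_injective
    (fun i : ZMod l => W (φ i))).1 (fun s => by
      rcases s.eq_empty_or_nonempty with rfl | ⟨i, hi⟩
      · simp
      · have h1 : #s ≤ l := by simpa [ZMod.card] using card_le_univ s
        have h2 : #(W (φ i)) ≤ #(s.biUnion fun i => W (φ i)) :=
          card_le_card (subset_biUnion_of_mem (fun i => W (φ i)) hi)
        have := hW (φ i)
        omega)
  refine ⟨v, hv, fun i => ?_⟩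
  have hne : φ i ≠ φ (i + 1) := fun h => by
    have := hWP w₀ hw₀ i
    rw [h] at this
    exact hE _ this
  have := hWP (Function.update (Function.update w₀ (φ i) (v i)) (φ (i + 1)) (v (i + 1)))
    (fun j => by
      by_cases h1 : j = φ (i + 1)
      · subst h1; simpa using hvW (i + 1)
      · rw [Function.update_of_ne h1]
        by_cases h2 : j = φ i
        · subst h2; simpa using hvW i
        · rw [Function.update_of_ne h2]; exact hw₀ j) i
  simpa [Function.update_of_ne hne] using this

end Blowup

section Sampling

variable {V : Type} [Fintype V]

lemma sum_eq_zero_of_update {ι : Type} [Fintype ι] [DecidableEq ι] (f : (ι → V) → ℝ) (k : ι)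
    (h : ∀ w, ∑ v, f (Function.update w k v) = 0) : ∑ w, f w = 0 := by
  rcases isEmpty_or_nonempty V with hV | hV
  · have : IsEmpty (ι → V) := ⟨fun w => hV.elim (w k)⟩
    simp
  have h1 : ∑ p : (ι → V) × V, f (Function.update p.1 k p.2) = 0 := by
    rw [Fintype.sum_prod_type]
    exact sum_eq_zero fun w _ => h w
  have hinv : Function.Involutive
      (fun p : (ι → V) × V => (Function.update p.1 k p.2, p.1 k)) := fun p => by
    simp
  have h2 : ∑ p : (ι → V) × V, f (Function.update p.1 k p.2) = ∑ p : (ι → V) × V, f p.1 :=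
    Equiv.sum_comp hinv.toPerm (fun p => f p.1)
  rw [h2, Fintype.sum_prod_type] at h1
  simp only [sum_const, card_univ, nsmul_eq_mul, ← mul_sum] at h1
  exact (mul_eq_zero.1 h1).resolve_left (by exact_mod_cast Fintype.card_ne_zero)

/-- The second moment bound for sampling the edges at the vertex with index `i`. -/
lemma sum_sq_le {M : ℕ} (g : V → V → ℝ) (hg : ∀ u, ∑ v, g u v = 0) (hg1 : ∀ u v, |g u v| ≤ 1)
    (i : Fin M) :
    ∑ w : Fin M → V, (∑ j ∈ univ.erase i, g (w i) (w j)) ^ 2 ≤ M * (Fintype.card V : ℝ) ^ M := by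
  have hdiag : ∀ j, ∑ w : Fin M → V, g (w i) (w j) * g (w i) (w j)
      ≤ (Fintype.card V : ℝ) ^ M := by
    intro j
    have h : ∀ w ∈ (univ : Finset (Fin M → V)), g (w i) (w j) * g (w i) (w j) ≤ 1 := by
      intro w _
      rw [← sq, sq_le_one_iff_abs_le_one]
      exact hg1 _ _
    have := sum_le_card_nsmul _ _ _ h
    rw [card_univ, Fintype.card_fun, Fintype.card_fin, nsmul_one] at this
    exact_mod_cast this
  have hoff : ∀ j k, k ≠ i → k ≠ j → ∑ w : Fin M → V, g (w i) (w j) * g (w i) (w k) = 0 := by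
    intro j k hki hkj
    refine sum_eq_zero_of_update (fun w : Fin M → V => g (w i) (w j) * g (w i) (w k)) k fun w => ?_
    simp only [Function.update_of_ne hki.symm, Function.update_of_ne hkj.symm,
      Function.update_self]
    rw [← mul_sum, hg, mul_zero]
  have h1 : ∑ w : Fin M → V, (∑ j ∈ univ.erase i, g (w i) (w j)) ^ 2 =
      ∑ j ∈ univ.erase i, ∑ k ∈ univ.erase i, ∑ w : Fin M → V, g (w i) (w j) * g (w i) (w k) := by
    have e : ∀ w : Fin M → V, (∑ j ∈ univ.erase i, g (w i) (w j)) ^ 2 =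
        ∑ j ∈ univ.erase i, ∑ k ∈ univ.erase i, g (w i) (w j) * g (w i) (w k) := fun w => by
      rw [sq, sum_mul_sum]
    rw [sum_congr rfl fun w _ => e w, sum_comm]
    exact sum_congr rfl fun j _ => sum_comm
  have h2 : ∀ j ∈ univ.erase i,
      ∑ k ∈ univ.erase i, ∑ w : Fin M → V, g (w i) (w j) * g (w i) (w k)
        ≤ (Fintype.card V : ℝ) ^ M := by
    intro j hj
    rw [sum_eq_single_of_mem j hj fun k hk hkj => hoff j k (mem_erase.1 hk).1 hkj]
    exact hdiag j
  have h3 := sum_le_card_nsmul _ _ _ h2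
  rw [nsmul_eq_mul] at h3
  rw [h1]
  refine h3.trans (mul_le_mul_of_nonneg_right ?_ (by positivity))
  have : #((univ : Finset (Fin M)).erase i) ≤ M := by
    simp
  exact_mod_cast this

/-- For most samples `w`, the vertex `w i` has nearly the expected number of sampled
out-neighbours. -/
lemma card_bad_le {M : ℕ} (E : V → V → Prop) (i : Fin M) {q : ℝ} (hq : 0 < q) :
    #(univ.filter fun w : Fin M → V =>
      (#(univ.filter fun j => j ≠ i ∧ E (w i) (w j)) : ℝ) + q <
        (M - 1) * (#(outN E (w i)) / (Fintype.card V : ℝ))) ≤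
      M / q ^ 2 * (Fintype.card V : ℝ) ^ M := by
  set n : ℝ := (Fintype.card V : ℝ) with hn
  rcases isEmpty_or_nonempty V with hV | hV
  · have : IsEmpty (Fin M → V) := ⟨fun w => hV.elim (w i)⟩
    simp only [univ_eq_empty, filter_empty, card_empty, CharP.cast_eq_zero]
    positivity
  have hnpos : 0 < n := by rw [hn]; exact_mod_cast Fintype.card_pos
  let g : V → V → ℝ := fun u v => (if E u v then 1 else 0) - #(outN E u) / n
  have hg : ∀ u, ∑ v, g u v = 0 := fun u => by
    simp only [g, sum_sub_distrib, sum_const, card_univ, nsmul_eq_mul, ← hn]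
    rw [mul_div_cancel₀ _ hnpos.ne', sum_ite, sum_const_zero, sum_const]
    simp [outN]
  have hfrac : ∀ u, 0 ≤ #(outN E u) / n ∧ #(outN E u) / n ≤ 1 := fun u => by
    refine ⟨by positivity, (div_le_one hnpos).2 ?_⟩
    rw [hn]; exact_mod_cast card_le_univ _
  have hg1 : ∀ u v, |g u v| ≤ 1 := fun u v => by
    have := hfrac u
    simp only [g]
    rw [abs_le]
    split_ifs <;> constructor <;> linarith
  have key := sum_sq_le g hg hg1 i
  set S := univ.filter fun w : Fin M → V =>
      (#(univ.filter fun j => j ≠ i ∧ E (w i) (w j)) : ℝ) + q < (M - 1) * (#(outN E (w i)) / n)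
    with hS
  have hlow : #S * q ^ 2 ≤ ∑ w : Fin M → V, (∑ j ∈ univ.erase i, g (w i) (w j)) ^ 2 := by
    rw [← nsmul_eq_mul]
    refine le_trans ?_ (sum_le_sum_of_subset_of_nonneg (subset_univ S) fun _ _ _ => sq_nonneg _)
    refine card_nsmul_le_sum _ _ _ fun w hw => ?_
    rw [hS, mem_filter] at hw
    have h1 : ∑ j ∈ univ.erase i, g (w i) (w j) =
        #(univ.filter fun j => j ≠ i ∧ E (w i) (w j)) - (M - 1) * (#(outN E (w i)) / n) := by
      simp only [g, sum_sub_distrib, sum_const, nsmul_eq_mul]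
      congr 1
      · rw [sum_ite, sum_const_zero, sum_const, add_zero, nsmul_eq_mul, mul_one]
        congr 2
        ext j; simp
      · congr 1
        rw [card_erase_of_mem (mem_univ i), card_univ, Fintype.card_fin, Nat.cast_pred i.pos]
    rw [h1, sq_le_sq, abs_of_pos hq]
    exact (by linarith [hw.2] : q ≤ -(_ - _)).trans (neg_le_abs _)
  rw [div_mul_eq_mul_div, le_div_iff₀ (by positivity)]
  exact hlow.trans key

omit [Fintype V] in
lemma IsWalk.exists_seq {E : V → V → Prop} {k : ℕ} {u v : V} (h : IsWalk E k u v) :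
    ∃ f : ℕ → V, f 0 = u ∧ f k = v ∧ ∀ i < k, E (f i) (f (i + 1)) := by
  induction k generalizing u with
  | zero => exact ⟨fun _ => u, rfl, h, by simp⟩
  | succ k ih =>
    obtain ⟨w, hw, hk⟩ := h
    obtain ⟨f, h0, h1, h2⟩ := ih hk
    refine ⟨fun i => if i = 0 then u else f (i - 1), by simp, by simpa using h1, fun i hi => ?_⟩
    rcases i with _ | i
    · simpa [h0] using hw
    · simpa using h2 i (by omega)

omit [Fintype V] in
lemma IsWalk.exists_zmod {E : V → V → Prop} {l : ℕ} [NeZero l] {u : V} (h : IsWalk E l u u) :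
    ∃ f : ZMod l → V, ∀ i, E (f i) (f (i + 1)) := by
  obtain ⟨f, h0, h1, h2⟩ := h.exists_seq
  refine ⟨fun i => f i.val, fun i => ?_⟩
  have hi := ZMod.val_lt i
  have h3 := h2 i.val hi
  have h4 : (i + 1).val = (i.val + 1) % l := by
    rw [ZMod.val_add, ZMod.val_one_eq_one_mod]
    simp
  show E (f i.val) (f (i + 1).val)
  rw [h4]
  rcases (Nat.succ_le_of_lt hi).lt_or_eq with hlt | heq
  · rw [Nat.mod_eq_of_lt hlt]; exact h3
  · rw [show i.val + 1 = l from heq] at h3 ⊢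
    rw [Nat.mod_self, h0]
    rwa [h1] at h3

/-- Three vertices spanning a transitive or cyclic triangle. -/
def IsTri {V : Type} (E : V → V → Prop) (t : V × V × V) : Prop :=
  E t.1 t.2.1 ∧ E t.2.1 t.2.2 ∧ (E t.1 t.2.2 ∨ E t.2.2 t.1)

lemma le_card_sample_tri (E : V → V → Prop) (m : ℕ) :
    #(univ.filter (IsTri E)) * Fintype.card V ^ m ≤
      #(univ.filter fun w : Fin (m + 3) → V => IsTri E (w 0, w 1, w 2)) := by
  have h1 : #(univ.filter (IsTri E)) * Fintype.card V ^ m =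
      #(univ.filter (IsTri E) ×ˢ (univ : Finset (Fin m → V))) := by
    rw [card_product, card_univ, Fintype.card_fun, Fintype.card_fin]
  rw [h1]
  refine card_le_card_of_injOn
    (fun p => Fin.cons p.1.1 (Fin.cons p.1.2.1 (Fin.cons p.1.2.2 p.2))) ?_ ?_
  · rintro ⟨⟨x, y, z⟩, u⟩ hp
    simp only [coe_product, Set.mem_prod, mem_coe, mem_filter, mem_univ, true_and] at hp ⊢
    exact hp.1
  · rintro ⟨⟨x, y, z⟩, u⟩ - ⟨⟨x', y', z'⟩, u'⟩ - h
    obtain ⟨rfl, h⟩ := Fin.cons_inj.1 h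
    obtain ⟨rfl, h⟩ := Fin.cons_inj.1 h
    obtain ⟨rfl, rfl⟩ := Fin.cons_inj.1 h
    rfl

omit [Fintype V] in
/-- A good sample contains a closed walk of length `l`. -/
lemma exists_pattern_of_good {E : V → V → Prop} (hE : ∀ u v, E u v → ¬ E v u) {l M q : ℕ}
    [NeZero l] (hl : 9 ≤ l) (h3 : 3 ∣ l) (h4 : ¬ 4 ∣ l) (hq : 1 ≤ q) (hM : M = 10000 * q)
    (w : Fin M → V) (G : Finset (Fin M)) (hG : M ≤ #G + q)
    (hout : ∀ i ∈ G, ((M : ℝ) - 1) / 4 ≤ #(univ.filter fun j => j ≠ i ∧ E (w i) (w j)) + q)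
    (hin : ∀ i ∈ G, ((M : ℝ) - 1) / 4 ≤ #(univ.filter fun j => j ≠ i ∧ E (w j) (w i)) + q)
    {a b c : Fin M} (ha : a ∈ G) (hb : b ∈ G) (hc : c ∈ G) (ht : IsTri E (w a, w b, w c)) :
    ∃ φ : ZMod l → Fin M, ∀ i, E (w (φ i)) (w (φ (i + 1))) := by
  have hcomp : #(univ \ G) ≤ q := by
    rw [card_sdiff_of_subset (subset_univ G), card_univ, Fintype.card_fin]; omega
  have gen : ∀ F : V → V → Prop,
      (∀ i ∈ G, ((M : ℝ) - 1) / 4 ≤ #(univ.filter fun j => j ≠ i ∧ F (w i) (w j)) + q) →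
      ∀ i : G, 2498 * q ≤ #(outN (fun i j : G => F (w i) (w j)) i) := by
    intro F hF i
    have h1 := hF i i.2
    have h2 : #(univ.filter fun j => j ≠ i.1 ∧ F (w i) (w j)) ≤
        #(outN (fun i j : G => F (w i) (w j)) i) + #(univ \ G) := by
      rw [← card_map (Function.Embedding.subtype _)]
      refine le_trans (card_le_card ?_) (card_union_le _ _)
      intro j hj
      rw [mem_filter] at hj
      by_cases hjG : j ∈ G
      · refine mem_union_left _ (mem_map.2 ⟨⟨j, hjG⟩, ?_, rfl⟩)
        rw [mem_outN]; exact hj.2.2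
      · exact mem_union_right _ (by simp [hjG])
    have h3 : (#(univ.filter fun j => j ≠ i.1 ∧ F (w i) (w j)) : ℝ) ≤
        #(outN (fun i j : G => F (w i) (w j)) i) + q := by
      exact_mod_cast h2.trans (by omega)
    have hMr : (M : ℝ) = 10000 * q := by exact_mod_cast hM
    rw [hMr] at h1
    have h5 : (2498 * q : ℝ) < #(outN (fun i j : G => F (w i) (w j)) i) + 1 := by linarith
    have h6 : 2498 * q < #(outN (fun i j : G => F (w i) (w j)) i) + 1 := by exact_mod_cast h5
    omega
  obtain ⟨u, hu⟩ := exists_closed_walk (E := fun i j : G => E (w i) (w j)) (d := 2498 * q)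
    (s := 8 * q) (l := l) (fun i j => hE _ _) (gen E hout) (gen (flip E) hin)
    (by
      rw [Fintype.card_coe]
      have := card_le_univ G
      rw [Fintype.card_fin] at this
      omega)
    (by omega) (by omega) hl h3 h4 (x := ⟨a, ha⟩) (y := ⟨b, hb⟩) (z := ⟨c, hc⟩) ht.1 ht.2.1 ht.2.2
  obtain ⟨f, hf⟩ := hu.exists_zmod
  exact ⟨fun i => f i, hf⟩

/-- Oriented graphs with semidegree at least a quarter of the order and a positive density of
triangles contain a cycle of length `l`. -/
theorem exists_cycle_of_many_tri (l : ℕ) [NeZero l] (hl : 9 ≤ l) (h3 : 3 ∣ l) (h4 : ¬ 4 ∣ l)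
    (η : ℝ) (hη : 0 < η) :
    ∃ n₀ : ℕ, ∀ (V : Type) [Fintype V] (E : V → V → Prop), (∀ u v, E u v → ¬ E v u) →
      n₀ ≤ Fintype.card V → (∀ v, (Fintype.card V : ℝ) / 4 ≤ #(outN E v)) →
      (∀ v, (Fintype.card V : ℝ) / 4 ≤ #(inN E v)) →
      η * (Fintype.card V : ℝ) ^ 3 ≤ #(univ.filter (IsTri E)) →
      ∃ v : ZMod l → V, Function.Injective v ∧ ∀ i, E (v i) (v (i + 1)) := by
  obtain ⟨q, hq⟩ := exists_nat_ge (10 ^ 9 / η + 1)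
  have hq1 : 1 ≤ q := by
    have : (0 : ℝ) ≤ 10 ^ 9 / η := by positivity
    exact_mod_cast (by linarith : (1 : ℝ) ≤ q)
  have hqη : 10 ^ 9 ≤ q * η := by
    rw [← div_le_iff₀ hη]; linarith
  obtain ⟨m, hm⟩ : ∃ m, m + 3 = 10000 * q := ⟨10000 * q - 3, by omega⟩
  set M := m + 3 with hM
  obtain ⟨n₀, hn₀⟩ := exists_cycle_of_pattern M l (η / 2 / (M : ℝ) ^ l) (by positivity)
  refine ⟨max n₀ 1, fun V _ E hE hV hout hin htri => ?_⟩
  set n : ℝ := (Fintype.card V : ℝ) with hn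
  have hnpos : 0 < n := by
    rw [hn]; exact_mod_cast lt_of_lt_of_le one_pos ((le_max_right _ _).trans hV)
  have hqpos : (0 : ℝ) < q := by exact_mod_cast hq1
  let bad : Fin M → Finset (Fin M → V) := fun i => univ.filter fun w : Fin M → V =>
    (#(univ.filter fun j => j ≠ i ∧ E (w i) (w j)) : ℝ) + q < (M - 1) / 4 ∨
    (#(univ.filter fun j => j ≠ i ∧ E (w j) (w i)) : ℝ) + q < (M - 1) / 4
  have hM1 : (0 : ℝ) ≤ M - 1 := by
    rw [hM]; push_cast; linarith [(Nat.cast_nonneg m : (0 : ℝ) ≤ m)]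
  have hMq : (M : ℝ) = 10000 * q := by exact_mod_cast hm
  have hbad : ∀ i, (#(bad i) : ℝ) ≤ 20000 / q * n ^ M := by
    intro i
    have b1 := card_bad_le E i hqpos
    have b2 := card_bad_le (flip E) i hqpos
    rw [← hn] at b1 b2
    have hsub : #(bad i) ≤ _ := (card_le_card (t := (univ.filter fun w : Fin M → V =>
      (#(univ.filter fun j => j ≠ i ∧ E (w i) (w j)) : ℝ) + q <
        (M - 1) * (#(outN E (w i)) / n)) ∪ (univ.filter fun w : Fin M → V =>
      (#(univ.filter fun j => j ≠ i ∧ flip E (w i) (w j)) : ℝ) + q <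
        (M - 1) * (#(outN (flip E) (w i)) / n))) (by
        intro w hw
        simp only [bad, mem_filter, mem_univ, true_and, mem_union] at hw ⊢
        have hle : ∀ k : ℕ, n / 4 ≤ k → (M - 1 : ℝ) / 4 ≤ (M - 1) * (k / n) := fun k hk => by
          rw [div_eq_mul_inv]
          refine mul_le_mul_of_nonneg_left ?_ hM1
          rw [le_div_iff₀ hnpos]; linarith
        rcases hw with hw | hw
        · exact Or.inl (hw.trans_le (hle _ (hout _)))
        · exact Or.inr (hw.trans_le (hle _ (hin _))))).trans (card_union_le _ _)
    have hsub' : (#(bad i) : ℝ) ≤ M / (q : ℝ) ^ 2 * n ^ M + M / (q : ℝ) ^ 2 * n ^ M :=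
      le_trans (by exact_mod_cast hsub) (add_le_add b1 b2)
    refine hsub'.trans (le_of_eq ?_)
    rw [hMq]
    field_simp
    norm_num
  set B : Finset (Fin M → V) := univ.filter fun w => q < #(univ.filter fun i => w ∈ bad i) with hB
  have hBc : (#B : ℝ) ≤ 2 * 10 ^ 8 / q * n ^ M := by
    have h1 : (#B : ℝ) * q ≤ ∑ w, (#(univ.filter fun i => w ∈ bad i) : ℝ) := by
      rw [← nsmul_eq_mul]
      refine le_trans ?_ (sum_le_sum_of_subset_of_nonneg (subset_univ B)
        fun _ _ _ => Nat.cast_nonneg _)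
      refine card_nsmul_le_sum _ _ _ fun w hw => ?_
      exact_mod_cast (mem_filter.1 hw).2.le
    have h2 : ∑ w, (#(univ.filter fun i => w ∈ bad i) : ℝ) = ∑ i, (#(bad i) : ℝ) := by
      have := sum_card_bipartiteAbove_eq_sum_card_bipartiteBelow
        (s := (univ : Finset (Fin M → V))) (t := (univ : Finset (Fin M))) (fun w i => w ∈ bad i)
      simp only [bipartiteAbove, bipartiteBelow, filter_univ_mem] at this
      exact_mod_cast this
    have h3 : ∑ i, (#(bad i) : ℝ) ≤ M * (20000 / q * n ^ M) := by
      refine (sum_le_sum fun i _ => hbad i).trans (le_of_eq ?_)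
      rw [sum_const, card_univ, Fintype.card_fin, nsmul_eq_mul]
    rw [div_mul_eq_mul_div, le_div_iff₀ hqpos]
    have h4 : (M : ℝ) * (20000 / q * n ^ M) = 2 * 10 ^ 8 * n ^ M := by
      rw [hMq]; field_simp; norm_num
    linarith
  set T := univ.filter fun w : Fin M → V => IsTri E (w 0, w 1, w 2) with hT
  have hTc : η * n ^ M ≤ #T := by
    have h1 : (#(univ.filter (IsTri E)) : ℝ) * n ^ m ≤ #T := by
      rw [hn]; exact_mod_cast le_card_sample_tri E m
    have h2 : η * n ^ M = η * n ^ 3 * n ^ m := by rw [hM]; ring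
    rw [h2]
    exact (mul_le_mul_of_nonneg_right htri (by positivity)).trans h1
  set S := T \ (bad 0 ∪ bad 1 ∪ bad 2 ∪ B) with hS
  have hSc : η / 2 * n ^ M ≤ #S := by
    have h1 : #T ≤ #S + (#(bad 0) + #(bad 1) + #(bad 2) + #B) := by
      have := le_card_sdiff (bad 0 ∪ bad 1 ∪ bad 2 ∪ B) T
      rw [← hS] at this
      have u1 := card_union_le (bad 0 ∪ bad 1 ∪ bad 2) B
      have u2 := card_union_le (bad 0 ∪ bad 1) (bad 2)
      have u3 := card_union_le (bad 0) (bad 1)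
      omega
    have h2 : (#T : ℝ) ≤ #S + (#(bad 0) + #(bad 1) + #(bad 2) + #B) := by exact_mod_cast h1
    have b0 := hbad 0
    have b1 := hbad 1
    have b2 := hbad 2
    have h3 : (3 * 20000 / q + 2 * 10 ^ 8 / q) * n ^ M ≤ η / 2 * n ^ M := by
      refine mul_le_mul_of_nonneg_right ?_ (by positivity)
      rw [← add_div, div_le_iff₀ hqpos]
      linarith
    have h5 : (3 * 20000 / q + 2 * 10 ^ 8 / q) * n ^ M =
      3 * (20000 / q * n ^ M) + 2 * 10 ^ 8 / q * n ^ M := by ring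
    linarith
  have hpat : ∀ w ∈ S, ∃ φ : ZMod l → Fin M, ∀ i, E (w (φ i)) (w (φ (i + 1))) := by
    intro w hw
    simp only [hS, hT, hB, mem_sdiff, mem_filter, mem_univ, true_and, mem_union, not_or,
      not_lt] at hw
    obtain ⟨ht, ⟨⟨h0, h1⟩, h2⟩, hb⟩ := hw
    have hmem : ∀ i, i ∈ (univ.filter fun i => w ∉ bad i) ↔ w ∉ bad i := fun i => by
      rw [mem_filter]; simp
    refine exists_pattern_of_good hE hl h3 h4 hq1 hm w (univ.filter fun i => w ∉ bad i) ?_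
      (fun i hi => ?_) (fun i hi => ?_) ((hmem 0).2 h0) ((hmem 1).2 h1) ((hmem 2).2 h2) ht
    · have := card_filter_add_card_filter_not (s := (univ : Finset (Fin M))) fun i => w ∈ bad i
      rw [card_univ, Fintype.card_fin] at this
      omega
    · rw [hmem] at hi
      simp only [bad, mem_filter, mem_univ, true_and, not_or, not_lt] at hi
      exact hi.1
    · rw [hmem] at hi
      simp only [bad, mem_filter, mem_univ, true_and, not_or, not_lt] at hi
      exact hi.2
  have hirr : ∀ v, ¬ E v v := fun v hv => hE _ _ hv hv
  let Φ : (Fin M → V) → ZMod l → Fin M := fun w =>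
    if h : w ∈ S then (hpat w h).choose else fun _ => 0
  obtain ⟨φ, -, hφ⟩ := exists_le_card_fiber_of_nsmul_le_card_of_maps_to (s := S)
    (t := (univ : Finset (ZMod l → Fin M))) (f := Φ) (b := η / 2 / (M : ℝ) ^ l * n ^ M)
    (fun _ _ => mem_univ _) ⟨fun _ => 0, mem_univ _⟩ (by
      rw [card_univ, Fintype.card_fun, Fintype.card_fin, ZMod.card, nsmul_eq_mul]
      refine le_trans (le_of_eq ?_) hSc
      push_cast
      have : (M : ℝ) ≠ 0 := by rw [hMq]; positivity
      field_simp)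
  refine hn₀ V E hirr ((le_max_left _ _).trans hV) φ (hφ.trans ?_)
  norm_cast
  refine card_le_card fun w hw => ?_
  rw [mem_filter] at hw ⊢
  refine ⟨mem_univ _, ?_⟩
  rw [← hw.2]
  simp only [Φ, dif_pos hw.1]
  exact (hpat w hw.1).choose_spec

end Sampling

section NearBipartite

variable {V : Type} [Fintype V]

/-- The underlying simple graph. -/
def underlying {V : Type} (E : V → V → Prop) (hE : ∀ u v, E u v → ¬ E v u) : SimpleGraph V where
  Adj u v := E u v ∨ E v u
  symm := ⟨fun _ _ h => h.symm⟩
  loopless := ⟨fun v h => h.elim (fun h => hE v v h h) fun h => hE v v h h⟩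

lemma card_clique_le_card_tri {E : V → V → Prop} (hE : ∀ u v, E u v → ¬ E v u) :
    #((underlying E hE).cliqueFinset 3) ≤ #(univ.filter (IsTri E)) := by
  refine card_le_card_of_surjOn (fun t => {t.1, t.2.1, t.2.2}) fun s hs => ?_
  rw [mem_coe, SimpleGraph.mem_cliqueFinset_iff, SimpleGraph.is3Clique_iff] at hs
  obtain ⟨a, b, c, hab, hac, hbc, rfl⟩ := hs
  have hab : E a b ∨ E b a := hab
  have hac : E a c ∨ E c a := hac
  have hbc : E b c ∨ E c b := hbc
  have key : ∀ x y z, E x y → E y z → (E x z ∨ E z x) → ({x, y, z} : Finset V) = {a, b, c} →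
      ({a, b, c} : Finset V) ∈ (fun t : V × V × V => ({t.1, t.2.1, t.2.2} : Finset V)) ''
        (univ.filter (IsTri E) : Finset (V × V × V)) := fun x y z h1 h2 h3 h4 =>
    ⟨(x, y, z), by simpa [IsTri] using ⟨h1, h2, h3⟩, h4⟩
  rcases hab with h1 | h1
  · rcases hbc with h2 | h2
    · exact key a b c h1 h2 hac rfl
    · rcases hac with h3 | h3
      · exact key a c b h3 h2 (Or.inl h1) (by grind)
      · exact key c a b h3 h1 (Or.inl h2) (by grind)
  · rcases hac with h2 | h2
    · exact key b a c h1 h2 hbc (by grind)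
    · rcases hbc with h3 | h3
      · exact key b c a h3 h2 (Or.inl h1) (by grind)
      · exact key c b a h3 h1 (Or.inl h2) (by grind)

/-- A graph close to a triangle-free subgraph, of minimum degree nearly half its order, is nearly
bipartite. -/
lemma exists_bipartition (G G' : SimpleGraph V) (hle : G' ≤ G) (δ : ℝ) (hδ : 0 < δ)
    (hδ1 : δ < 1 / 20) (hV : 0 < Fintype.card V)
    (hdeg : ∀ v, (Fintype.card V : ℝ) / 2 ≤ G.degree v)
    (hE : (#G.edgeFinset - #G'.edgeFinset : ℝ) < δ ^ 2 / 2 * (Fintype.card V : ℝ) ^ 2)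
    (hfree : G'.CliqueFree 3) :
    ∃ A B : Finset V, Disjoint A B ∧ (#(univ \ (A ∪ B)) : ℝ) ≤ δ * Fintype.card V ∧
      (∀ v ∈ A, (#(G.neighborFinset v \ B) : ℝ) ≤ 2 * δ * Fintype.card V) ∧
      ∀ v ∈ B, (#(G.neighborFinset v \ A) : ℝ) ≤ 2 * δ * Fintype.card V := by
  set n : ℝ := (Fintype.card V : ℝ) with hn
  have hnpos : 0 < n := by rw [hn]; exact_mod_cast hV
  set X : Finset V := univ.filter fun v => δ * n ≤ #(G.neighborFinset v \ G'.neighborFinset v)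
    with hX
  have hsub : ∀ v, G'.neighborFinset v ⊆ G.neighborFinset v := fun v w hw => by
    rw [SimpleGraph.mem_neighborFinset] at hw ⊢; exact hle hw
  have hXc : (#X : ℝ) ≤ δ * n := by
    have h1 : (#X : ℝ) * (δ * n) ≤ ∑ v, (#(G.neighborFinset v \ G'.neighborFinset v) : ℝ) := by
      rw [← nsmul_eq_mul]
      refine le_trans ?_ (sum_le_sum_of_subset_of_nonneg (subset_univ X)
        fun _ _ _ => Nat.cast_nonneg _)
      exact card_nsmul_le_sum _ _ _ fun w hw => (mem_filter.1 hw).2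
    have h2 : ∑ v, (#(G.neighborFinset v \ G'.neighborFinset v) : ℝ) =
        2 * (#G.edgeFinset - #G'.edgeFinset) := by
      have e : ∀ v, (#(G.neighborFinset v \ G'.neighborFinset v) : ℝ) =
          G.degree v - G'.degree v := fun v => by
        rw [card_sdiff_of_subset (hsub v), Nat.cast_sub (card_le_card (hsub v)),
          SimpleGraph.card_neighborFinset_eq_degree, SimpleGraph.card_neighborFinset_eq_degree]
      rw [sum_congr rfl fun v _ => e v, sum_sub_distrib]
      have e1 := G.sum_degrees_eq_twice_card_edges
      have e2 := G'.sum_degrees_eq_twice_card_edges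
      have e1' : (∑ v, G.degree v : ℝ) = 2 * #G.edgeFinset := by exact_mod_cast e1
      have e2' : (∑ v, G'.degree v : ℝ) = 2 * #G'.edgeFinset := by exact_mod_cast e2
      rw [e1', e2']; ring
    have h3 : (#X : ℝ) * (δ * n) < δ * n * (δ * n) := by nlinarith
    exact (lt_of_mul_lt_mul_right h3 (by positivity)).le
  let Y := {v // v ∉ X}
  let H : SimpleGraph Y := G'.comap Subtype.val
  have hXV : #X < Fintype.card V := by
    have : (#X : ℝ) < n := by nlinarith
    rw [hn] at this
    exact_mod_cast this
  obtain ⟨y, hy⟩ : ∃ y, y ∉ X := by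
    by_contra! h
    rw [eq_univ_iff_forall.2 h, card_univ] at hXV
    exact lt_irrefl _ hXV
  have : Nonempty Y := ⟨⟨y, hy⟩⟩
  have hmiss : ∀ v : Y, (#(G.neighborFinset v \ (H.neighborFinset v).map
      (Function.Embedding.subtype _)) : ℝ) ≤ 2 * δ * n := by
    intro v
    have h1 : G.neighborFinset v \ (H.neighborFinset v).map (Function.Embedding.subtype _) ⊆
        (G.neighborFinset v \ G'.neighborFinset v) ∪ X := by
      intro w hw
      rw [mem_sdiff] at hw
      by_cases hwX : w ∈ X
      · exact mem_union_right _ hwX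
      · refine mem_union_left _ (mem_sdiff.2 ⟨hw.1, fun h => hw.2 ?_⟩)
        refine mem_map.2 ⟨⟨w, hwX⟩, ?_, rfl⟩
        rw [SimpleGraph.mem_neighborFinset] at h ⊢
        exact h
    have h2 : (#(G.neighborFinset v \ (H.neighborFinset v).map (Function.Embedding.subtype _)) :
        ℝ) ≤ #(G.neighborFinset v \ G'.neighborFinset v) + #X := by
      exact_mod_cast (card_le_card h1).trans (card_union_le _ _)
    have h3 : (#(G.neighborFinset v.1 \ G'.neighborFinset v.1) : ℝ) ≤ δ * n := by
      have := v.2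
      simp only [hX, mem_filter, mem_univ, true_and, not_le] at this
      exact this.le
    linarith
  have hmin : ∀ v : Y, n / 2 - 2 * δ * n ≤ H.degree v := by
    intro v
    have h1 : #(G.neighborFinset v) ≤ #(G.neighborFinset v \ (H.neighborFinset v).map
        (Function.Embedding.subtype _)) + H.degree v := by
      rw [← SimpleGraph.card_neighborFinset_eq_degree,
        ← card_map (Function.Embedding.subtype _)]
      refine le_trans (card_le_card ?_) (card_union_le _ _)
      intro w hw
      simp only [mem_union, mem_sdiff, hw, true_and]
      exact (Classical.em _).symm
    have h2 : (#(G.neighborFinset v) : ℝ) ≤ #(G.neighborFinset v \ (H.neighborFinset v).map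
        (Function.Embedding.subtype _)) + H.degree v := by exact_mod_cast h1
    have h3 := hdeg v
    rw [← SimpleGraph.card_neighborFinset_eq_degree] at h3
    have := hmiss v
    linarith
  have hcol : H.Colorable 2 := by
    refine SimpleGraph.colorable_of_cliqueFree_lt_minDegree ?_ ?_
    · exact hfree.comap ⟨(SimpleGraph.Embedding.comap (Function.Embedding.subtype _) G').toCopy⟩
    · have hYV : Fintype.card Y ≤ Fintype.card V := Fintype.card_subtype_le _
      have hYV' : (Fintype.card Y : ℝ) ≤ n := by rw [hn]; exact_mod_cast hYV
      obtain ⟨v, hv⟩ := H.exists_minimal_degree_vertex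
      have h1 := hmin v
      rw [← hv] at h1
      rw [Nat.div_lt_iff_lt_mul (by norm_num)]
      have : (2 * (Fintype.card Y : ℝ)) < H.minDegree * 5 := by nlinarith
      have : (2 * Fintype.card Y) < H.minDegree * 5 := by exact_mod_cast this
      simpa using this
  obtain ⟨C⟩ := hcol
  have hside : ∀ i j : Fin 2, (∀ x : Fin 2, x ≠ i → x = j) → ∀ v : Y, C v = i →
      (#(G.neighborFinset v \ (univ.filter fun w : Y => C w = j).map
      (Function.Embedding.subtype _)) : ℝ) ≤ 2 * δ * n := by
    intro i j hij v hv
    refine le_trans ?_ (hmiss v)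
    norm_cast
    refine card_le_card (sdiff_subset_sdiff le_rfl (map_subset_map.2 fun w hw => ?_))
    rw [SimpleGraph.mem_neighborFinset] at hw
    refine mem_filter.2 ⟨mem_univ _, hij _ fun h => C.valid hw ?_⟩
    rw [hv, h]
  refine ⟨(univ.filter fun w : Y => C w = 0).map (Function.Embedding.subtype _),
    (univ.filter fun w : Y => C w = 1).map (Function.Embedding.subtype _), ?_, ?_, ?_, ?_⟩
  · rw [disjoint_map, disjoint_left]
    intro w h0 h1
    rw [mem_filter] at h0 h1
    exact absurd (h0.2.symm.trans h1.2) (by decide)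
  · refine le_trans ?_ hXc
    norm_cast
    refine card_le_card fun v hv => ?_
    by_contra hvX
    rw [mem_sdiff, mem_union, not_or] at hv
    have : C ⟨v, hvX⟩ = 0 ∨ C ⟨v, hvX⟩ = 1 := by
      generalize C ⟨v, hvX⟩ = i; fin_cases i <;> simp
    rcases this with h | h
    · exact hv.2.1 (mem_map.2 ⟨⟨v, hvX⟩, mem_filter.2 ⟨mem_univ _, h⟩, rfl⟩)
    · exact hv.2.2 (mem_map.2 ⟨⟨v, hvX⟩, mem_filter.2 ⟨mem_univ _, h⟩, rfl⟩)
  · intro v hv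
    obtain ⟨w, hw, rfl⟩ := mem_map.1 hv
    exact hside 0 1 (by decide) w (mem_filter.1 hw).2
  · intro v hv
    obtain ⟨w, hw, rfl⟩ := mem_map.1 hv
    exact hside 1 0 (by decide) w (mem_filter.1 hw).2

/-- A graph of semidegree at least a quarter of its order either has a cycle of length `l` or is
nearly bipartite. -/
theorem exists_near_bipartite (l : ℕ) [NeZero l] (hl : 9 ≤ l) (h3 : 3 ∣ l) (h4 : ¬ 4 ∣ l)
    (μ : ℝ) (hμ : 0 < μ) :
    ∃ n₀ : ℕ, ∀ (V : Type) [Fintype V] (E : V → V → Prop), (∀ u v, E u v → ¬ E v u) →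
      n₀ ≤ Fintype.card V → (∀ v, (Fintype.card V : ℝ) / 4 ≤ #(outN E v)) →
      (∀ v, (Fintype.card V : ℝ) / 4 ≤ #(inN E v)) →
      (¬ ∃ v : ZMod l → V, Function.Injective v ∧ ∀ i, E (v i) (v (i + 1))) →
      ∃ A B : Finset V, Disjoint A B ∧ (#(univ \ (A ∪ B)) : ℝ) ≤ μ * Fintype.card V ∧
        (∀ v ∈ A, (#(outN E v \ B) : ℝ) ≤ μ * Fintype.card V ∧
          (#(inN E v \ B) : ℝ) ≤ μ * Fintype.card V) ∧
        ∀ v ∈ B, (#(outN E v \ A) : ℝ) ≤ μ * Fintype.card V ∧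
          (#(inN E v \ A) : ℝ) ≤ μ * Fintype.card V := by
  set δ : ℝ := min (μ / 2) (1 / 40) with hδ
  have hδpos : 0 < δ := by rw [hδ]; positivity
  have hδ1 : δ ≤ 1 / 40 := min_le_right _ _
  have hδμ : 2 * δ ≤ μ := by have : δ ≤ μ / 2 := min_le_left _ _; linarith
  have hρ : 0 < SimpleGraph.triangleRemovalBound (δ ^ 2 / 2) :=
    SimpleGraph.triangleRemovalBound_pos (by positivity)
  obtain ⟨n₀, hn₀⟩ := exists_cycle_of_many_tri l hl h3 h4 _ hρ
  refine ⟨max n₀ 1, fun V _ E hE hV hout hin hno => ?_⟩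
  have hpos : 0 < Fintype.card V := lt_of_lt_of_le one_pos ((le_max_right _ _).trans hV)
  have htri : (#(univ.filter (IsTri E)) : ℝ) <
      SimpleGraph.triangleRemovalBound (δ ^ 2 / 2) * (Fintype.card V : ℝ) ^ 3 := by
    by_contra! h
    exact hno (hn₀ V E hE ((le_max_left _ _).trans hV) hout hin h)
  set G := underlying E hE with hG
  have hcl : (#(G.cliqueFinset 3) : ℝ) <
      SimpleGraph.triangleRemovalBound (δ ^ 2 / 2) * (Fintype.card V : ℝ) ^ 3 :=
    lt_of_le_of_lt (by exact_mod_cast card_clique_le_card_tri hE) htri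
  obtain ⟨G', hle, _, hed, hfree⟩ := SimpleGraph.triangle_removal hcl
  have hnb : ∀ v, G.neighborFinset v = outN E v ∪ inN E v := fun v => by
    ext w
    simp [hG, underlying]
  obtain ⟨A, B, hd, hR, hA, hB⟩ := exists_bipartition G G' hle δ hδpos (by linarith) hpos
    (fun v => by
      rw [← SimpleGraph.card_neighborFinset_eq_degree, hnb, card_union_of_disjoint]
      · have := hout v; have := hin v; push_cast; linarith
      · rw [disjoint_left]
        intro w h1 h2
        rw [mem_outN] at h1
        rw [mem_inN] at h2
        exact hE _ _ h1 h2)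
    (by
      push_cast at hed
      convert hed using 4
      ext; simp) hfree
  have hn : (0 : ℝ) ≤ Fintype.card V := Nat.cast_nonneg _
  have fin : ∀ (v : V) (B N : Finset V), N ⊆ G.neighborFinset v →
      (#(G.neighborFinset v \ B) : ℝ) ≤ 2 * δ * Fintype.card V →
      (#(N \ B) : ℝ) ≤ μ * Fintype.card V := by
    intro v B N hN h
    have : (#(N \ B) : ℝ) ≤ #(G.neighborFinset v \ B) := by
      exact_mod_cast card_le_card (sdiff_subset_sdiff hN le_rfl)
    exact this.trans (h.trans (mul_le_mul_of_nonneg_right hδμ hn))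
  refine ⟨A, B, hd, hR.trans (mul_le_mul_of_nonneg_right (by linarith) hn), fun v hv => ?_,
    fun v hv => ?_⟩
  · exact ⟨fin v B _ (by rw [hnb]; exact subset_union_left) (hA v hv),
      fin v B _ (by rw [hnb]; exact subset_union_right) (hA v hv)⟩
  · exact ⟨fin v A _ (by rw [hnb]; exact subset_union_left) (hB v hv),
      fin v A _ (by rw [hnb]; exact subset_union_right) (hB v hv)⟩

end NearBipartite

section Core

variable {V : Type} [Fintype V] {E : V → V → Prop}

/-- Disjoint classes arranged cyclically so that every vertex is joined to all but few of the
vertices of the next class and from all but few of those of the previous class. -/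
structure Core (E : V → V → Prop) (e : ℕ) (U : ZMod 4 → Finset V) : Prop where
  eq_of_mem : ∀ {i j v}, v ∈ U i → v ∈ U j → i = j
  out_le : ∀ {i v}, v ∈ U i → Fintype.card V ≤ 4 * (#((U (i + 1)).filter (E v ·)) + e)
  in_le : ∀ {i v}, v ∈ U i → Fintype.card V ≤ 4 * (#((U (i - 1)).filter (E · v)) + e)
  nonempty : (U 0).Nonempty

omit [Fintype V] in
/-- If every vertex of `P` is related to all but `s` vertices of `Q`, then most vertices of `Q` are
related to most vertices of `P`. -/
lemma card_filter_few_le {P Q : Finset V} {r : V → V → Prop} {s t : ℕ}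
    (h : ∀ p ∈ P, #Q ≤ #(Q.filter (r p ·)) + s) (hst : #P * s ≤ t * t) :
    #(Q.filter fun q => #(P.filter (r · q)) + t < #P) ≤ t := by
  set D := Q.filter fun q => #(P.filter (r · q)) + t < #P with hD
  have h1 : #D * (t + 1) ≤ ∑ q ∈ D, #(P.filter fun p => ¬ r p q) := by
    rw [← smul_eq_mul]
    refine card_nsmul_le_sum _ _ _ fun q hq => ?_
    have := (mem_filter.1 hq).2
    have := card_filter_add_card_filter_not (s := P) (fun p => r p q)
    omega
  have h2 : ∑ q ∈ D, #(P.filter fun p => ¬ r p q) = ∑ p ∈ P, #(D.filter fun q => ¬ r p q) :=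
    (sum_card_bipartiteAbove_eq_sum_card_bipartiteBelow (s := P) (t := D)
      (fun p q => ¬ r p q)).symm
  have h3 : ∑ p ∈ P, #(D.filter fun q => ¬ r p q) ≤ #P * s := by
    rw [← smul_eq_mul]
    refine sum_le_card_nsmul _ _ _ fun p hp => ?_
    have h4 : #(D.filter fun q => ¬ r p q) ≤ #(Q.filter fun q => ¬ r p q) :=
      card_le_card (filter_subset_filter _ (filter_subset _ _))
    have := card_filter_add_card_filter_not (s := Q) (fun q => r p q)
    have := h p hp
    omega
  nlinarith

omit [Fintype V] in
lemma card_out_add_card_in_le (hE : ∀ u v, E u v → ¬ E v u) (Q : Finset V) (v : V) :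
    #(Q.filter (E v ·)) + #(Q.filter (E · v)) ≤ #Q := by
  rw [← card_union_of_disjoint]
  · exact card_le_card (union_subset (filter_subset _ _) (filter_subset _ _))
  · rw [disjoint_filter]
    exact fun w _ h1 h2 => hE _ _ h1 h2

omit [Fintype V] in
lemma card_filter_split {P Q : Finset V} (h : Q ⊆ P) (p : V → Prop) :
    #(P.filter p) = #(Q.filter p) + #((P \ Q).filter p) := by
  rw [← card_union_of_disjoint, ← filter_union, union_sdiff_of_subset h]
  exact disjoint_filter_filter disjoint_sdiff

omit [Fintype V] in
lemma card_filter_sdiff_le (P Q : Finset V) (p : V → Prop) :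
    #(P.filter p) ≤ #((P \ Q).filter p) + #Q := by
  refine le_trans (card_le_card fun x hx => ?_) (card_union_le _ _)
  rw [mem_filter] at hx
  by_cases h : x ∈ Q
  · exact mem_union_right _ h
  · exact mem_union_left _ (mem_filter.2 ⟨mem_sdiff.2 ⟨hx.1, h⟩, hx.2⟩)

/-- The vertices of `A` and `B` have almost half of their neighbours on the other side. -/
structure NearBip (E : V → V → Prop) (m : ℕ) (A B : Finset V) : Prop where
  disj : Disjoint A B
  out_left : ∀ v ∈ A, Fintype.card V ≤ 4 * (#(B.filter (E v ·)) + m)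
  in_left : ∀ v ∈ A, Fintype.card V ≤ 4 * (#(B.filter (E · v)) + m)
  out_right : ∀ v ∈ B, Fintype.card V ≤ 4 * (#(A.filter (E v ·)) + m)
  in_right : ∀ v ∈ B, Fintype.card V ≤ 4 * (#(A.filter (E · v)) + m)
  left_nonempty : A.Nonempty
  right_nonempty : B.Nonempty

variable {m : ℕ} {A B : Finset V}

lemma NearBip.symm (h : NearBip E m A B) : NearBip E m B A :=
  ⟨h.disj.symm, h.out_right, h.in_right, h.out_left, h.in_left, h.right_nonempty, h.left_nonempty⟩

lemma NearBip.card_add_le (h : NearBip E m A B) : #A + #B ≤ Fintype.card V := by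
  rw [← card_union_of_disjoint h.disj]
  exact card_le_univ _

lemma NearBip.le_card_right (h : NearBip E m A B) (hE : ∀ u v, E u v → ¬ E v u) :
    Fintype.card V ≤ 2 * #B + 4 * m := by
  obtain ⟨v, hv⟩ := h.left_nonempty
  have := h.out_left v hv
  have := h.in_left v hv
  have := card_out_add_card_in_le hE B v
  omega

/-- A set with few out-neighbours spans the structure of a blow-up of the directed 4-cycle. -/
lemma exists_core (hE : ∀ u v, E u v → ¬ E v u) (h : NearBip E m A B) {t₁ t₂ : ℕ}
    (ht₁ : Fintype.card V * (13 * m) ≤ t₁ * t₁)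
    (ht₂ : Fintype.card V * (5 * m + t₁) ≤ t₂ * t₂)
    {X : Finset V} (hXB : X ⊆ B) (hX0 : X.Nonempty) (hX : Fintype.card V ≤ 4 * (#X + 2 * m))
    (hY : 4 * #(A.filter fun y => ∃ x ∈ X, E x y) ≤ Fintype.card V + 32 * m) :
    ∃ U : ZMod 4 → Finset V, Core E (10 * m + 2 * t₁ + 2 * t₂) U := by
  have cAB := h.card_add_le
  have cA := h.symm.le_card_right hE
  have cB := h.le_card_right hE
  have hcard : ∀ S : Finset V, #S ≤ Fintype.card V := fun S => card_le_univ S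
  set Y := A.filter fun y => ∃ x ∈ X, E x y with hYdef
  have hYA : Y ⊆ A := filter_subset _ _
  have hYout : ∀ x ∈ X, Fintype.card V ≤ 4 * (#(Y.filter (E x ·)) + m) := fun x hx => by
    refine (h.out_right x (hXB hx)).trans ?_
    have : #(A.filter (E x ·)) ≤ #(Y.filter (E x ·)) := card_le_card fun y hy => by
      rw [mem_filter] at hy
      exact mem_filter.2 ⟨mem_filter.2 ⟨hy.1, x, hx, hy.2⟩, hy.2⟩
    omega
  have cYA : #(A \ Y) + #Y = #A := card_sdiff_add_card_eq_card hYA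
  have cXB : #(B \ X) + #X = #B := card_sdiff_add_card_eq_card hXB
  have hin : ∀ x ∈ X, Fintype.card V ≤ 4 * (#((A \ Y).filter (E · x)) + 10 * m) := fun x hx => by
    have h1 := h.in_right x (hXB hx)
    have h2 := hYout x hx
    have h3 := card_out_add_card_in_le hE Y x
    have h4 := card_filter_split hYA (E · x)
    omega
  obtain ⟨x₀, hx₀⟩ := hX0
  have cY : Fintype.card V ≤ 4 * (#Y + m) := by
    have := hYout x₀ hx₀
    have := card_filter_le Y (E x₀ ·)
    omega
  set D₁ := Y.filter fun q => #(X.filter (E · q)) + t₁ < #X with hD₁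
  have cD₁ : #D₁ ≤ t₁ := card_filter_few_le (s := 9 * m) (fun x hx => by
    have := hYout x hx; omega) (by nlinarith [hcard X])
  set D₃ := (A \ Y).filter fun q => #(X.filter (E q ·)) + t₁ < #X with hD₃
  have cD₃ : #D₃ ≤ t₁ := card_filter_few_le (r := fun x q => E q x) (s := 13 * m) (fun x hx => by
    have := hin x hx; omega) (by nlinarith [hcard X])
  have hV₁ : ∀ y ∈ Y \ D₁, #X ≤ #(X.filter (E · y)) + t₁ := fun y hy => by
    rw [mem_sdiff] at hy
    by_contra hlt
    exact hy.2 (mem_filter.2 ⟨hy.1, by omega⟩)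
  have hV₃ : ∀ y ∈ (A \ Y) \ D₃, #X ≤ #(X.filter (E y ·)) + t₁ := fun y hy => by
    rw [mem_sdiff] at hy
    by_contra hlt
    exact hy.2 (mem_filter.2 ⟨hy.1, by omega⟩)
  have hV₁out : ∀ y ∈ Y \ D₁, Fintype.card V ≤ 4 * (#((B \ X).filter (E y ·)) + m + t₁) :=
    fun y hy => by
    have h1 := h.out_left y (hYA (mem_sdiff.1 hy).1)
    have h2 := card_out_add_card_in_le hE X y
    have h3 := hV₁ y hy
    have h4 := card_filter_split hXB (E y ·)
    omega
  set D₂ := (B \ X).filter fun q => #((Y \ D₁).filter (E · q)) + t₂ < #(Y \ D₁) with hD₂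
  have cD₂ : #D₂ ≤ t₂ := card_filter_few_le (s := 5 * m + t₁) (fun y hy => by
    have := hV₁out y hy; omega) (by nlinarith [hcard (Y \ D₁)])
  have hV₂ : ∀ z ∈ (B \ X) \ D₂, #(Y \ D₁) ≤ #((Y \ D₁).filter (E · z)) + t₂ := fun z hz => by
    rw [mem_sdiff] at hz
    by_contra hlt
    exact hz.2 (mem_filter.2 ⟨hz.1, by omega⟩)
  have cYD : #Y ≤ #(Y \ D₁) + #D₁ := by
    have := le_card_sdiff D₁ Y; omega
  have hmem : ∀ {i v}, v ∈ (![X, Y \ D₁, (B \ X) \ D₂, (A \ Y) \ D₃] : ZMod 4 → Finset V) i →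
      i = (if v ∈ A then (if v ∈ Y then 1 else 3) else if v ∈ X then 0 else 2 : ZMod 4) := by
    intro i v hv
    have hAB : v ∈ A → v ∉ B := fun h1 h2 => disjoint_left.1 h.disj h1 h2
    have := @hXB v
    have := @hYA v
    fin_cases i
    all_goals simp at hv
    · rw [if_neg (by tauto), if_pos hv]; rfl
    · rw [if_pos (by tauto), if_pos (by tauto)]; rfl
    · rw [if_neg (by tauto), if_neg (by tauto)]; rfl
    · rw [if_pos (by tauto), if_neg (by tauto)]; rfl
  refine ⟨![X, Y \ D₁, (B \ X) \ D₂, (A \ Y) \ D₃], ⟨fun hi hj => (hmem hi).trans (hmem hj).symm,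
    fun {i v} hv => ?_, fun {i v} hv => ?_, ⟨x₀, hx₀⟩⟩⟩
  · fin_cases i
    · have h1 := hYout v hv
      have h2 := card_filter_sdiff_le Y D₁ (E v ·)
      change _ ≤ 4 * (#((Y \ D₁).filter (E v ·)) + _)
      omega
    · have h1 := hV₁out v hv
      have h2 := card_filter_sdiff_le (B \ X) D₂ (E v ·)
      change _ ≤ 4 * (#(((B \ X) \ D₂).filter (E v ·)) + _)
      omega
    · have h1 := hV₂ v hv
      have hvB := (mem_sdiff.1 (mem_sdiff.1 hv).1).1
      have h2 := h.out_right v hvB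
      have h3 := card_out_add_card_in_le hE (Y \ D₁) v
      have h4 := card_filter_split hYA (E v ·)
      have h5 := card_filter_sdiff_le Y D₁ (E v ·)
      have h6 := card_filter_sdiff_le (A \ Y) D₃ (E v ·)
      change _ ≤ 4 * (#(((A \ Y) \ D₃).filter (E v ·)) + _)
      omega
    · have h1 := hV₃ v hv
      change _ ≤ 4 * (#(X.filter (E v ·)) + _)
      omega
  · fin_cases i
    · have h1 := hin v hv
      have h2 := card_filter_sdiff_le (A \ Y) D₃ (E · v)
      change _ ≤ 4 * (#(((A \ Y) \ D₃).filter (E · v)) + _)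
      omega
    · have h1 := hV₁ v hv
      change _ ≤ 4 * (#(X.filter (E · v)) + _)
      omega
    · have h1 := hV₂ v hv
      change _ ≤ 4 * (#((Y \ D₁).filter (E · v)) + _)
      omega
    · have h1 := hV₃ v hv
      have hvA := (mem_sdiff.1 (mem_sdiff.1 hv).1).1
      have h2 := h.in_left v hvA
      have h3 := card_out_add_card_in_le hE X v
      have h4 := card_filter_split hXB (E · v)
      have h5 := card_filter_sdiff_le (B \ X) D₂ (E · v)
      change _ ≤ 4 * (#(((B \ X) \ D₂).filter (E · v)) + _)
      omega

/-- Large subsets of `B` have many out-neighbours in `A`. -/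
def Expands (E : V → V → Prop) (m : ℕ) (A B : Finset V) : Prop :=
  ∀ X ⊆ B, Fintype.card V ≤ 4 * (#X + 2 * m) →
    Fintype.card V + 32 * m < 4 * #(A.filter fun y => ∃ x ∈ X, E x y)

lemma core_or_expands (hE : ∀ u v, E u v → ¬ E v u) (h : NearBip E m A B) {t₁ t₂ : ℕ}
    (hm : 8 * m < Fintype.card V)
    (ht₁ : Fintype.card V * (13 * m) ≤ t₁ * t₁)
    (ht₂ : Fintype.card V * (5 * m + t₁) ≤ t₂ * t₂) :
    (∃ U : ZMod 4 → Finset V, Core E (10 * m + 2 * t₁ + 2 * t₂) U) ∨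
      (Expands E m A B ∧ Expands E m B A) := by
  by_cases h1 : Expands E m A B
  · by_cases h2 : Expands E m B A
    · exact Or.inr ⟨h1, h2⟩
    · simp only [Expands, not_forall, not_lt] at h2
      obtain ⟨X, hX, hc, hY⟩ := h2
      exact Or.inl (exists_core hE h.symm ht₁ ht₂ hX (card_pos.1 (by omega)) hc hY)
  · simp only [Expands, not_forall, not_lt] at h1
    obtain ⟨X, hX, hc, hY⟩ := h1
    exact Or.inl (exists_core hE h ht₁ ht₂ hX (card_pos.1 (by omega)) hc hY)

end Core

section Routes

variable {V : Type} {E : V → V → Prop} {K : ℕ}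

/-- `Conn E K L u v`: there is a path from `u` to `v` with `L` inner vertices, which avoid any
given small set. -/
def Conn (E : V → V → Prop) (K L : ℕ) (u v : V) : Prop :=
  ∀ F : Finset V, #F + L ≤ K → ∃ s : List V, s.length = L ∧ List.IsChain E (u :: (s ++ [v])) ∧
    s.Nodup ∧ ∀ x ∈ s, x ∉ F

lemma Conn.of_edge {u v : V} (h : E u v) : Conn E K 0 u v := fun _ _ =>
  ⟨[], rfl, by simpa using h, List.nodup_nil, by simp⟩

lemma Conn.step {L : ℕ} {u v : V} (P : Finset V) (hP : K ≤ #(P.filter (E u ·)))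
    (h : ∀ x ∈ P, Conn E K L x v) : Conn E K (L + 1) u v := by
  intro F hF
  obtain ⟨x, hx, hxF⟩ := exists_mem_notMem_of_card_lt_card (s := F) (t := P.filter (E u ·))
    (by omega)
  rw [mem_filter] at hx
  obtain ⟨s, hs, hc, hn, hd⟩ := h x hx.1 (insert x F) (by rw [card_insert_of_notMem hxF]; omega)
  refine ⟨x :: s, by simp [hs], ?_, ?_, ?_⟩
  · rw [List.cons_append, List.isChain_cons_cons]
    exact ⟨hx.2, hc⟩
  · rw [List.nodup_cons]
    exact ⟨fun h => hd x h (mem_insert_self _ _), hn⟩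
  · intro y hy
    rcases List.mem_cons.1 hy with rfl | hy
    · exact hxF
    · exact fun h => hd y hy (mem_insert_of_mem h)

lemma Conn.of_card {u v : V} (P : Finset V) (hP : K ≤ #(P.filter fun x => E u x ∧ E x v)) :
    Conn E K 1 u v := by
  refine Conn.step (P.filter (E · v)) ?_ fun x hx => Conn.of_edge (mem_filter.1 hx).2
  rw [filter_filter]
  simpa only [and_comm] using hP

/-- The first vertex of a route with end `q`. -/
def nextPoint (r : List (V × ℕ)) (q : V) : V := (r.head?.map Prod.fst).getD q

/-- Consecutive points of a route are connected, by paths with the given numbers of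
inner vertices. -/
def Route (E : V → V → Prop) (K : ℕ) : List (V × ℕ) → V → Prop
  | [], _ => True
  | (p, L) :: r, q => Conn E K L p (nextPoint r q) ∧ Route E K r q

lemma Route.exists_path (r : List (V × ℕ)) (q : V) (F : Finset V)
    (hF : ∀ x ∈ r.map Prod.fst, x ∈ F) (hn : (r.map Prod.fst).Nodup) (hr : Route E K r q)
    (hK : #F + (r.map (·.2 + 1)).sum ≤ K) :
    ∃ s : List V, s.length = (r.map (·.2 + 1)).sum ∧ List.IsChain E (s ++ [q]) ∧
      (s ++ [q]).head? = some (nextPoint r q) ∧ s.Nodup ∧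
      ∀ x ∈ s, x ∈ F → x ∈ r.map Prod.fst := by
  induction r with
  | nil => exact ⟨[], rfl, by simp, rfl, List.nodup_nil, by simp⟩
  | cons a r ih =>
    obtain ⟨p, L⟩ := a
    simp only [List.map_cons, List.nodup_cons, List.sum_cons, List.mem_cons,
      forall_eq_or_imp] at hF hn hK ⊢
    obtain ⟨s, hs, hc, hh, hsn, hsF⟩ := ih hF.2 hn.2 hr.2 (by omega)
    obtain ⟨t, ht, htc, htn, htF⟩ := hr.1 (F ∪ s.toFinset) (by
      have := card_union_le F s.toFinset
      have := List.toFinset_card_le s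
      omega)
    have hpF : p ∈ F := hF.1
    have hps : p ∉ s := fun h => hn.1 (hsF p h hpF)
    have hpt : p ∉ t := fun h => htF p h (mem_union_left _ hpF)
    obtain ⟨z, hz⟩ : ∃ z, s ++ [q] = nextPoint r q :: z := by
      cases hsq : s ++ [q] with
      | nil => simp at hsq
      | cons a z =>
        rw [hsq, List.head?_cons, Option.some_inj] at hh
        exact ⟨z, by rw [hh]⟩
    refine ⟨p :: (t ++ s), by simp [hs, ht]; omega, ?_, rfl, ?_, ?_⟩
    · rw [List.cons_append, List.append_assoc, hz, ← List.cons_append, List.isChain_split]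
      exact ⟨htc, hz ▸ hc⟩
    · rw [List.nodup_cons, List.mem_append, not_or, List.nodup_append]
      refine ⟨⟨hpt, hps⟩, htn, hsn, fun a ha b hb hab => ?_⟩
      exact htF a ha (mem_union_right _ (by rw [hab]; simpa using hb))
    · intro x hx hxF
      rcases List.mem_cons.1 hx with rfl | hx
      · exact Or.inl rfl
      rcases List.mem_append.1 hx with hx | hx
      · exact absurd (mem_union_left _ hxF) (htF x hx)
      · exact Or.inr (hsF x hx hxF)

/-- A closed route yields a cycle. -/
lemma Route.exists_cycle {l : ℕ} [NeZero l] (r : List (V × ℕ)) (q : V)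
    (hq : nextPoint r q = q) (hn : (r.map Prod.fst).Nodup) (hr : Route E K r q)
    (hl : (r.map (·.2 + 1)).sum = l) (hK : 2 * l ≤ K) :
    ∃ v : ZMod l → V, Function.Injective v ∧ ∀ i, E (v i) (v (i + 1)) := by
  have hrl : r.length ≤ l := by
    rw [← hl]
    have := List.length_le_sum_of_one_le (r.map (·.2 + 1)) (by
      intro i hi
      obtain ⟨a, _, rfl⟩ := List.mem_map.1 hi
      omega)
    rwa [List.length_map] at this
  obtain ⟨s, hs, hc, hh, hsn, -⟩ := Route.exists_path r q (r.map Prod.fst).toFinset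
    (fun x hx => List.mem_toFinset.2 hx) hn hr (by
      have := List.toFinset_card_le (r.map Prod.fst)
      rw [List.length_map] at this
      omega)
  rw [hl] at hs
  have hlpos := NeZero.pos l
  refine ⟨fun i => s[i.val]'(by rw [hs]; exact ZMod.val_lt i), fun i j hij => ?_, fun i => ?_⟩
  · exact ZMod.val_injective l ((hsn.getElem_inj_iff).1 hij)
  · have hi := ZMod.val_lt i
    have h1 := List.isChain_iff_getElem.1 hc i.val (by simp [hs]; omega)
    rw [List.getElem_append_left (by omega)] at h1
    have h4 : (i + 1).val = (i.val + 1) % l := by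
      rw [ZMod.val_add, ZMod.val_one_eq_one_mod]
      simp
    simp only [h4]
    rcases (Nat.succ_le_of_lt hi).lt_or_eq with hlt | heq
    · rw [List.getElem_append_left (by omega)] at h1
      simpa only [Nat.mod_eq_of_lt hlt] using h1
    · have heq : i.val + 1 = l := heq
      have h0 : s[0] = q := by
        rw [hq, List.head?_eq_getElem?, List.getElem?_append_left (by omega)] at hh
        exact (List.getElem?_eq_some_iff.1 hh).2
      rw [List.getElem_append_right (by omega)] at h1
      simp only [List.getElem_singleton] at h1
      simp only [heq, Nat.mod_self]
      rwa [h0]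

end Routes

section Expanding

variable {V : Type} [Fintype V] {E : V → V → Prop} {m K : ℕ} {A B : Finset V}

lemma conn_two_of_expands (hE : ∀ u v, E u v → ¬ E v u) (h : NearBip E m A B)
    (hexp : Expands E m A B) (hKm : K ≤ m) {u v : V} (hu : u ∈ A) (hv : v ∈ B) :
    Conn E K 2 u v := by
  intro F hF
  set X := B.filter (E u ·) \ F with hX
  have cB := h.le_card_right hE
  have cAB := h.card_add_le
  have hXc := hexp X (sdiff_subset.trans (filter_subset _ _)) (by
    have := h.out_left u hu
    have := le_card_sdiff F (B.filter (E u ·))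
    rw [← hX] at this
    omega)
  have hin := h.in_right v hv
  set Y := A.filter fun y => ∃ x ∈ X, E x y
  obtain ⟨y, hy, hyF⟩ : ∃ y ∈ Y ∩ A.filter (E · v), y ∉ F := by
    refine exists_mem_notMem_of_card_lt_card ?_
    have h1 := card_union_add_card_inter Y (A.filter (E · v))
    have h2 : #(Y ∪ A.filter (E · v)) ≤ #A :=
      card_le_card (union_subset (filter_subset _ _) (filter_subset _ _))
    omega
  rw [mem_inter, mem_filter, mem_filter] at hy
  obtain ⟨⟨hyA, x, hxX, hxy⟩, -, hyv⟩ := hy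
  rw [hX, mem_sdiff, mem_filter] at hxX
  refine ⟨[x, y], rfl, by simp [hxX.1.2, hxy, hyv], ?_, ?_⟩
  · rw [List.nodup_cons]
    refine ⟨?_, List.nodup_singleton _⟩
    rw [List.mem_singleton]
    rintro rfl
    exact disjoint_left.1 h.disj hyA hxX.1.1
  · simp [hxX.2, hyF]

lemma conn_even_of_expands (hE : ∀ u v, E u v → ¬ E v u) (h : NearBip E m A B)
    (hexp : Expands E m A B) (hKm : K ≤ m) (hm : 8 * m ≤ Fintype.card V) {u v : V} (hu : u ∈ A)
    (hv : v ∈ B) (k : ℕ) : Conn E K (2 * k + 2) u v := by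
  induction k generalizing u with
  | zero => exact conn_two_of_expands hE h hexp hKm hu hv
  | succ k ih =>
    refine Conn.step (L := 2 * k + 2 + 1) B (by have := h.out_left u hu; omega) fun x hx => ?_
    exact Conn.step (L := 2 * k + 2) A (by have := h.out_right x hx; omega) fun y hy => ih hy

/-- The expanding case. -/
lemma exists_cycle_of_expands (hE : ∀ u v, E u v → ¬ E v u) (h : NearBip E m A B)
    (hAB : Expands E m A B) (hBA : Expands E m B A) {l : ℕ} [NeZero l] (hl : 9 ≤ l)
    (hlm : 2 * l ≤ m) (hm : 8 * m < Fintype.card V) (hR : #(univ \ (A ∪ B)) ≤ m)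
    (hdeg : ∀ v, Fintype.card V < 4 * #(outN E v)) (hdeg' : ∀ v, Fintype.card V < 4 * #(inN E v)) :
    ∃ v : ZMod l → V, Function.Injective v ∧ ∀ i, E (v i) (v (i + 1)) := by
  have hirr : ∀ u v, E u v → u ≠ v := fun u v huv h => hE u v huv (h ▸ huv)
  rcases Nat.even_or_odd l with hev | hodd
  · obtain ⟨a, ha⟩ := h.left_nonempty
    obtain ⟨b, hb⟩ : (B.filter (E a ·)).Nonempty := card_pos.1 (by have := h.out_left a ha; omega)
    rw [mem_filter] at hb
    obtain ⟨k, hk⟩ : ∃ k, l = 2 * k + 4 := ⟨l / 2 - 2, by have := hev.two_dvd; omega⟩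
    refine Route.exists_cycle (K := m) [(a, 0), (b, 2 * k + 2)] a rfl
      (by simpa using hirr _ _ hb.2)
      ⟨Conn.of_edge hb.2, conn_even_of_expands hE h.symm hBA le_rfl hm.le hb.1 ha k, trivial⟩
      (by simp; omega) hlm
  obtain ⟨k, hk⟩ : ∃ k, l = 2 * k + 5 := ⟨(l - 5) / 2, by obtain ⟨j, hj⟩ := hodd; omega⟩
  -- a vertex joining the two sides
  have cross : ∀ {A B : Finset V}, NearBip E m A B → Expands E m B A → ∀ {a r b}, a ∈ A → b ∈ B →
      r ∉ A → r ∉ B → E a r → E r b →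
      ∃ v : ZMod l → V, Function.Injective v ∧ ∀ i, E (v i) (v (i + 1)) := by
    intro A B h hBA a r b ha hb hrA hrB har hrb
    have hab : a ≠ b := fun hab => disjoint_left.1 h.disj ha (hab ▸ hb)
    refine Route.exists_cycle (K := m) [(a, 0), (r, 0), (b, 2 * k + 2)] a rfl ?_
      ⟨Conn.of_edge har, Conn.of_edge hrb,
        conn_even_of_expands hE h.symm hBA le_rfl hm.le hb ha k, trivial⟩
      (by simp; omega) hlm
    have := hirr _ _ har
    have := hirr _ _ hrb
    simp; tauto
  by_contra hno
  have hcross₁ : ∀ a r b, a ∈ A → b ∈ B → r ∉ A → r ∉ B → E a r → ¬ E r b :=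
    fun a r b ha hb hrA hrB har hrb => hno (cross h hBA ha hb hrA hrB har hrb)
  have hcross₂ : ∀ a r b, a ∈ A → b ∈ B → r ∉ A → r ∉ B → E b r → ¬ E r a :=
    fun a r b ha hb hrA hrB har hrb => hno (cross h.symm hAB hb ha hrB hrA har hrb)
  -- an edge inside a side
  have side : ∀ {A B : Finset V}, NearBip E m A B → Expands E m B A → ∀ p : V → Prop,
      (∀ v, p v → 2 ≤ #(A.filter (E v ·)) ∧ 2 ≤ #(A.filter (E · v))) → (∃ v, p v) →
      2 * #(univ.filter fun v => ¬ p v) ≤ Fintype.card V →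
      ∃ v : ZMod l → V, Function.Injective v ∧ ∀ i, E (v i) (v (i + 1)) := by
    intro A B h hBA p hp ⟨u, hu⟩ hc
    obtain ⟨x, y, hx, hy, hxy⟩ : ∃ x y, p x ∧ p y ∧ E x y := by
      by_contra! hcon
      have h1 : outN E u ∪ inN E u ⊆ univ.filter fun v => ¬ p v := fun v hv => by
        rw [mem_filter]
        refine ⟨mem_univ _, fun hpv => ?_⟩
        rcases mem_union.1 hv with hv | hv
        · exact hcon u v hu hpv (mem_outN.1 hv)
        · exact hcon v u hpv hu (mem_inN.1 hv)
      have h2 := card_le_card h1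
      rw [card_union_of_disjoint (disjoint_left.2 fun v h1 h2 =>
        hE _ _ (mem_outN.1 h1) (mem_inN.1 h2))] at h2
      have := hdeg u
      have := hdeg' u
      omega
    obtain ⟨a, ha⟩ := card_pos.1 (lt_of_lt_of_le two_pos (hp x hx).2)
    obtain ⟨b, hb, hba⟩ := exists_mem_notMem_of_card_lt_card (s := {a}) (t := A.filter (E y ·))
      (by have := (hp y hy).1; rw [card_singleton]; omega)
    rw [mem_filter] at ha hb
    rw [mem_singleton] at hba
    have hconn : Conn E m (2 * (k - 1) + 2 + 1) b a :=
      Conn.step B (by have := h.out_left b hb.1; omega) fun z hz =>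
        conn_even_of_expands hE h.symm hBA le_rfl hm.le hz ha.1 (k - 1)
    refine Route.exists_cycle (K := m) [(a, 0), (x, 0), (y, 0), (b, 2 * (k - 1) + 2 + 1)] a rfl ?_
      ⟨Conn.of_edge ha.2, Conn.of_edge hxy, Conn.of_edge hb.2, hconn, trivial⟩
      (by simp; omega) hlm
    have h1 := hirr _ _ ha.2
    have h2 := hirr _ _ hxy
    have h3 := hirr _ _ hb.2
    have h4 : a ≠ y := fun h => hE _ _ hxy (h ▸ ha.2)
    have h5 : x ≠ b := fun h => hE _ _ hxy (h ▸ hb.2)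
    simp; tauto
  have hlarge : ∀ (A B : Finset V) (P : V → Prop), #(univ \ (A ∪ B)) ≤ m → m + 2 ≤ #(univ.filter P) →
      (∀ b ∈ B, ¬ P b) → 2 ≤ #(A.filter P) := by
    intro A B P hR hP hB
    have h1 : univ.filter P ⊆ A.filter P ∪ univ \ (A ∪ B) := fun x hx => by
      have := hB x
      simp only [mem_filter, mem_univ, true_and, mem_union, mem_sdiff] at hx ⊢
      tauto
    have := card_le_card h1
    have := card_union_le (A.filter P) (univ \ (A ∪ B))
    omega
  have hout : ∀ v, m + 2 ≤ #(univ.filter (E v ·)) := fun v => by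
    have := hdeg v
    rw [outN] at this
    omega
  have hin : ∀ v, m + 2 ≤ #(univ.filter (E · v)) := fun v => by
    have := hdeg' v
    rw [inN] at this
    omega
  have hsum : ∀ p : V → Prop, #(univ.filter p) + #(univ.filter fun v => ¬ p v) =
      Fintype.card V := fun p => by
    rw [← card_univ]
    convert card_filter_add_card_filter_not (s := univ) p
  obtain ⟨p, hpd⟩ : ∃ p : V → Prop, p = fun v => v ∈ B ∨ (v ∉ A ∧ ∃ a ∈ A, E a v) := ⟨_, rfl⟩
  have hsum := hsum p
  have hp : ∀ v, p v ↔ v ∈ B ∨ (v ∉ A ∧ ∃ a ∈ A, E a v) := fun v => by rw [hpd]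
  rcases le_total (2 * #(univ.filter p)) (Fintype.card V) with hc | hc
  · refine hno (side h.symm hAB (fun v => ¬ p v) ?_ ?_ ?_)
    · intro v hv
      rw [hp, not_or, not_and] at hv
      by_cases hvA : v ∈ A
      · have := h.out_left v hvA
        have := h.in_left v hvA
        omega
      · have hA : ∀ a ∈ A, ¬ E a v := fun a ha hav => hvA (by
          exact absurd ⟨a, ha, hav⟩ (hv.2 hvA))
        have h1 := hlarge B A (E · v) (by rwa [union_comm]) (hin v) hA
        obtain ⟨b, hb⟩ := card_pos.1 (lt_of_lt_of_le two_pos h1)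
        rw [mem_filter] at hb
        exact ⟨hlarge B A (E v ·) (by rwa [union_comm]) (hout v) fun a ha =>
          hcross₂ a v b ha hb.1 hvA hv.1 hb.2, h1⟩
    · obtain ⟨a, ha⟩ := h.left_nonempty
      refine ⟨a, ?_⟩
      rw [hp]
      have := disjoint_left.1 h.disj ha
      tauto
    · simpa only [not_not] using hc
  · refine hno (side h hBA p ?_ ?_ (by omega))
    · intro v hv
      by_cases hvB : v ∈ B
      · have := h.out_right v hvB
        have := h.in_right v hvB
        omega
      · obtain ⟨hvA, a, ha, hav⟩ := ((hp v).1 hv).resolve_left hvB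
        have h1 := hlarge A B (E v ·) hR (hout v) fun b hb => hcross₁ a v b ha hb hvA hvB hav
        obtain ⟨a', ha'⟩ := card_pos.1 (lt_of_lt_of_le two_pos h1)
        rw [mem_filter] at ha'
        exact ⟨h1, hlarge A B (E · v) hR (hin v) fun b hb hbv =>
          hcross₂ a' v b ha'.1 hb hvA hvB hbv ha'.2⟩
    · obtain ⟨b, hb⟩ := h.right_nonempty
      exact ⟨b, (hp b).2 (Or.inl hb)⟩

end Expanding

section Frame

variable {V : Type} [Fintype V] {E : V → V → Prop} {U : ZMod 4 → Finset V} {e t l : ℕ}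

/-- A core in an oriented graph without cycle of length `l`, with a threshold `t` for the number
of neighbours in a class which is considered to be large. -/
structure Frame (E : V → V → Prop) (U : ZMod 4 → Finset V) (e t l : ℕ) : Prop where
  asymm : ∀ u v, E u v → ¬ E v u
  core : Core E e U
  out_deg : ∀ v, Fintype.card V < 4 * #(outN E v)
  in_deg : ∀ v, Fintype.card V < 4 * #(inN E v)
  le_t : 8 * e + 2 * l + 20 ≤ t
  t_le : 1000 * t ≤ Fintype.card V
  le_l : 9 ≤ l
  no_cycle : ¬ ∃ v : ZMod l → V, Function.Injective v ∧ ∀ i, E (v i) (v (i + 1))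

/-- `w` has many in-neighbours in the class `i`. -/
def In (E : V → V → Prop) (U : ZMod 4 → Finset V) (t : ℕ) (w : V) (i : ZMod 4) : Prop :=
  t ≤ #((U i).filter (E · w))

/-- `w` has many out-neighbours in the class `j`. -/
def Out (E : V → V → Prop) (U : ZMod 4 → Finset V) (t : ℕ) (w : V) (j : ZMod 4) : Prop :=
  t ≤ #((U j).filter (E w ·))

/-- `w` looks like a vertex of the class `c`. -/
def Good (E : V → V → Prop) (U : ZMod 4 → Finset V) (t : ℕ) (w : V) (c : ZMod 4) : Prop :=
  (∀ i, In E U t w i ↔ i = c - 1) ∧ ∀ j, Out E U t w j ↔ j = c + 1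

/-- Passing through `w` changes the length of a closed walk by `d` modulo 4. -/
def Defect (E : V → V → Prop) (U : ZMod 4 → Finset V) (t : ℕ) (w : V) (d : ZMod 4) : Prop :=
  ∃ i j, In E U t w i ∧ Out E U t w j ∧ d + j = i + 2

lemma Core.flip (h : Core E e U) : Core (flip E) e (fun i => U (-i)) where
  eq_of_mem hi hj := neg_injective (h.eq_of_mem hi hj)
  out_le {i v} hv := by
    have := h.in_le hv
    rwa [show -i - 1 = -(i + 1) by ring] at this
  in_le {i v} hv := by
    have := h.out_le hv
    rwa [show -i + 1 = -(i - 1) by ring] at this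
  nonempty := by simpa using h.nonempty

lemma Frame.flip (h : Frame E U e t l) : Frame (flip E) (fun i => U (-i)) e t l where
  asymm u v huv := h.asymm v u huv
  core := h.core.flip
  out_deg := h.in_deg
  in_deg := h.out_deg
  le_t := h.le_t
  t_le := h.t_le
  le_l := h.le_l
  no_cycle := by
    rintro ⟨v, hv, hvE⟩
    refine h.no_cycle ⟨fun i => v (-i), fun i j hij => neg_injective (hv hij), fun i => ?_⟩
    have := hvE (-(i + 1))
    rwa [show -(i + 1) + 1 = -i by ring] at this

omit [Fintype V] in
lemma in_flip {w : V} {i : ZMod 4} :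
    In (flip E) (fun i => U (-i)) t w i ↔ Out E U t w (-i) := Iff.rfl

omit [Fintype V] in
lemma out_flip {w : V} {i : ZMod 4} :
    Out (flip E) (fun i => U (-i)) t w i ↔ In E U t w (-i) := Iff.rfl

omit [Fintype V] in
lemma good_flip {w : V} {c : ZMod 4} :
    Good (flip E) (fun i => U (-i)) t w c ↔ Good E U t w (-c) := by
  have hn : ∀ {P : ZMod 4 → Prop}, (∀ i, P i) ↔ ∀ i, P (-i) := fun {P} =>
    ⟨fun h i => h _, fun h i => by simpa using h (-i)⟩
  rw [Good, Good, and_comm, hn, hn (P := fun i => In _ _ _ _ _ ↔ _)]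
  simp only [in_flip, out_flip, neg_neg]
  have h1 : ∀ i : ZMod 4, -i = c + 1 ↔ i = -c - 1 := by revert c; decide
  have h2 : ∀ i : ZMod 4, -i = c - 1 ↔ i = -c + 1 := by revert c; decide
  simp only [h1, h2]

omit [Fintype V] in
lemma defect_flip {w : V} {d : ZMod 4} :
    Defect (flip E) (fun i => U (-i)) t w d ↔ Defect E U t w d := by
  constructor
  · rintro ⟨i, j, hi, hj, h⟩
    exact ⟨-j, -i, hj, hi, by linear_combination h⟩
  · rintro ⟨i, j, hi, hj, h⟩
    refine ⟨-j, -i, ?_, ?_, by linear_combination h⟩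
    · rwa [in_flip, neg_neg]
    · rwa [out_flip, neg_neg]

namespace Frame

variable (h : Frame E U e t l)
include h

lemma irrefl {u v : V} (huv : E u v) : u ≠ v := fun heq => h.asymm u v huv (heq ▸ huv)

lemma class_nonempty (i : ZMod 4) : (U i).Nonempty := by
  have step : ∀ i, (U i).Nonempty → (U (i + 1)).Nonempty := fun i ⟨v, hv⟩ => by
    have h1 := h.core.out_le hv
    have := h.le_t
    have := h.t_le
    exact (card_pos.1 (by omega : 0 < #((U (i + 1)).filter (E v ·)))).mono (filter_subset _ _)
  have h0 := h.core.nonempty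
  have h1 := step _ h0
  have h2 := step _ h1
  have h3 := step _ h2
  fin_cases i
  · exact h0
  · exact h1
  · exact h2
  · exact h3

lemma le_card_class (i : ZMod 4) : Fintype.card V ≤ 4 * (#(U i) + e) := by
  obtain ⟨v, hv⟩ := h.class_nonempty (i - 1)
  have h1 := h.core.out_le hv
  rw [sub_add_cancel] at h1
  have := card_filter_le (U i) (E v ·)
  omega

lemma card_classes :
    #(univ.biUnion U) = #(U 0) + #(U 1) + #(U 2) + #(U 3) := by
  rw [card_biUnion fun i _ j _ hij => disjoint_left.2 fun v hi hj => hij (h.core.eq_of_mem hi hj)]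
  exact Fin.sum_univ_four fun i => #(U i)

lemma card_compl_le : #(univ \ univ.biUnion U) ≤ 4 * e := by
  have h1 := card_sdiff_add_card_eq_card (subset_univ (univ.biUnion U))
  rw [h.card_classes, card_univ] at h1
  have := h.le_card_class 0
  have := h.le_card_class 1
  have := h.le_card_class 2
  have := h.le_card_class 3
  omega

lemma card_class_le (i : ZMod 4) : 4 * #(U i) ≤ Fintype.card V + 12 * e := by
  have h1 := card_le_univ (univ.biUnion U)
  rw [h.card_classes] at h1
  have := h.le_card_class 0
  have := h.le_card_class 1
  have := h.le_card_class 2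
  have := h.le_card_class 3
  fin_cases i
  · change 4 * #(U 0) ≤ _; omega
  · change 4 * #(U 1) ≤ _; omega
  · change 4 * #(U 2) ≤ _; omega
  · change 4 * #(U 3) ≤ _; omega

lemma card_next_le {v : V} {i : ZMod 4} (hv : v ∈ U i) :
    #(U (i + 1)) ≤ #((U (i + 1)).filter (E v ·)) + 4 * e := by
  have := h.core.out_le hv
  have := h.card_class_le (i + 1)
  omega

lemma card_prev_le {v : V} {i : ZMod 4} (hv : v ∈ U i) :
    #(U (i - 1)) ≤ #((U (i - 1)).filter (E · v)) + 4 * e := by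
  have := h.core.in_le hv
  have := h.card_class_le (i - 1)
  omega

lemma out_of_mem {v : V} {i : ZMod 4} (hv : v ∈ U i) : Out E U t v (i + 1) := by
  have := h.card_next_le hv
  have := h.le_card_class (i + 1)
  have := h.le_t
  have := h.t_le
  rw [Out]
  omega

lemma in_of_mem {v : V} {i : ZMod 4} (hv : v ∈ U i) : In E U t v (i - 1) := by
  have := h.card_prev_le hv
  have := h.le_card_class (i - 1)
  have := h.le_t
  have := h.t_le
  rw [In]
  omega

lemma exists_out (w : V) : ∃ j, Out E U t w j := by
  by_contra! hno
  simp only [Out, not_le] at hno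
  have h1 : outN E w ⊆ univ \ univ.biUnion U ∪ univ.biUnion fun i => (U i).filter (E w ·) := by
    intro v hv
    rw [mem_outN] at hv
    by_cases hvU : v ∈ univ.biUnion U
    · obtain ⟨i, -, hi⟩ := mem_biUnion.1 hvU
      exact mem_union_right _ (mem_biUnion.2 ⟨i, mem_univ _, mem_filter.2 ⟨hi, hv⟩⟩)
    · exact mem_union_left _ (mem_sdiff.2 ⟨mem_univ _, hvU⟩)
  have h2 := card_le_card h1
  have h3 := card_union_le (univ \ univ.biUnion U) (univ.biUnion fun i => (U i).filter (E w ·))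
  have h4 : #(univ.biUnion fun i => (U i).filter (E w ·)) ≤ 4 * t := by
    have := card_biUnion_le_card_mul univ (fun i => (U i).filter (E w ·)) t
      fun i _ => (hno i).le
    rwa [card_univ, ZMod.card] at this
  have := h.card_compl_le
  have := h.out_deg w
  have := h.le_t
  have := h.t_le
  omega

lemma exists_in (w : V) : ∃ i, In E U t w i := by
  obtain ⟨j, hj⟩ := h.flip.exists_out w
  exact ⟨-j, hj⟩

/-- Connections starting in the core. -/
lemma conn_of_mem_left {u v : V} {a b : ZMod 4} (hu : u ∈ U a) (hv : In E U t v b) {L : ℕ}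
    (hL : 1 ≤ L) (hab : (L : ZMod 4) = b - a) : Conn E (2 * l) L u v := by
  induction L, hL using Nat.le_induction generalizing u a with
  | base =>
    obtain rfl : b = a + 1 := by rw [Nat.cast_one] at hab; linear_combination -hab
    refine Conn.of_card (U (a + 1)) ?_
    have h1 := card_filter_split (filter_subset (E u ·) (U (a + 1))) (E · v)
    rw [filter_filter] at h1
    have h2 : #((U (a + 1) \ (U (a + 1)).filter (E u ·)).filter (E · v)) ≤ 4 * e := by
      refine (card_filter_le _ _).trans ?_
      have := card_sdiff_add_card_eq_card (filter_subset (E u ·) (U (a + 1)))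
      have := h.card_next_le hu
      omega
    have := h.le_t
    rw [In] at hv
    omega
  | succ L hL ih =>
    refine Conn.step (U (a + 1)) ?_ fun x hx => ih hx ?_
    · have := h.out_of_mem hu
      rw [Out] at this
      have := h.le_t
      omega
    · push_cast at hab
      linear_combination hab

lemma conn {u v : V} {a b : ZMod 4} (hu : Out E U t u a) (hv : In E U t v b) {L : ℕ}
    (hL : 2 ≤ L) (hab : (L : ZMod 4) = b - a + 1) : Conn E (2 * l) L u v := by
  obtain ⟨L, rfl⟩ : ∃ k, L = k + 1 := ⟨L - 1, by omega⟩
  refine Conn.step (U a) ?_ fun x hx => h.conn_of_mem_left hx hv (by omega) ?_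
  · have := h.le_t
    rw [Out] at hu
    omega
  · push_cast at hab
    linear_combination hab

/-- Connections ending in the core. -/
lemma conn_of_mem_right {u v : V} {a b : ZMod 4} (hu : Out E U t u a) (hv : v ∈ U b) {L : ℕ}
    (hL : 1 ≤ L) (hab : (L : ZMod 4) = b - a) : Conn E (2 * l) L u v := by
  rcases hL.eq_or_lt with rfl | hL
  · obtain rfl : a = b - 1 := by rw [Nat.cast_one] at hab; linear_combination hab
    refine Conn.of_card (U (b - 1)) ?_
    have h1 := card_filter_split (filter_subset (E · v) (U (b - 1))) (E u ·)
    rw [filter_filter] at h1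
    have h2 : #((U (b - 1) \ (U (b - 1)).filter (E · v)).filter (E u ·)) ≤ 4 * e := by
      refine (card_filter_le _ _).trans ?_
      have := card_sdiff_add_card_eq_card (filter_subset (E · v) (U (b - 1)))
      have := h.card_prev_le hv
      omega
    have := h.le_t
    rw [Out] at hu
    simp only [and_comm (a := E _ v)] at h1
    omega
  · exact h.conn hu (h.in_of_mem hv) hL (by rw [hab]; ring)

lemma no_route (r : List (V × ℕ)) (q : V) (hq : nextPoint r q = q)
    (hn : (r.map Prod.fst).Nodup) (hr : Route E (2 * l) r q) (hl : (r.map (·.2 + 1)).sum = l) :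
    False := by
  have := h.le_l
  have : NeZero l := ⟨by omega⟩
  exact h.no_cycle (Route.exists_cycle r q hq hn hr hl le_rfl)

end Frame

lemma cast_sub {l k : ℕ} (h : k ≤ l) : ((l - k : ℕ) : ZMod 4) = l - k := Nat.cast_sub h

lemma exists_length (x : ZMod 4) (m : ℕ) : ∃ L : ℕ, m ≤ L ∧ L ≤ m + 3 ∧ (L : ZMod 4) = x := by
  have key : ∀ y : ZMod 4, ∃ k : ℕ, k ≤ 3 ∧ (k : ZMod 4) = y := by decide
  obtain ⟨k, hk, hy⟩ := key (x - m)
  exact ⟨m + k, by omega, by omega, by rw [Nat.cast_add, hy]; ring⟩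

namespace Frame

variable (h : Frame E U e t l)
include h

lemma not_defect_self (w : V) : ¬ Defect E U t w l := by
  rintro ⟨i, j, hi, hj, hd⟩
  have := h.le_l
  refine h.no_route [(w, l - 1)] w rfl (by simp) ⟨h.conn hj hi (by omega) ?_, trivial⟩
    (by simp; omega)
  rw [cast_sub (by omega)]
  push_cast
  linear_combination hd

lemma edge_ne {x y : V} {i j : ZMod 4} (hxy : E x y) (hi : In E U t x i) (hj : Out E U t y j) :
    (l : ZMod 4) + j ≠ i + 3 := by
  intro hd
  have := h.le_l
  have := h.irrefl hxy
  refine h.no_route [(x, 0), (y, l - 2)] x rfl (by simpa using this)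
    ⟨Conn.of_edge hxy, h.conn hj hi (by omega) ?_, trivial⟩ (by simp; omega)
  rw [cast_sub (by omega)]
  push_cast
  linear_combination hd

lemma not_defect_pair {w w' : V} (hne : w ≠ w') {d d' : ZMod 4} (hd : Defect E U t w d)
    (hd' : Defect E U t w' d') : d + d' ≠ l := by
  intro hs
  obtain ⟨i, j, hi, hj, hd⟩ := hd
  obtain ⟨i', j', hi', hj', hd'⟩ := hd'
  have := h.le_l
  obtain ⟨L, hL, hL', hLc⟩ := exists_length (i' - j + 1) 2
  refine h.no_route [(w, L), (w', l - 2 - L)] w rfl (by simpa using hne)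
    ⟨h.conn hj hi' hL hLc, h.conn hj' hi (by omega) ?_, trivial⟩ (by simp; omega)
  rw [cast_sub (by omega), cast_sub (by omega), hLc]
  push_cast
  linear_combination hd + hd' - hs

lemma not_defect_edge {w x y : V} (hx : w ≠ x) (hy : w ≠ y) {d i j : ZMod 4} (hxy : E x y)
    (hi : In E U t x i) (hj : Out E U t y j) (hl : 10 ≤ l) (hd : Defect E U t w d) :
    d + (i + 3 - j) ≠ l := by
  intro hs
  obtain ⟨i', j', hi', hj', hd⟩ := hd
  have := h.irrefl hxy
  obtain ⟨L, hL, hL', hLc⟩ := exists_length (i - j' + 1) 2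
  refine h.no_route [(w, L), (x, 0), (y, l - 3 - L)] w rfl (by simp; tauto)
    ⟨h.conn hj' hi hL hLc, Conn.of_edge hxy, h.conn hj hi' (by omega) ?_, trivial⟩ (by simp; omega)
  rw [cast_sub (by omega), cast_sub (by omega), hLc]
  push_cast
  linear_combination hd - hs

lemma not_defect_edge_of_mem {w x y : V} (hx : w ≠ x) (hy : w ≠ y) {d i j : ZMod 4} (hxy : E x y)
    (hi : x ∈ U i) (hj : Out E U t y j) (hd : Defect E U t w d) :
    d + (i + 2 - j) ≠ l := by
  intro hs
  obtain ⟨i', j', hi', hj', hd⟩ := hd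
  have := h.irrefl hxy
  have := h.le_l
  obtain ⟨L, hL, hL', hLc⟩ := exists_length (i - j') 1
  refine h.no_route [(w, L), (x, 0), (y, l - 3 - L)] w rfl (by simp; tauto)
    ⟨h.conn_of_mem_right hj' hi hL hLc, Conn.of_edge hxy, h.conn hj hi' (by omega) ?_, trivial⟩
    (by simp; omega)
  rw [cast_sub (by omega), cast_sub (by omega), hLc]
  push_cast
  linear_combination hd - hs

lemma not_defect_triple {w w' w'' : V} (h₁ : w ≠ w') (h₂ : w ≠ w'') (h₃ : w' ≠ w'')
    {d d' d'' : ZMod 4} (hd : Defect E U t w d) (hd' : Defect E U t w' d')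
    (hd'' : Defect E U t w'' d'') (hl : 15 ≤ l) : d + d' + d'' ≠ l := by
  intro hs
  obtain ⟨i, j, hi, hj, hd⟩ := hd
  obtain ⟨i', j', hi', hj', hd'⟩ := hd'
  obtain ⟨i'', j'', hi'', hj'', hd''⟩ := hd''
  obtain ⟨L, hL, hL', hLc⟩ := exists_length (i' - j + 1) 2
  obtain ⟨M, hM, hM', hMc⟩ := exists_length (i'' - j' + 1) 2
  refine h.no_route [(w, L), (w', M), (w'', l - 3 - L - M)] w rfl (by simp; tauto)
    ⟨h.conn hj hi' hL hLc, h.conn hj' hi'' hM hMc, h.conn hj'' hi (by omega) ?_, trivial⟩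
    (by simp; omega)
  rw [cast_sub (by omega), cast_sub (by omega), cast_sub (by omega), hLc, hMc]
  push_cast
  linear_combination hd + hd' + hd'' - hs

end Frame

end Frame

section Clean

variable {V : Type} [Fintype V] {E : V → V → Prop} {U : ZMod 4 → Finset V} {e t l : ℕ}

/-- There are several disjoint edges from the class `j` to vertices which look like vertices of the
class `j'`. -/
def Many (E : V → V → Prop) (U : ZMod 4 → Finset V) (t : ℕ) (j j' : ZMod 4) : Prop :=
  ∀ F : Finset V, #F ≤ 4 → ∃ x b, x ∈ U j ∧ x ∉ F ∧ b ∉ F ∧ Good E U t b j' ∧ E x b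

/-- The vertices looking like those of the class `c`. -/
noncomputable def goods (E : V → V → Prop) (U : ZMod 4 → Finset V) (t : ℕ) (c : ZMod 4) :
    Finset V := univ.filter (Good E U t · c)

/-- The vertices not looking like those of a class. -/
noncomputable def strays (E : V → V → Prop) (U : ZMod 4 → Finset V) (t : ℕ) : Finset V :=
  univ.filter fun w => ¬ ∃ c, Good E U t w c

/-- The strays with many in-neighbours in the class `i`. -/
noncomputable def strayIn (E : V → V → Prop) (U : ZMod 4 → Finset V) (t : ℕ) (i : ZMod 4) :
    Finset V := (strays E U t).filter (In E U t · i)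

/-- The strays with many out-neighbours in the class `j`. -/
noncomputable def strayOut (E : V → V → Prop) (U : ZMod 4 → Finset V) (t : ℕ) (j : ZMod 4) :
    Finset V := (strays E U t).filter (Out E U t · j)

@[simp] lemma mem_goods {w : V} {c : ZMod 4} : w ∈ goods E U t c ↔ Good E U t w c := by
  simp [goods]

@[simp] lemma mem_strays {w : V} : w ∈ strays E U t ↔ ¬ ∃ c, Good E U t w c := by
  simp [strays]

lemma goods_flip (c : ZMod 4) : goods (flip E) (fun i => U (-i)) t c = goods E U t (-c) := by
  ext w
  rw [mem_goods, mem_goods, good_flip]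

lemma strays_flip : strays (flip E) (fun i => U (-i)) t = strays E U t := by
  ext w
  simp only [mem_strays, good_flip]
  exact not_congr ⟨fun ⟨c, hc⟩ => ⟨-c, hc⟩, fun ⟨c, hc⟩ => ⟨-c, by rwa [neg_neg]⟩⟩

lemma strayIn_flip (i : ZMod 4) :
    strayIn (flip E) (fun i => U (-i)) t i = strayOut E U t (-i) := by
  rw [strayIn, strays_flip, strayOut]
  rfl

omit [Fintype V] in
lemma Good.eq {w : V} {c c' : ZMod 4} (hc : Good E U t w c) (hc' : Good E U t w c') : c = c' := by
  have := (hc'.1 _).1 ((hc.1 (c - 1)).2 rfl)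
  linear_combination this

lemma card_goods_add : #(goods E U t 0) + #(goods E U t 1) + #(goods E U t 2) + #(goods E U t 3) +
    #(strays E U t) = Fintype.card V := by
  have h1 : #(univ.biUnion (goods E U t)) =
      #(goods E U t 0) + #(goods E U t 1) + #(goods E U t 2) + #(goods E U t 3) := by
    rw [card_biUnion fun i _ j _ hij => disjoint_left.2 fun v hi hj =>
      hij ((mem_goods.1 hi).eq (mem_goods.1 hj))]
    exact Fin.sum_univ_four fun i => #(goods E U t i)
  have h2 : strays E U t = univ \ univ.biUnion (goods E U t) := by
    ext w
    simp
  have h3 := card_sdiff_add_card_eq_card (subset_univ (univ.biUnion (goods E U t)))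
  rw [h2, ← h1, add_comm, h3, card_univ]

namespace Frame

variable (h : Frame E U e t l)
include h

lemma good_of_even {w : V} (hd : ∀ d, Defect E U t w d → d = 0) : ∃ c, Good E U t w c := by
  obtain ⟨i, hi⟩ := h.exists_in w
  obtain ⟨j, hj⟩ := h.exists_out w
  have hij : ∀ i j, In E U t w i → Out E U t w j → j = i + 2 := fun i j hi hj => by
    have := hd (i + 2 - j) ⟨i, j, hi, hj, by ring⟩
    linear_combination -this
  refine ⟨i + 1, fun i' => ⟨fun hi' => ?_, ?_⟩, fun j' => ⟨fun hj' => ?_, ?_⟩⟩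
  · have := hij _ _ hi hj
    have := hij _ _ hi' hj
    grind
  · rintro rfl
    rwa [add_sub_cancel_right]
  · rw [hij _ _ hi hj']
    ring
  · rintro rfl
    have := hij _ _ hi hj
    rwa [show i + 1 + 1 = j by rw [this]; ring]

omit h in
lemma card_filter_of_not_many {j j' : ZMod 4} (hj : j' ≠ j + 1) (hM : ¬ Many E U t j j') :
    #((U j).filter fun x => ∃ b, Good E U t b j' ∧ E x b) ≤ 4 + 4 * t := by
  by_contra! hlt
  refine hM fun F hF => ?_
  set F' := (F.filter (Good E U t · j')).biUnion fun b => (U j).filter (E · b)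
  have h1 : #F' ≤ 4 * t := by
    refine (card_biUnion_le_card_mul _ _ t fun b hb => ?_).trans
      (Nat.mul_le_mul_right _ ((card_filter_le _ _).trans hF))
    have h2 := (((mem_filter.1 hb).2.1 j).not.2 (by
      intro h3; exact hj (by linear_combination -h3)))
    rw [In] at h2
    omega
  have h2 := card_union_le F F'
  obtain ⟨x, hx, hxF⟩ := exists_mem_notMem_of_card_lt_card (s := F ∪ F')
    (t := (U j).filter fun x => ∃ b, Good E U t b j' ∧ E x b) (by omega)
  obtain ⟨hxU, b, hb, hxb⟩ := mem_filter.1 hx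
  rw [mem_union, not_or] at hxF
  exact ⟨x, b, hxU, hxF.1, fun hbF => hxF.2 (mem_biUnion.2
    ⟨b, mem_filter.2 ⟨hbF, hb⟩, mem_filter.2 ⟨hxU, hxb⟩⟩), hb, hxb⟩

lemma exists_clean {j : ZMod 4} (hW : #(strays E U t) ≤ 8)
    (hM : ∀ j', j' ≠ j + 1 → ¬ Many E U t j j') {S : Finset V} (hS : S ⊆ U j)
    (hSc : 21 * t ≤ #S) :
    ∃ v ∈ S, outN E v ⊆ goods E U t (j + 1) ∪ strayIn E U t j := by
  set R := (univ.erase (j + 1)).biUnion fun j' => (U j).filter fun x => ∃ b, Good E U t b j' ∧ E x b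
  set Q := ((strays E U t).filter fun w => ¬ In E U t w j).biUnion fun w => (U j).filter (E · w)
  have hR : #R ≤ 3 * (4 + 4 * t) :=
    (card_biUnion_le_card_mul _ _ (4 + 4 * t) fun j' hj' =>
      card_filter_of_not_many (ne_of_mem_erase hj') (hM _ (ne_of_mem_erase hj'))).trans_eq (by
        rw [card_erase_of_mem (mem_univ _), card_univ, ZMod.card])
  have hQ : #Q ≤ 8 * t := by
    refine (card_biUnion_le_card_mul _ _ t fun b hb => ?_).trans
      (Nat.mul_le_mul_right _ ((card_filter_le _ _).trans hW))
    have h2 := (mem_filter.1 hb).2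
    rw [In] at h2
    omega
  have := h.le_t
  have := card_union_le R Q
  obtain ⟨v, hv, hvn⟩ := exists_mem_notMem_of_card_lt_card (s := R ∪ Q) (t := S) (by omega)
  rw [mem_union, not_or] at hvn
  refine ⟨v, hv, fun w hw => ?_⟩
  rw [mem_outN] at hw
  by_cases hg : ∃ c, Good E U t w c
  · obtain ⟨c, hc⟩ := hg
    by_cases hcj : c = j + 1
    · exact mem_union_left _ (mem_goods.2 (hcj ▸ hc))
    · exact absurd (mem_biUnion.2 ⟨c, mem_erase.2 ⟨hcj, mem_univ _⟩,
        mem_filter.2 ⟨hS hv, w, hc, hw⟩⟩) hvn.1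
  · refine mem_union_right _ (mem_filter.2 ⟨mem_strays.2 hg, ?_⟩)
    by_contra hin
    exact hvn.2 (mem_biUnion.2 ⟨w, mem_filter.2 ⟨mem_strays.2 hg, hin⟩,
      mem_filter.2 ⟨hS hv, hw⟩⟩)

lemma le_card_goods_add_strayIn (hW : #(strays E U t) ≤ 8)
    (hM : ∀ j j', j' ≠ j + 1 → ¬ Many E U t j j') {d : ℕ} (hd : ∀ v, d ≤ #(outN E v))
    (j : ZMod 4) : d ≤ #(goods E U t (j + 1)) + #(strayIn E U t j) := by
  obtain ⟨v, -, hv⟩ := h.exists_clean hW (hM j) subset_rfl (by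
    have := h.le_card_class j
    have := h.le_t
    have := h.t_le
    omega)
  exact (hd v).trans ((card_le_card hv).trans (card_union_le _ _))

lemma le_card_goods_add_strayOut (hW : #(strays E U t) ≤ 8)
    (hM : ∀ j j', j' ≠ j + 1 → ¬ Many (_root_.flip E) (fun i => U (-i)) t j j')
    {d : ℕ} (hd : ∀ v, d ≤ #(inN E v))
    (j : ZMod 4) : d ≤ #(goods E U t (j - 1)) + #(strayOut E U t j) := by
  have := h.flip.le_card_goods_add_strayIn (by rwa [strays_flip]) hM hd (-j)
  rwa [goods_flip, strayIn_flip, neg_neg, show -(-j + 1) = j - 1 by ring] at this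

lemma le_card_goods_add_min (hW : #(strays E U t) ≤ 8)
    (hM : ∀ j j', j' ≠ j + 1 → ¬ Many E U t j j')
    (hM' : ∀ j j', j' ≠ j + 1 → ¬ Many (_root_.flip E) (fun i => U (-i)) t j j')
    {d : ℕ} (hd : ∀ v, d ≤ #(outN E v)) (hd' : ∀ v, d ≤ #(inN E v)) (i : ZMod 4) :
    d ≤ #(goods E U t (i + 1)) + min #(strayIn E U t i) #(strayOut E U t (i + 2)) := by
  have h1 := h.le_card_goods_add_strayIn hW hM hd i
  have h2 := h.le_card_goods_add_strayOut hW hM' hd' (i + 2)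
  rw [show i + 2 - 1 = i + 1 by ring] at h2
  omega

omit h in
lemma sum_card_goods_add (f : ZMod 4 → ℕ) :
    ∑ i, (#(goods E U t (i + 1)) + f i) + #(strays E U t) = Fintype.card V + ∑ i, f i := by
  have hshift : ∑ i, #(goods E U t (i + 1)) = ∑ i, #(goods E U t i) :=
    Equiv.sum_comp (Equiv.addRight (1 : ZMod 4)) fun i => #(goods E U t i)
  rw [sum_add_distrib, hshift]
  have hs : ∑ i : ZMod 4, #(goods E U t i) = _ := Fin.sum_univ_four fun i => #(goods E U t i)
  have := card_goods_add (E := E) (U := U) (t := t)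
  change _ = #(goods E U t 0) + #(goods E U t 1) + #(goods E U t 2) + #(goods E U t 3) at hs
  omega

omit h in
lemma four_mul_le_sum {d : ℕ} {f : ZMod 4 → ℕ}
    (hf : ∀ i, d ≤ #(goods E U t (i + 1)) + f i) :
    4 * d + #(strays E U t) ≤ Fintype.card V + ∑ i, f i := by
  have := sum_card_goods_add (E := E) (U := U) (t := t) f
  have := card_nsmul_le_sum univ _ d fun i _ => hf i
  rw [card_univ, ZMod.card, smul_eq_mul] at this
  omega

lemma not_many_of_edge {j j' : ZMod 4} (hl : (l : ZMod 4) + j' = j + 1) : ¬ Many E U t j j' := by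
  intro hM
  obtain ⟨x, b, hx, -, -, hb, hxb⟩ := hM ∅ (by simp)
  exact h.edge_ne hxb (h.in_of_mem hx) ((hb.2 _).2 rfl) (by linear_combination hl)

lemma not_many_of_two_edges {j j' : ZMod 4} (L : ℕ) (hL : 1 ≤ L) (hLl : L + 5 ≤ l)
    (hLc : (L : ZMod 4) = j - j' - 1) (hl : (l : ZMod 4) = 2 * L + 4) : ¬ Many E U t j j' := by
  intro hM
  obtain ⟨x, b, hx, -, -, hb, hxb⟩ := hM ∅ (by simp)
  obtain ⟨x', b', hx', hxF', hbF', hb', hxb'⟩ := hM {x, b} (card_le_two.trans (by omega))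
  have hn := h.irrefl hxb
  have hn' := h.irrefl hxb'
  simp only [mem_insert, mem_singleton, not_or] at hxF' hbF'
  have ho := (hb.2 _).2 rfl
  have ho' := (hb'.2 _).2 rfl
  refine h.no_route [(x, 0), (b, L), (x', 0), (b', l - 4 - L)] x rfl (by simp; grind)
    ⟨Conn.of_edge hxb, h.conn_of_mem_right ho hx' hL (by rw [hLc]; ring), Conn.of_edge hxb',
      h.conn_of_mem_right ho' hx (by omega) ?_, trivial⟩ (by simp; omega)
  rw [cast_sub (by omega), cast_sub (by omega), hl]
  push_cast
  linear_combination hLc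

lemma not_many_of_three_edges {j j' : ZMod 4} (L : ℕ) (hL : 1 ≤ L) (hLl : 2 * L + 7 ≤ l)
    (hLc : (L : ZMod 4) = j - j' - 1) (hl : (l : ZMod 4) = 3 * L + 6) : ¬ Many E U t j j' := by
  intro hM
  obtain ⟨x, b, hx, -, -, hb, hxb⟩ := hM ∅ (by simp)
  obtain ⟨x', b', hx', hxF', hbF', hb', hxb'⟩ := hM {x, b} (card_le_two.trans (by omega))
  obtain ⟨x'', b'', hx'', hxF'', hbF'', hb'', hxb''⟩ := hM {x, b, x', b'} card_le_four
  have hn := h.irrefl hxb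
  have hn' := h.irrefl hxb'
  have hn'' := h.irrefl hxb''
  simp only [mem_insert, mem_singleton, not_or] at hxF' hbF' hxF'' hbF''
  have ho := (hb.2 _).2 rfl
  have ho' := (hb'.2 _).2 rfl
  have ho'' := (hb''.2 _).2 rfl
  refine h.no_route [(x, 0), (b, L), (x', 0), (b', L), (x'', 0), (b'', l - 6 - L - L)] x rfl
    (by simp; grind)
    ⟨Conn.of_edge hxb, h.conn_of_mem_right ho hx' hL (by rw [hLc]; ring), Conn.of_edge hxb',
      h.conn_of_mem_right ho' hx'' hL (by rw [hLc]; ring), Conn.of_edge hxb'',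
      h.conn_of_mem_right ho'' hx (by omega) ?_, trivial⟩ (by simp; omega)
  rw [cast_sub (by omega), cast_sub (by omega), cast_sub (by omega), hl]
  push_cast
  linear_combination hLc

lemma not_many_of_defect {w : V} {d : ZMod 4} (hd : Defect E U t w d) {j j' : ZMod 4}
    (hl : d + (j - j' + 1) = l) : ¬ Many E U t j j' := by
  intro hM
  obtain ⟨x, b, hx, hxF, hbF, hb, hxb⟩ := hM {w} (by simp)
  rw [notMem_singleton] at hxF hbF
  exact h.not_defect_edge_of_mem (Ne.symm hxF) (Ne.symm hbF) hxb hx ((hb.2 _).2 rfl) hd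
    (by linear_combination hl)

end Frame

end Clean

section Cases

variable {V : Type} [Fintype V] {E : V → V → Prop} {U : ZMod 4 → Finset V} {e t l : ℕ}

omit [Fintype V] in
lemma Good.defect_eq {w : V} {c d : ZMod 4} (hc : Good E U t w c) (hd : Defect E U t w d) :
    d = 0 := by
  obtain ⟨i, j, hi, hj, hd⟩ := hd
  rw [hc.1] at hi
  rw [hc.2] at hj
  rw [hi, hj] at hd
  linear_combination hd

lemma sum_card_strayIn_add :
    ∑ i, (#(strayIn E U t i) + #(strayOut E U t (i + 2))) =
      ∑ w ∈ strays E U t, (#(univ.filter (In E U t w)) + #(univ.filter (Out E U t w))) := by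
  have hshift : ∑ i, #(strayOut E U t (i + 2)) = ∑ i, #(strayOut E U t i) :=
    Equiv.sum_comp (Equiv.addRight (2 : ZMod 4)) fun i => #(strayOut E U t i)
  rw [sum_add_distrib, sum_add_distrib, hshift]
  congr 1
  · exact (sum_card_bipartiteAbove_eq_sum_card_bipartiteBelow (s := strays E U t)
      (t := univ) (In E U t)).symm
  · exact (sum_card_bipartiteAbove_eq_sum_card_bipartiteBelow (s := strays E U t)
      (t := univ) (Out E U t)).symm

lemma two_mul_sum_min_le :
    2 * ∑ i, min #(strayIn E U t i) #(strayOut E U t (i + 2)) ≤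
      ∑ w ∈ strays E U t, (#(univ.filter (In E U t w)) + #(univ.filter (Out E U t w))) := by
  rw [← sum_card_strayIn_add, mul_sum]
  exact sum_le_sum fun i _ => by omega

lemma sum_min_of_strays_eq {w : V} (hw : strays E U t = {w}) :
    ∑ i, min #(strayIn E U t i) #(strayOut E U t (i + 2)) =
      #(univ.filter fun i => In E U t w i ∧ Out E U t w (i + 2)) := by
  rw [card_filter]
  refine sum_congr rfl fun i _ => ?_
  rw [strayIn, strayOut, hw, filter_singleton, filter_singleton]
  by_cases h1 : In E U t w i <;> by_cases h2 : Out E U t w (i + 2) <;> simp [h1, h2]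

namespace Frame

variable (h : Frame E U e t l)
include h

lemma card_in_add_card_out_le {w : V}
    (hw : (∀ d, Defect E U t w d → d = 0 ∨ d = 1) ∨ ∀ d, Defect E U t w d → d = 0 ∨ d = 3) :
    #(univ.filter (In E U t w)) + #(univ.filter (Out E U t w)) ≤ 3 := by
  have key : ∀ I J : Finset (ZMod 4), I.Nonempty → J.Nonempty →
      ((∀ i ∈ I, ∀ j ∈ J, i + 2 - j = 0 ∨ i + 2 - j = 1) ∨
        ∀ i ∈ I, ∀ j ∈ J, i + 2 - j = 0 ∨ i + 2 - j = 3) → #I + #J ≤ 3 := by decide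
  obtain ⟨i, hi⟩ := h.exists_in w
  obtain ⟨j, hj⟩ := h.exists_out w
  refine key _ _ ⟨i, mem_filter.2 ⟨mem_univ _, hi⟩⟩ ⟨j, mem_filter.2 ⟨mem_univ _, hj⟩⟩ ?_
  refine hw.imp (fun hw i hi j hj => hw _ ?_) fun hw i hi j hj => hw _ ?_
  all_goals exact ⟨i, j, (mem_filter.1 hi).2, (mem_filter.1 hj).2, by ring⟩

lemma exists_defect_of_mem_strays {w : V} (hw : w ∈ strays E U t) :
    ∃ d, Defect E U t w d ∧ d ≠ 0 := by
  by_contra! hno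
  exact mem_strays.1 hw (h.good_of_even hno)

omit h in
lemma exists_eq_of_zmod (j j' : ZMod 4) : j' = j ∨ j' = j + 1 ∨ j' = j + 2 ∨ j' = j + 3 := by
  revert j j'; decide

lemma not_many_even (hl : (l : ZMod 4) = 1 ∨ (l : ZMod 4) = 3 ∧ 15 ≤ l) {j j' : ZMod 4}
    (hj : j' = j ∨ j' = j + 2) : ¬ Many E U t j j' := by
  have h4 : (4 : ZMod 4) = 0 := rfl
  have := h.le_l
  rcases hl with hl | ⟨hl, hl'⟩ <;> rcases hj with rfl | rfl
  · exact h.not_many_of_edge (by rw [hl]; ring)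
  · refine h.not_many_of_three_edges 1 le_rfl (by omega) ?_ ?_
    · push_cast; linear_combination h4
    · rw [hl]; push_cast; linear_combination -2 * h4
  · refine h.not_many_of_three_edges 3 (by omega) (by omega) ?_ ?_
    · push_cast; linear_combination h4
    · rw [hl]; push_cast; linear_combination -3 * h4
  · exact h.not_many_of_edge (by rw [hl]; linear_combination h4)

/-- The case `l ≡ 2`. -/
lemma false_of_two (hl : (l : ZMod 4) = 2) (hl' : 18 ≤ l) {d : ℕ}
    (hdn : Fintype.card V + 2 ≤ 4 * d) (hd : ∀ v, d ≤ #(outN E v)) (hd' : ∀ v, d ≤ #(inN E v)) :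
    False := by
  have h4 : (4 : ZMod 4) = 0 := rfl
  have not_many : ∀ {E : V → V → Prop} {U : ZMod 4 → Finset V}, Frame E U e t l →
      ∀ j j', j' ≠ j + 1 → ¬ Many E U t j j' := by
    intro E U h j j' hj
    rcases exists_eq_of_zmod j j' with rfl | rfl | rfl | rfl
    · refine h.not_many_of_two_edges 3 (by omega) (by omega) ?_ ?_
      · push_cast; linear_combination h4
      · rw [hl]; push_cast; linear_combination -2 * h4
    · exact absurd rfl hj
    · refine h.not_many_of_two_edges 1 (by omega) (by omega) ?_ ?_
      · push_cast; linear_combination h4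
      · rw [hl]; push_cast; linear_combination -h4
    · exact h.not_many_of_edge (by rw [hl]; linear_combination h4)
  have hself : ∀ w, ¬ Defect E U t w 2 := fun w hw => h.not_defect_self w (by rwa [hl])
  have hone : #((strays E U t).filter (Defect E U t · 1)) ≤ 1 := card_le_one.2
    fun a ha b hb => by_contra fun hab => h.not_defect_pair hab (mem_filter.1 ha).2
      (mem_filter.1 hb).2 (by rw [hl]; rfl)
  have hthree : #((strays E U t).filter (Defect E U t · 3)) ≤ 1 := card_le_one.2
    fun a ha b hb => by_contra fun hab => h.not_defect_pair hab (mem_filter.1 ha).2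
      (mem_filter.1 hb).2 (by rw [hl]; rfl)
  have htwo : ∀ d : ZMod 4, d = 0 ∨ d = 1 ∨ d = 2 ∨ d = 3 := by decide
  have hdef : ∀ w ∈ strays E U t, Defect E U t w 1 ∨ Defect E U t w 3 := fun w hw => by
    obtain ⟨d, hd, hd0⟩ := h.exists_defect_of_mem_strays hw
    rcases htwo d with rfl | rfl | rfl | rfl
    · exact absurd rfl hd0
    · exact Or.inl hd
    · exact absurd hd (hself w)
    · exact Or.inr hd
  have hk : #(strays E U t) ≤ 2 := by
    rw [← filter_true_of_mem hdef, filter_or]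
    exact (card_union_le _ _).trans (by omega)
  have hmain := four_mul_le_sum (h.le_card_goods_add_min (by omega) (not_many h)
    (not_many h.flip) hd hd')
  have hsum : ∑ i, min #(strayIn E U t i) #(strayOut E U t (i + 2)) ≤ 2 * #(strays E U t) := by
    have key : ∀ i, #(strayIn E U t i) + #(strayOut E U t i) ≤ #(strays E U t) := fun i => by
      rw [strayIn, strayOut, ← card_union_of_disjoint]
      · exact card_le_card (union_subset (filter_subset _ _) (filter_subset _ _))
      · rw [disjoint_filter]
        exact fun w _ hi ho => hself w ⟨i, i, hi, ho, by ring⟩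
    have hs : ∑ i : ZMod 4, min #(strayIn E U t i) #(strayOut E U t (i + 2)) = _ :=
      Fin.sum_univ_four fun i : ZMod 4 => min #(strayIn E U t i) #(strayOut E U t (i + 2))
    change _ = min #(strayIn E U t 0) #(strayOut E U t 2) +
      min #(strayIn E U t 1) #(strayOut E U t 3) + min #(strayIn E U t 2) #(strayOut E U t 0) +
      min #(strayIn E U t 3) #(strayOut E U t 1) at hs
    have := key 0
    have := key 1
    omega
  have hk2 : 1 < #(strays E U t) := by omega
  have hle : ∑ w ∈ strays E U t, (#(univ.filter (In E U t w)) + #(univ.filter (Out E U t w))) ≤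
      #(strays E U t) • 3 := by
    refine sum_le_card_nsmul _ _ _ fun w hw => h.card_in_add_card_out_le ?_
    obtain ⟨w', hw', hne⟩ := exists_mem_ne hk2 w
    have hnot : ∀ x : ZMod 4, x + x = 2 → Defect E U t w x → ¬ Defect E U t w' x :=
      fun x hx h1 h2 => h.not_defect_pair hne.symm h1 h2 (by rw [hl, hx])
    rcases hdef w' hw' with h1 | h1
    · refine Or.inr fun d hd => ?_
      rcases htwo d with rfl | rfl | rfl | rfl
      · exact Or.inl rfl
      · exact absurd h1 (hnot 1 rfl hd)
      · exact absurd hd (hself w)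
      · exact Or.inr rfl
    · refine Or.inl fun d hd => ?_
      rcases htwo d with rfl | rfl | rfl | rfl
      · exact Or.inl rfl
      · exact Or.inr rfl
      · exact absurd hd (hself w)
      · exact absurd h1 (hnot 3 rfl hd)
  have := two_mul_sum_min_le.trans hle
  rw [smul_eq_mul] at this
  omega

lemma not_defect_edge_of_mem' {w x y : V} (hx : w ≠ x) (hy : w ≠ y) {d i j : ZMod 4} (hxy : E x y)
    (hi : In E U t x i) (hj : y ∈ U j) (hd : Defect E U t w d) :
    d + (i + 2 - j) ≠ l := by
  have hj' : y ∈ U (- -j) := by rwa [neg_neg]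
  have hi' : In E U t x (- -i) := by rwa [neg_neg]
  have := h.flip.not_defect_edge_of_mem hy hx hxy hj' hi' (defect_flip.2 hd)
  rwa [show -j + 2 - -i = i + 2 - j by ring] at this

/-- The case in which all defects are even. -/
lemma false_of_even (hl : (l : ZMod 4) = 1 ∨ (l : ZMod 4) = 3 ∧ 15 ≤ l)
    (hev : ∀ w d, Defect E U t w d → d = 0 ∨ d = 2) : False := by
  have hpar : ∀ {w i j}, In E U t w i → Out E U t w j → j = i ∨ j = i + 2 := by
    intro w i j hi hj
    have key : ∀ i j : ZMod 4, i + 2 - j = 0 ∨ i + 2 - j = 2 → j = i ∨ j = i + 2 := by decide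
    exact key i j (hev w _ ⟨i, j, hi, hj, by ring⟩)
  obtain ⟨q, hq, hq'⟩ : ∃ q : V → Prop, (∀ {w i}, In E U t w i → (q w ↔ i = 0 ∨ i = 2)) ∧
      ∀ {w j}, Out E U t w j → (q w ↔ j = 0 ∨ j = 2) := by
    have key : ∀ i j : ZMod 4, j = i ∨ j = i + 2 → ((i = 0 ∨ i = 2) ↔ (j = 0 ∨ j = 2)) := by decide
    have hout : ∀ {w j}, Out E U t w j → ((∃ j, (j = 0 ∨ j = 2) ∧ Out E U t w j) ↔
        j = 0 ∨ j = 2) := fun {w j} hj => by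
      obtain ⟨i, hi⟩ := h.exists_in w
      refine ⟨fun ⟨j', h1, h2⟩ => ?_, fun h1 => ⟨j, h1, hj⟩⟩
      rwa [← key i j (hpar hi hj), key i j' (hpar hi h2)]
    refine ⟨fun w => ∃ j, (j = 0 ∨ j = 2) ∧ Out E U t w j, fun {w i} hi => ?_, hout⟩
    obtain ⟨j, hj⟩ := h.exists_out w
    exact (hout hj).trans (key i j (hpar hi hj)).symm
  obtain ⟨p, hp, hpc, j₀, hj₀⟩ : ∃ p : V → Prop, (∀ {x y i j}, p x → p y → In E U t x i →
      Out E U t y j → j = i ∨ j = i + 2) ∧ 2 * #(univ.filter fun v => ¬ p v) ≤ Fintype.card V ∧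
      ∃ j, ∀ u, p u ↔ ∀ i, In E U t u i → i = j - 1 ∨ i = j + 1 := by
    have hsum : #(univ.filter q) + #(univ.filter fun v => ¬ q v) = Fintype.card V := by
      rw [← card_univ]
      convert card_filter_add_card_filter_not (s := univ) q
    have key : ∀ i j : ZMod 4, ((i = 0 ∨ i = 2) ↔ (j = 0 ∨ j = 2)) → j = i ∨ j = i + 2 := by decide
    rcases le_total (2 * #(univ.filter q)) (Fintype.card V) with hc | hc
    · refine ⟨fun v => ¬ q v, fun {x y i j} hx hy hi hj => key i j ?_, by simpa using hc, 0,
        fun u => ?_⟩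
      · rw [← hq hi, ← hq' hj]
        tauto
      · have key : ∀ i : ZMod 4, (i = 0 - 1 ∨ i = 0 + 1) ↔ ¬ (i = 0 ∨ i = 2) := by decide
        simp only [key]
        refine ⟨fun h1 i hi => by rwa [← hq hi], fun h1 => ?_⟩
        obtain ⟨i, hi⟩ := h.exists_in u
        rw [hq hi]
        exact h1 i hi
    · refine ⟨q, fun {x y i j} hx hy hi hj => key i j ?_, by omega, 1, fun u => ?_⟩
      · rw [← hq hi, ← hq' hj]
        tauto
      · have key : ∀ i : ZMod 4, (i = 1 - 1 ∨ i = 1 + 1) ↔ (i = 0 ∨ i = 2) := by decide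
        simp only [key]
        refine ⟨fun h1 i hi => by rwa [← hq hi], fun h1 => ?_⟩
        obtain ⟨i, hi⟩ := h.exists_in u
        rw [hq hi]
        exact h1 i hi
  have hadj : ∀ u, p u → ∃ v, p v ∧ (E u v ∨ E v u) := by
    intro u hu
    by_contra! hno
    have h1 : outN E u ∪ inN E u ⊆ univ.filter fun v => ¬ p v := fun v hv => by
      rw [mem_filter]
      refine ⟨mem_univ _, fun hpv => ?_⟩
      rcases mem_union.1 hv with hv | hv
      · exact (hno v hpv).1 (mem_outN.1 hv)
      · exact (hno v hpv).2 (mem_inN.1 hv)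
    have h2 := card_le_card h1
    rw [card_union_of_disjoint (disjoint_left.2 fun v h1 h2 =>
      h.asymm _ _ (mem_outN.1 h1) (mem_inN.1 h2))] at h2
    have := h.out_deg u
    have := h.in_deg u
    omega
  have hU : ∀ u ∈ U j₀, p u := fun u hu => (hj₀ u).2 fun i hi => by
    have h1 := hpar hi (h.out_of_mem hu)
    have key : ∀ i j : ZMod 4, j + 1 = i ∨ j + 1 = i + 2 → i = j - 1 ∨ i = j + 1 := by decide
    exact key _ _ h1
  have hcard : 22 * t < #(U j₀) := by
    have := h.le_card_class j₀
    have := h.le_t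
    have := h.t_le
    omega
  have ht := h.le_t
  by_cases hst : ∃ w, ¬ ∃ c, Good E U t w c
  · obtain ⟨w, hw⟩ := hst
    have hw2 : Defect E U t w 2 := by
      obtain ⟨d, hd, hd0⟩ := h.exists_defect_of_mem_strays (mem_strays.2 hw)
      rcases hev w d hd with rfl | rfl
      · exact absurd rfl hd0
      · exact hd
    obtain ⟨u, hu, hwu, hwu'⟩ : ∃ u ∈ U j₀, w ≠ u ∧ (p w → ¬ E u w ∧ ¬ E w u) := by
      by_cases hpw : p w
      · have h1 : ¬ In E U t w j₀ := fun h1 => by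
          have key : ∀ j : ZMod 4, j ≠ j - 1 ∧ j ≠ j + 1 := by decide
          have := (hj₀ w).1 hpw _ h1
          have := key j₀
          tauto
        have h2 : ¬ Out E U t w j₀ := fun h2 => by
          obtain ⟨i, hi⟩ := h.exists_in w
          have key : ∀ i j : ZMod 4, (j = i ∨ j = i + 2) → ¬ (i = j - 1 ∨ i = j + 1) := by decide
          exact key _ _ (hpar hi h2) ((hj₀ w).1 hpw _ hi)
        rw [In] at h1
        rw [Out] at h2
        have h3 := card_union_le ((U j₀).filter (E · w)) ((U j₀).filter (E w ·))
        have h4 := card_insert_le w ((U j₀).filter (E · w) ∪ (U j₀).filter (E w ·))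
        obtain ⟨u, hu, hun⟩ := exists_mem_notMem_of_card_lt_card
          (s := insert w ((U j₀).filter (E · w) ∪ (U j₀).filter (E w ·))) (t := U j₀) (by omega)
        simp only [mem_insert, mem_union, mem_filter, not_or, not_and] at hun
        exact ⟨u, hu, Ne.symm hun.1, fun _ => ⟨hun.2.1 hu, hun.2.2 hu⟩⟩
      · obtain ⟨u, hu⟩ := h.class_nonempty j₀
        exact ⟨u, hu, fun heq => hpw (heq ▸ hU u hu), fun h => absurd h hpw⟩
    obtain ⟨v, hv, huv⟩ := hadj u (hU u hu)
    have hwv : w ≠ v := by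
      rintro rfl
      have := hwu' hv
      tauto
    have hc : (l : ZMod 4) = 1 ∨ (l : ZMod 4) = 3 := by tauto
    have key : ∀ c i j : ZMod 4, (c = 1 ∨ c = 3) → (j = i ∨ j = i + 2) → c + j = i + 3 ∨
        2 + (i + 3 - j) = c := by decide
    rcases huv with huv | hvu
    · obtain ⟨j, hj⟩ := h.exists_out v
      have hi := h.in_of_mem hu
      rcases key _ _ _ hc (hp (hU u hu) hv hi hj) with h1 | h1
      · exact h.edge_ne huv hi hj h1
      · exact h.not_defect_edge_of_mem hwu hwv huv hu hj hw2 (by rw [← h1]; ring)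
    · obtain ⟨i, hi⟩ := h.exists_in v
      have hj := h.out_of_mem hu
      rcases key _ _ _ hc (hp hv (hU u hu) hi hj) with h1 | h1
      · exact h.edge_ne hvu hi hj h1
      · exact h.not_defect_edge_of_mem' hwv hwu hvu hi hu hw2 (by rw [← h1]; ring)
  · push Not at hst
    have hcov : U j₀ ⊆
        (((U j₀).filter fun x => ∃ b, Good E U t b j₀ ∧ E x b) ∪
          (U j₀).filter fun x => ∃ b, Good E U t b (j₀ + 2) ∧ E x b) ∪
        (((U j₀).filter fun x => ∃ b, Good E U t b j₀ ∧ E b x) ∪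
          (U j₀).filter fun x => ∃ b, Good E U t b (j₀ + 2) ∧ E b x) := by
      intro u hu
      obtain ⟨v, hv, huv⟩ := hadj u (hU u hu)
      obtain ⟨c, hc⟩ := hst v
      have h1 := (hj₀ v).1 hv _ ((hc.1 _).2 rfl)
      have key : ∀ j c : ZMod 4, (c - 1 = j - 1 ∨ c - 1 = j + 1) → c = j ∨ c = j + 2 := by decide
      simp only [mem_union, mem_filter]
      rcases key _ _ h1 with rfl | rfl
      · rcases huv with huv | hvu
        · exact Or.inl (Or.inl ⟨hu, v, hc, huv⟩)
        · exact Or.inr (Or.inl ⟨hu, v, hc, hvu⟩)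
      · rcases huv with huv | hvu
        · exact Or.inl (Or.inr ⟨hu, v, hc, huv⟩)
        · exact Or.inr (Or.inr ⟨hu, v, hc, hvu⟩)
    have key : ∀ j : ZMod 4, j ≠ j + 1 ∧ j + 2 ≠ j + 1 := by decide
    have key' : ∀ j : ZMod 4, -(j + 2) = -j + 2 := by decide
    have h1 := card_filter_of_not_many (key j₀).1 (h.not_many_even hl (Or.inl rfl))
    have h2 := card_filter_of_not_many (key j₀).2 (h.not_many_even hl (Or.inr rfl))
    have h3 := card_filter_of_not_many (key (-j₀)).1 (h.flip.not_many_even hl (Or.inl rfl))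
    have h4 := card_filter_of_not_many (key (-j₀)).2 (h.flip.not_many_even hl (Or.inr rfl))
    simp only [good_flip, neg_neg, ← key', _root_.flip] at h3 h4
    have h5 := card_le_card hcov
    have h6 := card_union_le
      (((U j₀).filter fun x => ∃ b, Good E U t b j₀ ∧ E x b) ∪
          (U j₀).filter fun x => ∃ b, Good E U t b (j₀ + 2) ∧ E x b)
      (((U j₀).filter fun x => ∃ b, Good E U t b j₀ ∧ E b x) ∪
          (U j₀).filter fun x => ∃ b, Good E U t b (j₀ + 2) ∧ E b x)
    have h7 := card_union_le ((U j₀).filter fun x => ∃ b, Good E U t b j₀ ∧ E x b)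
      ((U j₀).filter fun x => ∃ b, Good E U t b (j₀ + 2) ∧ E x b)
    have h8 := card_union_le ((U j₀).filter fun x => ∃ b, Good E U t b j₀ ∧ E b x)
      ((U j₀).filter fun x => ∃ b, Good E U t b (j₀ + 2) ∧ E b x)
    omega

end Frame

end Cases

section Three

variable {V : Type} [Fintype V] {E : V → V → Prop} {U : ZMod 4 → Finset V} {e t l : ℕ}

/-- The possible sets of classes in which a vertex with defects `0` and `1` or only `1` has many
in-neighbours. -/
def shapeIn (k : Fin 3) (i : ZMod 4) : Finset (ZMod 4) := if k = 2 then {i - 1, i} else {i}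

/-- The possible sets of classes in which a vertex with defects `0` and `1` or only `1` has many
out-neighbours. -/
def shapeOut (k : Fin 3) (i : ZMod 4) : Finset (ZMod 4) := if k = 1 then {i + 1, i + 2} else {i + 1}

lemma card_strayIn_of_pair {a b : V} (hab : a ≠ b) (hs : strays E U t = {a, b}) (j : ZMod 4) :
    #(strayIn E U t j) = (if In E U t a j then 1 else 0) + if In E U t b j then 1 else 0 := by
  rw [strayIn, hs, card_filter, sum_pair hab]

lemma card_strayOut_of_pair {a b : V} (hab : a ≠ b) (hs : strays E U t = {a, b}) (j : ZMod 4) :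
    #(strayOut E U t j) = (if Out E U t a j then 1 else 0) + if Out E U t b j then 1 else 0 := by
  rw [strayOut, hs, card_filter, sum_pair hab]

namespace Frame

variable (h : Frame E U e t l)
include h

omit [Fintype V] h in
lemma exists_shape {w : V} (hw : ∀ d, Defect E U t w d → d = 0 ∨ d = 1) (hw1 : Defect E U t w 1) :
    ∃ k i, (∀ j, In E U t w j ↔ j ∈ shapeIn k i) ∧ ∀ j, Out E U t w j ↔ j ∈ shapeOut k i := by
  have key : ∀ I J : Finset (ZMod 4), (∀ i ∈ I, ∀ j ∈ J, i + 2 - j = 0 ∨ i + 2 - j = 1) →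
      (∃ i ∈ I, ∃ j ∈ J, 1 + j = i + 2) → ∃ k i, I = shapeIn k i ∧ J = shapeOut k i := by decide
  obtain ⟨i, j, hi, hj, hd⟩ := hw1
  obtain ⟨k, i, hI, hJ⟩ := key (univ.filter (In E U t w)) (univ.filter (Out E U t w))
    (fun i hi j hj => hw _ ⟨i, j, (mem_filter.1 hi).2, (mem_filter.1 hj).2, by ring⟩)
    ⟨i, by simpa using hi, j, by simpa using hj, hd⟩
  exact ⟨k, i, fun j => by simp [← hI], fun j => by simp [← hJ]⟩

lemma false_of_shapes (hl : (l : ZMod 4) = 3) (hl' : 15 ≤ l) {d : ℕ}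
    (hdn : Fintype.card V + 1 ≤ 4 * d) (hd : ∀ v, d ≤ #(outN E v))
    (hmin : ∀ i, d ≤ #(goods E U t (i + 1)) + min #(strayIn E U t i) #(strayOut E U t (i + 2)))
    {a b : V} (hab : a ≠ b) (hs : strays E U t = {a, b}) (ha1 : Defect E U t a 1) {i : ZMod 4}
    (ha : ∀ j, In E U t a j ↔ j ∈ shapeIn 1 i) (ha' : ∀ j, Out E U t a j ↔ j ∈ shapeOut 1 i)
    (hb : ∀ j, In E U t b j ↔ j ∈ shapeIn 2 (i - 1)) : False := by
  have h4 : (4 : ZMod 4) = 0 := rfl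
  have hb1 : In E U t b (i - 1) := (hb _).2 (by simp [shapeIn])
  have hb2 : In E U t b (i - 2) := (hb _).2 (by
    have key : ∀ i, i - 2 ∈ shapeIn 2 (i - 1) := by decide
    exact key i)
  have hsub : outN E b ⊆ goods E U t (i - 1 + 1) := by
    intro x hx
    rw [mem_outN] at hx
    by_cases hg : ∃ c, Good E U t x c
    · obtain ⟨c, hc⟩ := hg
      have hxa : a ≠ x := by
        rintro rfl
        exact absurd (mem_insert_self a {b}) (hs ▸ mem_strays.not.2 (not_not.2 ⟨c, hc⟩))
      have ho := (hc.2 _).2 rfl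
      rw [mem_goods, sub_add_cancel]
      have hij : ∀ i c : ZMod 4, c = i ∨ c = i + 1 ∨ c = i + 2 ∨ c = i + 3 := exists_eq_of_zmod
      rcases hij i c with rfl | rfl | rfl | rfl
      · exact hc
      · exact absurd (by rw [hl]; linear_combination h4) (h.edge_ne hx hb2 ho)
      · exact absurd (by rw [hl]; linear_combination h4) (h.edge_ne hx hb1 ho)
      · exact absurd (by rw [hl]; linear_combination -h4)
          (h.not_defect_edge hab hxa hx hb1 ho (by omega) ha1)
    · have hxs : x ∈ ({a, b} : Finset V) := hs ▸ mem_strays.2 hg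
      rcases mem_insert.1 hxs with rfl | hxs
      · exact absurd (by rw [hl]; linear_combination h4)
          (h.edge_ne hx hb2 ((ha' (i + 2)).2 (by simp [shapeOut])))
      · exact absurd (mem_singleton.1 hxs).symm (h.irrefl hx)
  have hle : ∀ j, d ≤ #(goods E U t (j + 1)) + if j = i - 1 ∨ j = i + 1 then 0 else 1 := by
    intro j
    split_ifs with hj
    · rcases hj with rfl | rfl
      · exact (hd b).trans (card_le_card hsub)
      · have key : ∀ i, i + 1 ∉ shapeIn 1 i ∧ i + 1 ∉ shapeIn 2 (i - 1) := by decide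
        have h1 := hmin (i + 1)
        rw [card_strayIn_of_pair hab hs, if_neg (by rw [ha]; exact (key i).1),
          if_neg (by rw [hb]; exact (key i).2)] at h1
        omega
    · have key : ∀ i j, j ∈ shapeIn 1 i → j ∉ shapeIn 2 (i - 1) := by decide
      have h1 := hmin j
      rw [card_strayIn_of_pair hab hs, ha, hb] at h1
      split_ifs at h1 with h2 h3
      · exact absurd h3 (key i j h2)
      all_goals omega
  have hsum := four_mul_le_sum hle
  have key : ∀ i : ZMod 4, (∑ j : ZMod 4, if j = i - 1 ∨ j = i + 1 then 0 else 1) = 2 := by decide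
  rw [key, hs, card_pair hab] at hsum
  omega

/-- The case `l ≡ 3`. -/
lemma false_of_three (hl : (l : ZMod 4) = 3) (hl' : 15 ≤ l) {d : ℕ}
    (hdn : Fintype.card V + 1 ≤ 4 * d) (hd : ∀ v, d ≤ #(outN E v)) (hd' : ∀ v, d ≤ #(inN E v)) :
    False := by
  have h4 : (4 : ZMod 4) = 0 := rfl
  have hcases : ∀ d : ZMod 4, d = 0 ∨ d = 1 ∨ d = 2 ∨ d = 3 := by decide
  have hself : ∀ w, ¬ Defect E U t w 3 := fun w hw => h.not_defect_self w (by rwa [hl])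
  by_cases hw : ∃ w, Defect E U t w 1
  swap
  · refine h.false_of_even (Or.inr ⟨hl, hl'⟩) fun w d hd => ?_
    rcases hcases d with rfl | rfl | rfl | rfl
    · exact Or.inl rfl
    · exact absurd ⟨w, hd⟩ hw
    · exact Or.inr rfl
    · exact absurd hd (hself w)
  obtain ⟨w₀, hw₀⟩ := hw
  have not_many : ∀ {E : V → V → Prop} {U : ZMod 4 → Finset V}, Frame E U e t l →
      Defect E U t w₀ 1 → ∀ j j', j' ≠ j + 1 → ¬ Many E U t j j' := by
    intro E U h hw j j' hj
    rcases exists_eq_of_zmod j j' with rfl | rfl | rfl | rfl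
    · exact h.not_many_even (Or.inr ⟨hl, hl'⟩) (Or.inl rfl)
    · exact absurd rfl hj
    · exact h.not_many_even (Or.inr ⟨hl, hl'⟩) (Or.inr rfl)
    · exact h.not_many_of_defect hw (by rw [hl]; linear_combination -h4)
  have hw₀s : w₀ ∈ strays E U t := mem_strays.2 fun ⟨c, hc⟩ => absurd (hc.defect_eq hw₀) (by decide)
  have htwo : ∀ {w w'}, w ≠ w' → Defect E U t w 1 → ¬ Defect E U t w' 2 := fun hne h1 h2 =>
    h.not_defect_pair hne h1 h2 (by rw [hl]; rfl)
  have hone : ∀ w ∈ strays E U t, Defect E U t w 1 := by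
    intro w hw
    by_cases hww : w = w₀
    · rwa [hww]
    · obtain ⟨d, hd, hd0⟩ := h.exists_defect_of_mem_strays hw
      rcases hcases d with rfl | rfl | rfl | rfl
      · exact absurd rfl hd0
      · exact hd
      · exact absurd hd (htwo (Ne.symm hww) hw₀)
      · exact absurd hd (hself w)
  have hk : #(strays E U t) ≤ 2 := by
    by_contra! hlt
    obtain ⟨x, y, z, hx, hy, hz, hxy, hxz, hyz⟩ := two_lt_card_iff.1 hlt
    exact h.not_defect_triple hxy hxz hyz (hone x hx) (hone y hy) (hone z hz) hl' (by rw [hl]; rfl)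
  have hmin := h.le_card_goods_add_min (by omega) (not_many h hw₀)
    (not_many h.flip (defect_flip.2 hw₀)) hd hd'
  have hmain := four_mul_le_sum hmin
  have hk0 : 0 < #(strays E U t) := card_pos.2 ⟨_, hw₀s⟩
  obtain hk1 | hk2 : #(strays E U t) = 1 ∨ #(strays E U t) = 2 := by omega
  · obtain ⟨w, hw⟩ := card_eq_one.1 hk1
    obtain ⟨i, j, hi, hj, hij⟩ := hone w (hw ▸ mem_singleton_self w)
    have key : ∀ I J : Finset (ZMod 4), (∀ i ∈ I, ∀ j ∈ J, i + 2 - j ≠ 3) →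
        (∃ i ∈ I, ∃ j ∈ J, 1 + j = i + 2) → #(univ.filter fun i => i ∈ I ∧ i + 2 ∈ J) ≤ 1 := by
      decide
    have h1 := key (univ.filter (In E U t w)) (univ.filter (Out E U t w))
      (fun i hi j hj heq => hself w ⟨i, j, (mem_filter.1 hi).2, (mem_filter.1 hj).2, by
        rw [← heq]; ring⟩)
      ⟨i, by simpa using hi, j, by simpa using hj, hij⟩
    simp only [mem_filter, mem_univ, true_and] at h1
    rw [sum_min_of_strays_eq hw, hk1] at hmain
    have h2 : #(univ.filter fun i => In E U t w i ∧ Out E U t w (i + 2)) ≤ 1 := by convert h1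
    omega
  · obtain ⟨a, b, hab, hs⟩ := card_eq_two.1 hk2
    have ha := hone a (hs ▸ mem_insert_self a {b})
    have hb := hone b (hs ▸ mem_insert_of_mem (mem_singleton_self b))
    have hD : ∀ {w w'}, w' ≠ w → Defect E U t w' 1 → ∀ d, Defect E U t w d → d = 0 ∨ d = 1 := by
      intro w w' hne h1 d hd
      rcases hcases d with rfl | rfl | rfl | rfl
      · exact Or.inl rfl
      · exact Or.inr rfl
      · exact absurd hd (htwo hne h1)
      · exact absurd hd (hself w)
    obtain ⟨k, i, hI, hO⟩ := exists_shape (hD hab.symm hb) ha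
    obtain ⟨k', i', hI', hO'⟩ := exists_shape (hD hab ha) hb
    have key : ∀ k k' i i', 3 ≤ ∑ j : ZMod 4,
        min ((if j ∈ shapeIn k i then 1 else 0) + if j ∈ shapeIn k' i' then 1 else 0)
          ((if j + 2 ∈ shapeOut k i then 1 else 0) + if j + 2 ∈ shapeOut k' i' then 1 else 0) →
        (k = 1 ∧ k' = 2 ∧ i' = i - 1) ∨ (k' = 1 ∧ k = 2 ∧ i = i' - 1) := by decide
    have h1 : 3 ≤ ∑ j : ZMod 4, min #(strayIn E U t j) #(strayOut E U t (j + 2)) := by omega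
    simp only [card_strayIn_of_pair hab hs, card_strayOut_of_pair hab hs, hI, hI', hO, hO'] at h1
    rcases key k k' i i' (by convert h1) with ⟨rfl, rfl, rfl⟩ | ⟨rfl, rfl, rfl⟩
    · exact h.false_of_shapes hl hl' hdn hd hmin hab hs ha hI hO hI'
    · exact h.false_of_shapes hl hl' hdn hd hmin hab.symm (by rw [hs, pair_comm]) hb hI' hO' hI

end Frame

end Three

section One

variable {V : Type} [Fintype V] {E : V → V → Prop} {U : ZMod 4 → Finset V} {e t l : ℕ}

/-- Every stray `w` has defect `3` and no defects other than `0` and `3`: it has many in-neighbours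
in the class `c w` and many out-neighbours in the class `c w + 3`. The vertices with an additional
class of in-neighbours or out-neighbours satisfy `p` or `q`, respectively. -/
structure Indexing (E : V → V → Prop) (U : ZMod 4 → Finset V) (t : ℕ) (c : V → ZMod 4)
    (p q : V → Prop) : Prop where
  in_iff : ∀ w ∈ strays E U t, ∀ j, In E U t w j ↔ j = c w ∨ p w ∧ j = c w + 1
  out_iff : ∀ w ∈ strays E U t, ∀ j, Out E U t w j ↔ j = c w + 3 ∨ q w ∧ j = c w + 2
  not_both : ∀ w ∈ strays E U t, p w → ¬ q w

namespace Indexing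

variable {c : V → ZMod 4} {p q : V → Prop} (hI : Indexing E U t c p q)
include hI

lemma in_index {w : V} (hw : w ∈ strays E U t) : In E U t w (c w) :=
  (hI.in_iff w hw _).2 (Or.inl rfl)

lemma out_index {w : V} (hw : w ∈ strays E U t) : Out E U t w (c w + 3) :=
  (hI.out_iff w hw _).2 (Or.inl rfl)

lemma card_strayIn_le (j : ZMod 4) :
    #(strayIn E U t j) ≤ #((strays E U t).filter (c · = j)) +
      #((strays E U t).filter fun w => c w = j + 3 ∧ p w) := by
  refine (card_le_card fun w hw => ?_).trans (card_union_le _ _)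
  obtain ⟨hws, hin⟩ := mem_filter.1 hw
  have h4 : (4 : ZMod 4) = 0 := rfl
  rcases (hI.in_iff w hws j).1 hin with rfl | ⟨hp, rfl⟩
  · exact mem_union_left _ (mem_filter.2 ⟨hws, rfl⟩)
  · exact mem_union_right _ (mem_filter.2 ⟨hws, by linear_combination -h4, hp⟩)

lemma card_strayOut_le (j : ZMod 4) :
    #(strayOut E U t (j + 2)) ≤ #((strays E U t).filter (c · = j + 3)) +
      #((strays E U t).filter fun w => c w = j ∧ q w) := by
  refine (card_le_card fun w hw => ?_).trans (card_union_le _ _)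
  obtain ⟨hw, hout⟩ := mem_filter.1 hw
  have h4 : (4 : ZMod 4) = 0 := rfl
  rcases (hI.out_iff w hw _).1 hout with h1 | ⟨hq, h1⟩
  · exact mem_union_left _ (mem_filter.2 ⟨hw, by linear_combination -h1 - h4⟩)
  · exact mem_union_right _ (mem_filter.2 ⟨hw, by linear_combination -h1, hq⟩)

lemma card_add_card_le (j : ZMod 4) :
    #((strays E U t).filter fun w => c w = j ∧ q w) +
      #((strays E U t).filter fun w => c w = j ∧ p w) ≤ #((strays E U t).filter (c · = j)) := by
  rw [← card_union_of_disjoint (disjoint_filter.2 fun w hw h1 h2 => hI.not_both w hw h2.2 h1.2)]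
  refine card_le_card fun w hw => ?_
  simp only [mem_union, mem_filter] at hw ⊢
  tauto

omit hI in
lemma card_strays (c : V → ZMod 4) :
    #((strays E U t).filter (c · = 0)) + #((strays E U t).filter (c · = 1)) +
      #((strays E U t).filter (c · = 2)) + #((strays E U t).filter (c · = 3)) =
      #(strays E U t) := by
  have h1 := card_eq_sum_card_fiberwise (s := strays E U t) (t := univ) (f := c) fun _ _ =>
    mem_coe.2 (mem_univ _)
  have h2 : ∑ j : ZMod 4, #((strays E U t).filter (c · = j)) = _ :=
    Fin.sum_univ_four fun j : ZMod 4 => #((strays E U t).filter (c · = j))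
  exact (h1.trans h2).symm

end Indexing

namespace Frame

variable (h : Frame E U e t l)
include h

lemma exists_indexing (hl : (l : ZMod 4) = 1) {w₀ : V} (hw₀ : Defect E U t w₀ 3)
    (hk : 1 < #(strays E U t)) : ∃ c p q, Indexing E U t c p q := by
  have hcases : ∀ d : ZMod 4, d = 0 ∨ d = 1 ∨ d = 2 ∨ d = 3 := by decide
  have hself : ∀ w, ¬ Defect E U t w 1 := fun w hw => h.not_defect_self w (by rwa [hl])
  have htwo : ∀ {w w'}, w ≠ w' → Defect E U t w 3 → ¬ Defect E U t w' 2 := fun hne h1 h2 =>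
    h.not_defect_pair hne h1 h2 (by rw [hl]; rfl)
  have hthree : ∀ w ∈ strays E U t, Defect E U t w 3 := by
    intro w hw
    by_cases hww : w = w₀
    · rwa [hww]
    · obtain ⟨d, hd, hd0⟩ := h.exists_defect_of_mem_strays hw
      rcases hcases d with rfl | rfl | rfl | rfl
      · exact absurd rfl hd0
      · exact absurd hd (hself w)
      · exact absurd hd (htwo (Ne.symm hww) hw₀)
      · exact hd
  have hD : ∀ w ∈ strays E U t, ∀ d, Defect E U t w d → d = 0 ∨ d = 3 := by
    intro w _ d hd
    obtain ⟨w', hw', hne⟩ := exists_mem_ne hk w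
    rcases hcases d with rfl | rfl | rfl | rfl
    · exact Or.inl rfl
    · exact absurd hd (hself w)
    · exact absurd hd (htwo hne (hthree w' hw'))
    · exact Or.inr rfl
  have key : ∀ I J : Finset (ZMod 4), (∀ i ∈ I, ∀ j ∈ J, i + 2 - j = 0 ∨ i + 2 - j = 3) →
      (∃ i ∈ I, ∃ j ∈ J, 3 + j = i + 2) → ∃ i, i ∈ I ∧ i + 3 ∈ J ∧ I ⊆ {i, i + 1} ∧
        J ⊆ {i + 3, i + 2} ∧ (i + 1 ∈ I → i + 2 ∉ J) := by decide
  have hshape : ∀ w, ∃ i, w ∈ strays E U t → In E U t w i ∧ Out E U t w (i + 3) ∧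
      (∀ j, In E U t w j → j = i ∨ j = i + 1) ∧ (∀ j, Out E U t w j → j = i + 3 ∨ j = i + 2) ∧
      (In E U t w (i + 1) → ¬ Out E U t w (i + 2)) := by
    intro w
    by_cases hw : w ∈ strays E U t
    · obtain ⟨i, j, hi, hj, hd⟩ := hthree w hw
      obtain ⟨i, hi⟩ := key (univ.filter (In E U t w)) (univ.filter (Out E U t w))
        (fun i hi j hj => hD w hw _ ⟨i, j, (mem_filter.1 hi).2, (mem_filter.1 hj).2, by ring⟩)
        ⟨i, by simpa using hi, j, by simpa using hj, hd⟩
      simp only [mem_filter, mem_univ, true_and, subset_iff, mem_insert, mem_singleton] at hi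
      exact ⟨i, fun _ => hi⟩
    · exact ⟨0, fun h => absurd h hw⟩
  choose c hc using hshape
  refine ⟨c, fun w => In E U t w (c w + 1), fun w => Out E U t w (c w + 2),
    fun w hw j => ?_, fun w hw j => ?_, fun w hw => (hc w hw).2.2.2.2⟩
  · obtain ⟨h1, -, h2, -⟩ := hc w hw
    constructor
    · intro hj
      rcases h2 j hj with rfl | rfl
      · exact Or.inl rfl
      · exact Or.inr ⟨hj, rfl⟩
    · rintro (rfl | ⟨hj, rfl⟩)
      exacts [h1, hj]
  · obtain ⟨-, h1, -, h2, -⟩ := hc w hw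
    constructor
    · intro hj
      rcases h2 j hj with rfl | rfl
      · exact Or.inl rfl
      · exact Or.inr ⟨hj, rfl⟩
    · rintro (rfl | ⟨hj, rfl⟩)
      exacts [h1, hj]

section

variable {c : V → ZMod 4} {p q : V → Prop} (hI : Indexing E U t c p q) (hl : (l : ZMod 4) = 1)
include hI hl

lemma card_index_le_two (j : ZMod 4) : #((strays E U t).filter (c · = j)) ≤ 2 := by
  by_contra! hlt
  have h4 : (4 : ZMod 4) = 0 := rfl
  have := h.le_l
  obtain ⟨x, y, z, hx, hy, hz, hxy, hxz, hyz⟩ := two_lt_card_iff.1 hlt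
  obtain ⟨hx, hxj⟩ := mem_filter.1 hx
  obtain ⟨hy, hyj⟩ := mem_filter.1 hy
  obtain ⟨hz, hzj⟩ := mem_filter.1 hz
  refine h.no_route [(x, 2), (y, 2), (z, l - 7)] x rfl (by simp; tauto)
    ⟨h.conn (hI.out_index hx) (hI.in_index hy) le_rfl ?_,
      h.conn (hI.out_index hy) (hI.in_index hz) le_rfl ?_,
      h.conn (hI.out_index hz) (hI.in_index hx) (by omega) ?_, trivial⟩ (by simp; omega)
  · rw [hxj, hyj]; push_cast; linear_combination h4
  · rw [hyj, hzj]; push_cast; linear_combination h4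
  · rw [hzj, hxj, cast_sub (by omega), hl]; push_cast; linear_combination -h4

lemma not_conn_of_left {a b b' : V} (ha : a ∈ strays E U t) (hb : b ∈ strays E U t)
    (hb' : b' ∈ strays E U t) (hne : b ≠ b') (hab : c a = c b + 1) (hbb : c b' = c b) :
    ¬ Conn E (2 * l) 1 a b := by
  intro hc
  have h4 : (4 : ZMod 4) = 0 := rfl
  have key : ∀ x : ZMod 4, x ≠ x + 1 := by decide
  have := h.le_l
  have h1 : a ≠ b := by rintro rfl; exact key _ hab
  have h2 : a ≠ b' := by rintro rfl; exact key _ (hbb.symm.trans hab)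
  refine h.no_route [(a, 1), (b, 2), (b', l - 6)] a rfl (by simp; tauto)
    ⟨hc, h.conn (hI.out_index hb) (hI.in_index hb') le_rfl ?_,
      h.conn (hI.out_index hb') (hI.in_index ha) (by omega) ?_, trivial⟩ (by simp; omega)
  · rw [hbb]; push_cast; linear_combination h4
  · rw [hab, hbb, cast_sub (by omega), hl]; push_cast; linear_combination -h4

lemma not_conn_of_right {a a' b : V} (ha : a ∈ strays E U t) (ha' : a' ∈ strays E U t)
    (hb : b ∈ strays E U t) (hne : a ≠ a') (hab : c a = c b + 1) (haa : c a' = c a) :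
    ¬ Conn E (2 * l) 1 a b := by
  intro hc
  have h4 : (4 : ZMod 4) = 0 := rfl
  have key : ∀ x : ZMod 4, x ≠ x + 1 := by decide
  have := h.le_l
  have h1 : a ≠ b := by rintro rfl; exact key _ hab
  have h2 : b ≠ a' := by rintro rfl; exact key _ (haa.trans hab)
  refine h.no_route [(a, 1), (b, 3), (a', l - 7)] a rfl (by simp; tauto)
    ⟨hc, h.conn (hI.out_index hb) (hI.in_index ha') (by omega) ?_,
      h.conn (hI.out_index ha') (hI.in_index ha) (by omega) ?_, trivial⟩ (by simp; omega)
  · rw [haa, hab]; push_cast; linear_combination h4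
  · rw [haa, cast_sub (by omega), hl]; push_cast; linear_combination -h4

lemma not_conn_of_conn {a b b' : V} (ha : a ∈ strays E U t) (hb : b ∈ strays E U t)
    (hb' : b' ∈ strays E U t) (hab : c a = c b + 1) (hbb : c b = c b' + 1)
    (hc : Conn E (2 * l) 1 a b) : ¬ Conn E (2 * l) 1 b b' := by
  intro hc'
  have h4 : (4 : ZMod 4) = 0 := rfl
  have key : ∀ x : ZMod 4, x ≠ x + 1 := by decide
  have := h.le_l
  have h1 : a ≠ b := by rintro rfl; exact key _ hab
  have h2 : b ≠ b' := by rintro rfl; exact key _ hbb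
  have h3 : a ≠ b' := by
    rintro rfl
    have key' : ∀ x y : ZMod 4, x = y + 1 → y ≠ x + 1 := by decide
    exact key' _ _ hab hbb
  refine h.no_route [(a, 1), (b, 1), (b', l - 5)] a rfl (by simp; tauto)
    ⟨hc, hc', h.conn (hI.out_index hb') (hI.in_index ha) (by omega) ?_, trivial⟩ (by simp; omega)
  rw [hab, hbb, cast_sub (by omega), hl]; push_cast; linear_combination -h4

end

lemma add_one_le_of_not_linked (hW : #(strays E U t) ≤ 8)
    (hM : ∀ j j', j' ≠ j + 1 → ¬ Many E U t j j') {d : ℕ} (hd : ∀ v, d ≤ #(outN E v))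
    {a b : V} {j : ZMod 4} (ha : 22 * t ≤ #((U j).filter (E a ·))) (hb : b ∈ strayIn E U t j)
    (hab : #((U j).filter fun x => E a x ∧ E x b) < 2 * l) :
    d + 1 ≤ #(goods E U t (j + 1)) + #(strayIn E U t j) := by
  have := h.le_t
  obtain ⟨v, hv, hvo⟩ := h.exists_clean hW (hM j)
    (S := (U j).filter fun x => E a x ∧ ¬ E x b) (filter_subset _ _) (by
      have hs : #((U j).filter (E a ·)) ≤ #((U j).filter fun x => E a x ∧ E x b) +
          #((U j).filter fun x => E a x ∧ ¬ E x b) := by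
        rw [← card_union_of_disjoint (disjoint_filter.2 fun x _ h1 h2 => h2.2 h1.2)]
        refine card_le_card fun x hx => ?_
        simp only [mem_union, mem_filter] at hx ⊢
        tauto
      omega)
  have h1 : outN E v ⊆ goods E U t (j + 1) ∪ (strayIn E U t j).erase b := fun x hx => by
    have := hvo hx
    have hxb : x ≠ b := by
      rintro rfl
      exact (mem_filter.1 hv).2.2 (mem_outN.1 hx)
    simp only [mem_union, mem_erase] at this ⊢
    tauto
  have h2 := (card_le_card h1).trans (card_union_le _ _)
  rw [card_erase_of_mem hb] at h2
  have := card_pos.2 ⟨b, hb⟩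
  have := hd v
  omega

end Frame

end One

section Gap

lemma exists_gap {t K : ℕ} {S : Finset ℕ} (hS : #S ≤ K) :
    ∃ i ≤ K, ∀ x ∈ S, t * 22 ^ i ≤ x → 22 * (t * 22 ^ i) ≤ x := by
  by_contra! hno
  choose! x hx hle hlt using hno
  obtain ⟨i, hi, j, hj, hij, hxx⟩ := exists_ne_map_eq_of_card_lt_of_maps_to
    (s := range (K + 1)) (t := S) (f := x) (by rw [card_range]; omega)
    fun i hi => hx i (by rw [coe_range, Set.mem_Iio] at hi; omega)
  rw [mem_range, Nat.lt_succ_iff] at hi hj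
  wlog hlt' : i < j generalizing i j
  · exact this j hj i hi hij.symm hxx.symm (by omega)
  have h1 := hlt i hi
  have h2 := hle j hj
  have h3 : 22 ^ (i + 1) ≤ 22 ^ j := Nat.pow_le_pow_right (by norm_num) hlt'
  have h4 := Nat.mul_le_mul_left t h3
  rw [pow_succ, ← mul_assoc] at h4
  omega

lemma false_of_counts {n α β f x : ZMod 4 → ℕ} (hn : ∀ i, n i ≤ 2) (hαβ : ∀ i, α i + β i ≤ n i)
    (hf : ∀ i, f i ≤ 1)
    (hlink : ∀ i, f i = 0 → n i = 0 ∨ n (i + 1) = 0 ∨ (n i = 1 ∧ n (i + 1) = 1))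
    (hlinks : ∀ i, f i = 0 → f (i + 1) = 0 → n i = 0 ∨ n (i + 1) = 0 ∨ n (i + 2) = 0)
    (hx : ∀ i, x i + f i ≤ n i + β (i + 3)) (hx' : ∀ i, x i + f (i + 2) ≤ n (i + 3) + α i)
    (hsum : n 0 + n 1 + n 2 + n 3 + 2 ≤ x 0 + x 1 + x 2 + x 3) : False := by
  have a0 := hαβ 0
  have a1 := hαβ 1
  have a2 := hαβ 2
  have a3 := hαβ 3
  have x0 : x 0 + f 0 ≤ n 0 + β 3 := hx 0
  have x1 : x 1 + f 1 ≤ n 1 + β 0 := hx 1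
  have x2 : x 2 + f 2 ≤ n 2 + β 1 := hx 2
  have x3 : x 3 + f 3 ≤ n 3 + β 2 := hx 3
  have y0 : x 0 + f 2 ≤ n 3 + α 0 := hx' 0
  have y1 : x 1 + f 3 ≤ n 0 + α 1 := hx' 1
  have y2 : x 2 + f 0 ≤ n 1 + α 2 := hx' 2
  have y3 : x 3 + f 1 ≤ n 2 + α 3 := hx' 3
  have key : 2 * (f 0 + f 1 + f 2 + f 3) + 4 ≤ n 0 + n 1 + n 2 + n 3 := by omega
  have hzero : (n 0 = 0 ∧ n 2 = 0) ∨ (n 1 = 0 ∧ n 3 = 0) := by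
    clear a0 a1 a2 a3 x0 x1 x2 x3 y0 y1 y2 y3 hsum
    have n0 := hn 0
    have n1 := hn 1
    have n2 := hn 2
    have n3 := hn 3
    have f0 := hf 0
    have f1 := hf 1
    have f2 := hf 2
    have f3 := hf 3
    have l0 : f 0 = 0 → n 0 = 0 ∨ n 1 = 0 ∨ (n 0 = 1 ∧ n 1 = 1) := hlink 0
    have l1 : f 1 = 0 → n 1 = 0 ∨ n 2 = 0 ∨ (n 1 = 1 ∧ n 2 = 1) := hlink 1
    have l2 : f 2 = 0 → n 2 = 0 ∨ n 3 = 0 ∨ (n 2 = 1 ∧ n 3 = 1) := hlink 2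
    have l3 : f 3 = 0 → n 3 = 0 ∨ n 0 = 0 ∨ (n 3 = 1 ∧ n 0 = 1) := hlink 3
    have m0 : f 0 = 0 → f 1 = 0 → n 0 = 0 ∨ n 1 = 0 ∨ n 2 = 0 := hlinks 0
    have m1 : f 1 = 0 → f 2 = 0 → n 1 = 0 ∨ n 2 = 0 ∨ n 3 = 0 := hlinks 1
    have m2 : f 2 = 0 → f 3 = 0 → n 2 = 0 ∨ n 3 = 0 ∨ n 0 = 0 := hlinks 2
    have m3 : f 3 = 0 → f 0 = 0 → n 3 = 0 ∨ n 0 = 0 ∨ n 1 = 0 := hlinks 3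
    omega
  omega

end Gap

section One

variable {V : Type} [Fintype V] {E : V → V → Prop} {U : ZMod 4 → Finset V} {e t l : ℕ}

/-- There are strays `a` and `b` with indices `j + 1` and `j` which are not joined by many paths
of length two. -/
def Unlinked (E : V → V → Prop) (U : ZMod 4 → Finset V) (t l : ℕ) (c : V → ZMod 4) (j : ZMod 4) :
    Prop :=
  ∃ a b, a ∈ strays E U t ∧ b ∈ strays E U t ∧ c a = j + 1 ∧ c b = j ∧ ¬ Conn E (2 * l) 1 a b

omit [Fintype V] in
lemma In.mono {t' : ℕ} (htt : t ≤ t') {w : V} {i : ZMod 4} (h : In E U t' w i) : In E U t w i :=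
  htt.trans h

omit [Fintype V] in
lemma Out.mono {t' : ℕ} (htt : t ≤ t') {w : V} {i : ZMod 4} (h : Out E U t' w i) :
    Out E U t w i :=
  htt.trans h

namespace Frame

variable (h : Frame E U e t l)
include h

lemma le_of_unlinked {c : V → ZMod 4} {p q : V → Prop}
    (hI : Indexing E U t c p q) (hW : #(strays E U t) ≤ 8)
    (hM : ∀ j j', j' ≠ j + 1 → ¬ Many E U t j j') {d : ℕ} (hd : ∀ v, d ≤ #(outN E v))
    (hgap : ∀ w ∈ strays E U t, ∀ i, Out E U t w i → Out E U (22 * t) w i)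
    {j : ZMod 4} (hj : Unlinked E U t l c j) :
    d + 1 ≤ #(goods E U t (j + 1)) + #(strayIn E U t j) := by
  obtain ⟨a, b, ha, hb, haj, rfl, hab⟩ := hj
  have h4 : (4 : ZMod 4) = 0 := rfl
  have ho := hI.out_index ha
  rw [haj, show c b + 1 + 3 = c b by linear_combination h4] at ho
  refine h.add_one_le_of_not_linked hW hM hd (hgap a ha _ ho)
    (mem_filter.2 ⟨hb, hI.in_index hb⟩) ?_
  by_contra! hle
  exact hab (Conn.of_card (U (c b)) hle)

lemma le_of_unlinked' {c : V → ZMod 4} {p q : V → Prop}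
    (hI : Indexing E U t c p q) (hW : #(strays E U t) ≤ 8)
    (hM : ∀ j j', j' ≠ j + 1 → ¬ Many (_root_.flip E) (fun i => U (-i)) t j j')
    {d : ℕ} (hd : ∀ v, d ≤ #(inN E v))
    (hgap : ∀ w ∈ strays E U t, ∀ i, In E U t w i → In E U (22 * t) w i)
    {j : ZMod 4} (hj : Unlinked E U t l c j) :
    d + 1 ≤ #(goods E U t (j - 1)) + #(strayOut E U t j) := by
  obtain ⟨a, b, ha, hb, haj, rfl, hab⟩ := hj
  have h4 : (4 : ZMod 4) = 0 := rfl
  have ho := hI.out_index ha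
  rw [haj, show c b + 1 + 3 = c b by linear_combination h4] at ho
  have h1 : 22 * t ≤ #((U (- -c b)).filter (_root_.flip E b ·)) := by
    rw [neg_neg]
    exact hgap b hb _ (hI.in_index hb)
  have h2 : a ∈ strayIn (_root_.flip E) (fun i => U (-i)) t (-c b) := by
    rw [strayIn_flip, neg_neg]
    exact mem_filter.2 ⟨ha, ho⟩
  have := h.flip.add_one_le_of_not_linked (by rwa [strays_flip]) hM hd h1 h2 (by
    rw [neg_neg]
    by_contra! hle
    refine hab (Conn.of_card (U (c b)) ?_)
    simpa only [_root_.flip, and_comm] using hle)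
  rwa [goods_flip, strayIn_flip, neg_neg, show -(-c b + 1) = c b - 1 by ring] at this

lemma exists_defect_three (hl : (l : ZMod 4) = 1) : ∃ w, Defect E U t w 3 := by
  by_contra! hno
  have hcases : ∀ d : ZMod 4, d = 0 ∨ d = 1 ∨ d = 2 ∨ d = 3 := by decide
  refine h.false_of_even (Or.inl hl) fun w d hd => ?_
  rcases hcases d with rfl | rfl | rfl | rfl
  · exact Or.inl rfl
  · exact absurd hd (by simpa [hl] using h.not_defect_self w)
  · exact Or.inr rfl
  · exact absurd hd (hno w)

lemma card_strays_le (hl : (l : ZMod 4) = 1) : #(strays E U t) ≤ 8 := by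
  by_contra! hlt
  obtain ⟨w₀, hw₀⟩ := h.exists_defect_three hl
  obtain ⟨c, p, q, hI⟩ := h.exists_indexing hl hw₀ (by omega)
  have := Indexing.card_strays (E := E) (U := U) (t := t) c
  have := h.card_index_le_two hI hl 0
  have := h.card_index_le_two hI hl 1
  have := h.card_index_le_two hI hl 2
  have := h.card_index_le_two hI hl 3
  omega

lemma false_of_gap (hl : (l : ZMod 4) = 1) {d : ℕ}
    (hdn : Fintype.card V + 2 ≤ 4 * d) (hd : ∀ v, d ≤ #(outN E v)) (hd' : ∀ v, d ≤ #(inN E v))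
    (hgap : ∀ w ∈ strays E U t, ∀ i, In E U t w i → In E U (22 * t) w i)
    (hgap' : ∀ w ∈ strays E U t, ∀ i, Out E U t w i → Out E U (22 * t) w i) : False := by
  have hW := h.card_strays_le hl
  obtain ⟨w₀, hw₀⟩ := h.exists_defect_three hl
  have not_many : ∀ {E : V → V → Prop} {U : ZMod 4 → Finset V}, Frame E U e t l →
      Defect E U t w₀ 3 → ∀ j j', j' ≠ j + 1 → ¬ Many E U t j j' := by
    intro E U h hw j j' hj
    rcases exists_eq_of_zmod j j' with rfl | rfl | rfl | rfl
    · exact h.not_many_even (Or.inl hl) (Or.inl rfl)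
    · exact absurd rfl hj
    · exact h.not_many_even (Or.inl hl) (Or.inr rfl)
    · exact h.not_many_of_defect hw (by rw [hl]; ring)
  have hM := not_many h hw₀
  have hM' := not_many h.flip (defect_flip.2 hw₀)
  have hw₀s : w₀ ∈ strays E U t := mem_strays.2 fun ⟨c, hc⟩ => absurd (hc.defect_eq hw₀) (by decide)
  have hk0 : 0 < #(strays E U t) := card_pos.2 ⟨_, hw₀s⟩
  obtain hk1 | hk2 : #(strays E U t) = 1 ∨ 1 < #(strays E U t) := by omega
  · have hmain := four_mul_le_sum (h.le_card_goods_add_min hW hM hM' hd hd')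
    obtain ⟨w, hw⟩ := card_eq_one.1 hk1
    have key : ∀ I J : Finset (ZMod 4), (∀ i ∈ I, ∀ j ∈ J, i + 2 - j ≠ 1) →
        #(univ.filter fun i => i ∈ I ∧ i + 2 ∈ J) ≤ 2 := by decide
    have h1 := key (univ.filter (In E U t w)) (univ.filter (Out E U t w))
      (fun i hi j hj heq => h.not_defect_self w (by
        rw [hl]
        exact ⟨i, j, (mem_filter.1 hi).2, (mem_filter.1 hj).2, by rw [← heq]; ring⟩))
    simp only [mem_filter, mem_univ, true_and] at h1
    rw [sum_min_of_strays_eq hw, hk1] at hmain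
    have h2 : #(univ.filter fun i => In E U t w i ∧ Out E U t w (i + 2)) ≤ 2 := by convert h1
    omega
  · obtain ⟨c, p, q, hI⟩ := h.exists_indexing hl hw₀ hk2
    obtain ⟨n, hn⟩ : ∃ n : ZMod 4 → ℕ, ∀ j, n j = #((strays E U t).filter (c · = j)) :=
      ⟨_, fun _ => rfl⟩
    obtain ⟨α, hα⟩ : ∃ α : ZMod 4 → ℕ, ∀ j, α j = #((strays E U t).filter fun w => c w = j ∧ q w) :=
      ⟨_, fun _ => rfl⟩
    obtain ⟨β, hβ⟩ : ∃ β : ZMod 4 → ℕ, ∀ j, β j = #((strays E U t).filter fun w => c w = j ∧ p w) :=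
      ⟨_, fun _ => rfl⟩
    obtain ⟨f, hf⟩ : ∃ f : ZMod 4 → ℕ, ∀ j, f j = if Unlinked E U t l c j then 1 else 0 :=
      ⟨_, fun _ => rfl⟩
    have hf1 : ∀ j, f j ≤ 1 := fun j => by rw [hf]; split_ifs <;> omega
    have hconn : ∀ j, f j = 0 → ∀ a b, a ∈ strays E U t → b ∈ strays E U t → c a = j + 1 →
        c b = j → Conn E (2 * l) 1 a b := by
      intro j hj a b ha hb haj hbj
      by_contra hab
      rw [hf, if_pos ⟨a, b, ha, hb, haj, hbj, hab⟩] at hj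
      exact one_ne_zero hj
    have hex : ∀ j, 0 < n j → ∃ a ∈ strays E U t, c a = j := fun j hj => by
      rw [hn] at hj
      obtain ⟨a, ha⟩ := card_pos.1 hj
      exact ⟨a, mem_filter.1 ha⟩
    have hex2 : ∀ j, 1 < n j → ∃ a ∈ strays E U t, ∃ b ∈ strays E U t, a ≠ b ∧ c a = j ∧ c b = j :=
      fun j hj => by
        rw [hn] at hj
        obtain ⟨a, ha, b, hb, hab⟩ := one_lt_card.1 hj
        rw [mem_filter] at ha hb
        exact ⟨a, ha.1, b, hb.1, hab, ha.2, hb.2⟩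
    have hfn : ∀ j, f j ≤ n j ∧ f j ≤ n (j + 1) := by
      intro j
      rw [hf]
      split_ifs with hu
      · obtain ⟨a, b, ha, hb, haj, hbj, -⟩ := hu
        rw [hn, hn]
        exact ⟨card_pos.2 ⟨b, mem_filter.2 ⟨hb, hbj⟩⟩, card_pos.2 ⟨a, mem_filter.2 ⟨ha, haj⟩⟩⟩
      · omega
    have hA : ∀ j, d + f j ≤ #(goods E U t (j + 1)) + (n j + β (j + 3)) := by
      intro j
      rw [hf, hn, hβ]
      have := hI.card_strayIn_le j
      split_ifs with hu
      · have := h.le_of_unlinked hI hW hM hd hgap' hu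
        omega
      · have := h.le_card_goods_add_strayIn hW hM hd j
        omega
    have hB : ∀ j, d + f (j + 2) ≤ #(goods E U t (j + 1)) + (n (j + 3) + α j) := by
      intro j
      rw [hf, hn, hα, show j + 1 = j + 2 - 1 by ring]
      have := hI.card_strayOut_le j
      split_ifs with hu
      · have := h.le_of_unlinked' hI hW hM' hd' hgap hu
        omega
      · have := h.le_card_goods_add_strayOut hW hM' hd' (j + 2)
        omega
    have hlink : ∀ i, f i = 0 → n i = 0 ∨ n (i + 1) = 0 ∨ (n i = 1 ∧ n (i + 1) = 1) := by
      intro i hi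
      by_contra! hne
      obtain ⟨hi0, hi1, hi2⟩ := hne
      by_cases h2 : 1 < n i
      · obtain ⟨b, hb, b', hb', hbb, hbi, hbi'⟩ := hex2 i h2
        obtain ⟨a, ha, hai⟩ := hex (i + 1) (by omega)
        exact h.not_conn_of_left hI hl ha hb hb' hbb (by rw [hai, hbi]) (by rw [hbi, hbi'])
          (hconn i hi a b ha hb hai hbi)
      · obtain ⟨a, ha, a', ha', haa, hai, hai'⟩ := hex2 (i + 1) (by
          have := hi2 (by omega)
          omega)
        obtain ⟨b, hb, hbi⟩ := hex i (by omega)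
        exact h.not_conn_of_right hI hl ha ha' hb haa (by rw [hai, hbi]) (by rw [hai, hai'])
          (hconn i hi a b ha hb hai hbi)
    have hlinks : ∀ i, f i = 0 → f (i + 1) = 0 → n i = 0 ∨ n (i + 1) = 0 ∨ n (i + 2) = 0 := by
      intro i hi hi'
      by_contra! hne
      obtain ⟨b', hb', hbi'⟩ := hex i (by omega)
      obtain ⟨b, hb, hbi⟩ := hex (i + 1) (by omega)
      obtain ⟨a, ha, hai⟩ := hex (i + 2) (by omega)
      exact h.not_conn_of_conn hI hl ha hb hb' (by rw [hai, hbi]; ring) (by rw [hbi, hbi'])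
        (hconn (i + 1) hi' a b ha hb (by rw [hai]; ring) hbi) (hconn i hi b b' hb hb' hbi hbi')
    obtain ⟨x, hx⟩ : ∃ x : ZMod 4 → ℕ, ∀ i,
        x i = min (n i + β (i + 3) - f i) (n (i + 3) + α i - f (i + 2)) := ⟨_, fun _ => rfl⟩
    have hmain := four_mul_le_sum (E := E) (U := U) (t := t) (d := d) (f := x) (fun i => by
      have := hA i
      have := hB i
      rw [hx]
      omega)
    have hsum : ∑ i : ZMod 4, x i = _ := Fin.sum_univ_four x
    change _ = x 0 + x 1 + x 2 + x 3 at hsum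
    have hcard := Indexing.card_strays (E := E) (U := U) (t := t) c
    rw [← hn, ← hn, ← hn, ← hn] at hcard
    refine false_of_counts (fun i => hn i ▸ h.card_index_le_two hI hl i) (fun i => ?_) hf1 hlink
      hlinks (α := α) (β := β) (x := x) (fun i => ?_) (fun i => ?_) (by omega)
    · rw [hn, hα, hβ]
      exact hI.card_add_card_le i
    · have := hfn i
      rw [hx]
      omega
    · have := (hfn (i + 2)).2
      rw [show i + 2 + 1 = i + 3 by ring] at this
      rw [hx]
      omega

omit h in
lemma strays_mono {t' : ℕ} (h : Frame E U e t' l) (htt : t ≤ t') :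
    strays E U t' ⊆ strays E U t := by
  intro w hw
  rw [mem_strays] at hw ⊢
  rintro ⟨c, hc⟩
  obtain ⟨i, hi⟩ := h.exists_in w
  obtain ⟨j, hj⟩ := h.exists_out w
  have hI : ∀ i, In E U t' w i → i = c - 1 := fun i hi => (hc.1 i).1 (hi.mono htt)
  have hO : ∀ j, Out E U t' w j → j = c + 1 := fun j hj => (hc.2 j).1 (hj.mono htt)
  exact hw ⟨c, fun i' => ⟨hI i', fun heq => heq ▸ hI i hi ▸ hi⟩,
    fun j' => ⟨hO j', fun heq => heq ▸ hO j hj ▸ hj⟩⟩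

/-- The case `l ≡ 1`. -/
lemma false_of_one (hl : (l : ZMod 4) = 1) (ht : 1000 * (t * 22 ^ 64) ≤ Fintype.card V) {d : ℕ}
    (hdn : Fintype.card V + 2 ≤ 4 * d) (hd : ∀ v, d ≤ #(outN E v)) (hd' : ∀ v, d ≤ #(inN E v)) :
    False := by
  have hW := h.card_strays_le hl
  set S : Finset ℕ := (strays E U t ×ˢ univ).image (fun x => #((U x.2).filter (E · x.1))) ∪
    (strays E U t ×ˢ univ).image fun x => #((U x.2).filter (E x.1 ·))
  have hS : #S ≤ 64 := by
    have h1 : #(strays E U t ×ˢ (univ : Finset (ZMod 4))) ≤ 32 := by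
      rw [card_product, card_univ, ZMod.card]
      omega
    refine (card_union_le _ _).trans ?_
    have := card_image_le (s := strays E U t ×ˢ (univ : Finset (ZMod 4)))
      (f := fun x => #((U x.2).filter (E · x.1)))
    have := card_image_le (s := strays E U t ×ˢ (univ : Finset (ZMod 4)))
      (f := fun x => #((U x.2).filter (E x.1 ·)))
    omega
  obtain ⟨i, hi, hgap⟩ := exists_gap (t := t) hS
  have htt : t ≤ t * 22 ^ i := Nat.le_mul_of_pos_right _ (by positivity)
  have htt' : t * 22 ^ i ≤ t * 22 ^ 64 :=
    Nat.mul_le_mul_left _ (Nat.pow_le_pow_right (by norm_num) hi)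
  have h' : Frame E U e (t * 22 ^ i) l :=
    { h with
      le_t := h.le_t.trans htt
      t_le := (Nat.mul_le_mul_left _ htt').trans ht }
  have hsub := strays_mono h' htt
  refine h'.false_of_gap hl hdn hd hd' (fun w hw j hj => hgap _ ?_ hj)
    fun w hw j hj => hgap _ ?_ hj
  · exact mem_union_left _ (mem_image.2 ⟨(w, j), mem_product.2 ⟨hsub hw, mem_univ _⟩, rfl⟩)
  · exact mem_union_right _ (mem_image.2 ⟨(w, j), mem_product.2 ⟨hsub hw, mem_univ _⟩, rfl⟩)

end Frame

end One

section Assembly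

/-- A hierarchy of small parameters, each much smaller than the next one. -/
lemma exists_parameters (K l : ℕ) (hK : 1 ≤ K) :
    ∃ μ : ℝ, 0 < μ ∧ ∃ N₀ : ℕ, ∀ N : ℕ, N₀ ≤ N → ∃ m t₁ t₂ : ℕ, μ * N ≤ m ∧ 2 * l ≤ m ∧
      8 * m < N ∧ N * (13 * m) ≤ t₁ * t₁ ∧ N * (5 * m + t₁) ≤ t₂ * t₂ ∧
      K * (8 * (10 * m + 2 * t₁ + 2 * t₂) + 2 * l + 20) ≤ N := by
  obtain ⟨L, hL⟩ : ∃ L, L = 241 * K := ⟨_, rfl⟩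
  have hL1 : 241 ≤ L := by omega
  refine ⟨1 / (2 * L ^ 4), by positivity, L ^ 4 * (2 * l + 20), fun N hN => ?_⟩
  have hpos : 0 < L ^ 4 := by positivity
  obtain ⟨s, hs⟩ : ∃ s, s = N / L ^ 4 := ⟨_, rfl⟩
  have hls : 2 * l + 20 ≤ s := by
    rw [hs, Nat.le_div_iff_mul_le hpos]
    linarith
  have hsN : L ^ 4 * s ≤ N := hs ▸ Nat.mul_div_le N (L ^ 4)
  have hNs : N ≤ 2 * L ^ 4 * s := by
    have h1 : N < L ^ 4 * (s + 1) := hs ▸ Nat.lt_mul_div_succ N hpos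
    nlinarith
  have hL2 : 241 * 241 ≤ L ^ 2 := by nlinarith
  refine ⟨s, 6 * L ^ 2 * s, 4 * L ^ 3 * s, ?_, by omega, ?_, ?_, ?_, ?_⟩
  · rw [one_div, inv_mul_le_iff₀ (by positivity)]
    exact_mod_cast hNs
  · have h9 : 9 ≤ L ^ 4 := by nlinarith
    have h1 : 9 * s ≤ L ^ 4 * s := Nat.mul_le_mul_right s h9
    omega
  · calc N * (13 * s) ≤ 2 * L ^ 4 * s * (13 * s) := Nat.mul_le_mul_right _ hNs
      _ = 26 * (L ^ 4 * s ^ 2) := by ring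
      _ ≤ 36 * (L ^ 4 * s ^ 2) := Nat.mul_le_mul_right _ (by norm_num)
      _ = 6 * L ^ 2 * s * (6 * L ^ 2 * s) := by ring
  · calc N * (5 * s + 6 * L ^ 2 * s) ≤ 2 * L ^ 4 * s * (5 * s + 6 * L ^ 2 * s) :=
          Nat.mul_le_mul_right _ hNs
      _ = L ^ 4 * s ^ 2 * (10 + 12 * L ^ 2) := by ring
      _ ≤ L ^ 4 * s ^ 2 * (16 * L ^ 2) := Nat.mul_le_mul_left _ (by omega)
      _ = 4 * L ^ 3 * s * (4 * L ^ 3 * s) := by ring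
  · have h23 : L ^ 2 ≤ L ^ 3 := Nat.pow_le_pow_right (by omega) (by norm_num)
    have h03 : 1 ≤ L ^ 3 := Nat.one_le_pow _ _ (by omega)
    calc K * (8 * (10 * s + 2 * (6 * L ^ 2 * s) + 2 * (4 * L ^ 3 * s)) + 2 * l + 20)
        ≤ K * (8 * (10 * s + 2 * (6 * L ^ 2 * s) + 2 * (4 * L ^ 3 * s)) + s) :=
          Nat.mul_le_mul_left _ (by omega)
      _ = K * ((81 + 96 * L ^ 2 + 64 * L ^ 3) * s) := by ring
      _ ≤ K * (241 * L ^ 3 * s) :=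
          Nat.mul_le_mul_left _ (Nat.mul_le_mul_right _ (by omega))
      _ = L ^ 4 * s := by rw [show L ^ 4 = L * L ^ 3 by ring, hL]; ring
      _ ≤ N := hsN

variable {V : Type} [Fintype V] {E : V → V → Prop} {A B : Finset V} {m : ℕ}

lemma nearBip_of_sdiff_le (hdisj : Disjoint A B) (hm : 8 * m < Fintype.card V)
    (hdeg : ∀ v, Fintype.card V < 4 * #(outN E v)) (hdeg' : ∀ v, Fintype.card V < 4 * #(inN E v))
    (hR : #(univ \ (A ∪ B)) ≤ m) (hA : ∀ v ∈ A, #(outN E v \ B) ≤ m ∧ #(inN E v \ B) ≤ m)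
    (hB : ∀ v ∈ B, #(outN E v \ A) ≤ m ∧ #(inN E v \ A) ≤ m) : NearBip E m A B := by
  have hout : ∀ v C, #(outN E v \ C) ≤ m → Fintype.card V ≤ 4 * (#(C.filter (E v ·)) + m) := by
    intro v C h
    have h1 := card_sdiff_add_card_inter (outN E v) C
    rw [show outN E v ∩ C = C.filter (E v ·) by ext; simp [and_comm]] at h1
    have := hdeg v
    omega
  have hin : ∀ v C, #(inN E v \ C) ≤ m → Fintype.card V ≤ 4 * (#(C.filter (E · v)) + m) := by
    intro v C h
    have h1 := card_sdiff_add_card_inter (inN E v) C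
    rw [show inN E v ∩ C = C.filter (E · v) by ext; simp [and_comm]] at h1
    have := hdeg' v
    omega
  have hne : A.Nonempty ∧ B.Nonempty := by
    have hu : (A ∪ B).Nonempty := by
      rw [nonempty_iff_ne_empty]
      intro h0
      rw [h0, sdiff_empty, card_univ] at hR
      omega
    obtain ⟨v, hv⟩ := hu
    rcases mem_union.1 hv with hv | hv
    · refine ⟨⟨v, hv⟩, ?_⟩
      have h1 := hout v B (hA v hv).1
      have h2 : 0 < #(B.filter (E v ·)) := by omega
      exact (card_pos.1 h2).mono (filter_subset _ _)
    · refine ⟨?_, ⟨v, hv⟩⟩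
      have h1 := hout v A (hB v hv).1
      have h2 : 0 < #(A.filter (E v ·)) := by omega
      exact (card_pos.1 h2).mono (filter_subset _ _)
  exact ⟨hdisj, fun v hv => hout v B (hA v hv).1, fun v hv => hin v B (hA v hv).2,
    fun v hv => hout v A (hB v hv).1, fun v hv => hin v A (hB v hv).2, hne.1, hne.2⟩

/-- A large oriented graph of minimum semidegree at least `(n + 1) / 4` (if `l ≡ 3` modulo `4`) or
`(n + 2) / 4` (otherwise) contains a directed cycle of length `l`. -/
theorem exists_cycle_of_semidegree (l : ℕ) [NeZero l] (hl : 9 ≤ l) (h3 : 3 ∣ l) (h4 : ¬ 4 ∣ l) :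
    ∃ n₀ : ℕ, ∀ (V : Type) [Fintype V] (E : V → V → Prop), (∀ u v, E u v → ¬ E v u) →
      n₀ ≤ Fintype.card V → ∀ d : ℕ,
      Fintype.card V + (if l % 4 = 3 then 1 else 2) ≤ 4 * d →
      (∀ v, d ≤ #(outN E v)) → (∀ v, d ≤ #(inN E v)) →
      ∃ v : ZMod l → V, Function.Injective v ∧ ∀ i, E (v i) (v (i + 1)) := by
  obtain ⟨μ, hμ, N₀, hN₀⟩ := exists_parameters (1000 * 22 ^ 64) l (Nat.mul_pos (by norm_num)
    (Nat.pow_pos (by norm_num)))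
  obtain ⟨N₁, hN₁⟩ := exists_near_bipartite l hl h3 h4 μ hμ
  refine ⟨max N₀ N₁, fun V _ E hE hV d hd hout hin => ?_⟩
  obtain ⟨m, t₁, t₂, hμm, hlm, hm, ht₁, ht₂, ht⟩ := hN₀ _ ((le_max_left _ _).trans hV)
  have hd1 : Fintype.card V < 4 * d := by split_ifs at hd <;> omega
  have hdeg : ∀ v, Fintype.card V < 4 * #(outN E v) := fun v => by have := hout v; omega
  have hdeg' : ∀ v, Fintype.card V < 4 * #(inN E v) := fun v => by have := hin v; omega
  have hreal : ∀ k : ℕ, Fintype.card V < 4 * k → (Fintype.card V : ℝ) / 4 ≤ k := by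
    intro k hk
    have : (Fintype.card V : ℝ) ≤ 4 * k := by exact_mod_cast hk.le
    linarith
  by_contra hcyc
  obtain ⟨A, B, hdisj, hR, hA, hB⟩ := hN₁ V E hE ((le_max_right _ _).trans hV)
    (fun v => hreal _ (hdeg v)) (fun v => hreal _ (hdeg' v)) hcyc
  have hnat : ∀ k : ℕ, (k : ℝ) ≤ μ * Fintype.card V → k ≤ m := fun k hk => by
    exact_mod_cast hk.trans hμm
  have hbip : NearBip E m A B := nearBip_of_sdiff_le hdisj hm hdeg hdeg' (hnat _ hR)
    (fun v hv => ⟨hnat _ (hA v hv).1, hnat _ (hA v hv).2⟩)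
    fun v hv => ⟨hnat _ (hB v hv).1, hnat _ (hB v hv).2⟩
  rcases core_or_expands hE hbip hm ht₁ ht₂ with ⟨U, hU⟩ | ⟨hAB, hBA⟩
  · obtain ⟨t, ht'⟩ : ∃ t, t = 8 * (10 * m + 2 * t₁ + 2 * t₂) + 2 * l + 20 := ⟨_, rfl⟩
    rw [← ht'] at ht
    have hlarge : 1000 * (t * 22 ^ 64) ≤ Fintype.card V := by
      rwa [mul_comm t, ← mul_assoc]
    have hframe : Frame E U (10 * m + 2 * t₁ + 2 * t₂) t l :=
      ⟨hE, hU, hdeg, hdeg', ht'.ge, (Nat.mul_le_mul_left _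
        (Nat.le_mul_of_pos_right t (Nat.pow_pos (by norm_num)))).trans hlarge, hl, hcyc⟩
    have hcast : (l : ZMod 4) = ((l % 4 : ℕ) : ZMod 4) := (ZMod.natCast_mod l 4).symm
    obtain hr | hr | hr : l % 4 = 1 ∨ l % 4 = 2 ∨ l % 4 = 3 := by omega
    · rw [hr] at hcast
      exact hframe.false_of_one (by simpa using hcast) hlarge (by simpa [hr] using hd) hout hin
    · rw [hr] at hcast
      exact hframe.false_of_two (by simpa using hcast) (by omega) (by simpa [hr] using hd) hout hin
    · rw [hr] at hcast
      exact hframe.false_of_three (by simpa using hcast) (by omega) (by simpa [hr] using hd)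
        hout hin
  · exact hcyc (exists_cycle_of_expands hE hbip hAB hBA hl hlm hm (hnat _ hR) hdeg hdeg')

end Assembly

end DiCycle

/-- For `ℓ ≥ 9` divisible by `3` but not by `4`: there are `ε > 0` and `n₀` such that any
oriented graph `G` on `n ≥ n₀` vertices with minimum semidegree at least `(n+1)/4` when
`ℓ ≡ 3 (mod 4)` and `(n+2)/4` otherwise, containing a subgraph `H` with minimum
semidegree (within `H`) at least `n/4 - εn` that is homomorphic to `C₄`,
contains a directed `ℓ`-cycle. -/
theorem cycle_of_c4_homomorphic_subgraph (ℓ : ℕ) (hℓ : 9 ≤ ℓ) (h3 : 3 ∣ ℓ) (h4 : ¬ 4 ∣ ℓ) :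
    ∃ ε : ℝ, 0 < ε ∧ ∃ n₀ : ℕ, ∀ n : ℕ, n₀ ≤ n →
      ∀ E : Fin n → Fin n → Prop, Oriented E →
      (∀ v, (if ℓ % 4 = 3 then ((n : ℝ) + 1) / 4 else ((n : ℝ) + 2) / 4)
        ≤ (semiDeg E v : ℝ)) →
      (∃ (S : Finset (Fin n)) (E' : Fin n → Fin n → Prop),
        (∀ u v : Fin n, E' u v → E u v ∧ u ∈ S ∧ v ∈ S) ∧
        (∀ v ∈ S, (n : ℝ) / 4 - ε * n ≤ (semiDeg E' v : ℝ)) ∧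
        (∃ f : Fin n → ZMod 4, ∀ u v : Fin n, E' u v → f v = f u + 1)) →
      HasDiCycle E ℓ := by
  have : NeZero ℓ := ⟨by omega⟩
  obtain ⟨n₀, hn₀⟩ := DiCycle.exists_cycle_of_semidegree ℓ hℓ h3 h4
  refine ⟨1, one_pos, n₀, fun n hn E hE hdeg _ => ?_⟩
  have hout : ∀ v, outDeg E v = (DiCycle.outN E v).card := fun v => by
    rw [outDeg, ← Set.ncard_coe_finset]
    congr 1
    ext
    simp
  have hin : ∀ v, inDeg E v = (DiCycle.inN E v).card := fun v => by
    rw [inDeg, ← Set.ncard_coe_finset]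
    congr 1
    ext
    simp
  have hsemi : ∀ v, n + (if ℓ % 4 = 3 then 1 else 2) ≤ 4 * semiDeg E v := by
    intro v
    have h := hdeg v
    have h' : (n : ℝ) + (if ℓ % 4 = 3 then 1 else 2) ≤ 4 * semiDeg E v := by
      split_ifs at h ⊢ <;> linarith
    split_ifs at h' ⊢ <;> exact_mod_cast h'
  have hle : ∀ v, (n + (if ℓ % 4 = 3 then 1 else 2) + 3) / 4 ≤ semiDeg E v := fun v => by
    have := hsemi v
    omega
  refine hn₀ (Fin n) E hE.2 (by simpa using hn) _ ?_
    (fun v => (hle v).trans ((min_le_left _ _).trans (hout v).le))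
    (fun v => (hle v).trans ((min_le_right _ _).trans (hin v).le))
  rw [Fintype.card_fin]
  omega
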